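/- arXiv:2012.15447 — 3 statements merged into one kernel-verified Lean document; each statement's English description precedes it below -/
import Mathlib

section
/- Let I_1 = B(x_{a_1}x_{b_1}, x_{c_1}x_{d_1}) and I_2 = B(x_{a_2}x_{b_2}, x_{c_2}x_{d_2}) be strongly stable ideals in S = K[x_1, …, x_n], where c_i < a_i ≤ b_i < d_i for i = 1, 2 and d_1 ≤ d_2, and let φ : S[T_u : u ∈ B_{M_1} ∪ B_{N_1}; Z_v : v ∈ B_{M_2} ∪ B_{N_2}] → S[t, z] be the S-algebra homomorphism with T_u ↦ u·t and Z_v ↦ v·z. Then there exists a monomial order on S[T_u, Z_v] for which the set of marked binomials { x_i T_u − x_j T_{u'} : i < j and x_i·u = x_j·u' } ∪ { x_i Z_v − x_j Z_{v'} : i < j and x_i·v = x_j·v' } ∪ G₁ ∪ G₂ ∪ G₃, where G₁ = { T_u T_v − T_{u'} T_{v'} : u·v = u'·v', u, v ≻_rlex v' }, G₂ = { Z_u Z_v − Z_{u'} Z_{v'} : u·v = u'·v', u, v ≻_mrlex v' }, and G₃ = { T_u Z_v − T_{u'} Z_{v'} : u·v = u'·v', v ≻_mrlex v' }, is a Gröbner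 basis of the defining ideal ker φ of the multi-Rees algebra R(I_1 ⊕ I_2), with the marked (first written) terms as initial terms; in particular, ker φ is generated by these quadratic binomials. -/
/-- A marked binomial: the difference of two monomials (given by exponent vectors),
with `head` chosen as the marked term. -/
structure MarkedBinomial (V : Type*) where
  head : V →₀ ℕ
  tail : V →₀ ℕ

/-- The polynomial associated to a marked binomial. -/
noncomputable def MarkedBinomial.toPoly {V : Type*} (K : Type*) [Field K]
    (g : MarkedBinomial V) : MvPolynomial V K :=
  MvPolynomial.monomial g.head 1 - MvPolynomial.monomial g.tail 1

/-- Transport a marked binomial along a map of variables. -/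
noncomputable def MarkedBinomial.map {V W : Type*} (f : V → W) (g : MarkedBinomial V) :
    MarkedBinomial W :=
  ⟨Finsupp.mapDomain f g.head, Finsupp.mapDomain f g.tail⟩

/-- A monomial order on the exponent vectors `V →₀ ℕ`: a strict total order, compatible
with addition, for which `1` (the zero exponent vector) is the smallest monomial. -/
structure MonomialOrd (V : Type*) where
  gt : (V →₀ ℕ) → (V →₀ ℕ) → Prop
  irrefl : ∀ m, ¬ gt m m
  trans : ∀ {m₁ m₂ m₃}, gt m₁ m₂ → gt m₂ m₃ → gt m₁ m₃
  total : ∀ m₁ m₂, m₁ ≠ m₂ → gt m₁ m₂ ∨ gt m₂ m₁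
  add_right : ∀ {m₁ m₂} (m₃), gt m₁ m₂ → gt (m₁ + m₃) (m₂ + m₃)
  gt_zero : ∀ m, m ≠ 0 → gt m 0

/-- `m` is the initial (leading) exponent of `f` with respect to the strict order `gt`. -/
def IsInitialTerm {V K : Type*} [Field K] (gt : (V →₀ ℕ) → (V →₀ ℕ) → Prop)
    (f : MvPolynomial V K) (m : V →₀ ℕ) : Prop :=
  m ∈ f.support ∧ ∀ m' ∈ f.support, m' ≠ m → gt m m'

/-- A set `G` of marked binomials is a Gröbner basis of the ideal `J` with respect to the
order `gt`, with the marked terms as initial terms: `G ⊆ J`, each marked term is the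
initial term of its binomial, and the marked terms generate the initial ideal of `J`. -/
def IsMarkedGB {V K : Type*} [Field K] (gt : (V →₀ ℕ) → (V →₀ ℕ) → Prop)
    (G : Set (MarkedBinomial V)) (J : Ideal (MvPolynomial V K)) : Prop :=
  (∀ g ∈ G, g.toPoly K ∈ J) ∧ (∀ g ∈ G, gt g.head g.tail) ∧
    Ideal.span ((fun g => (MvPolynomial.monomial g.head (1 : K) : MvPolynomial V K)) '' G) =
      Ideal.span {p : MvPolynomial V K |
        ∃ f ∈ J, f ≠ 0 ∧ ∃ m, IsInitialTerm gt f m ∧ p = MvPolynomial.monomial m (1 : K)}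

/-- One-step reduction of a monomial (exponent vector) with respect to a collection of
marked binomials: replace an occurrence of a marked term by the corresponding tail. -/
def Reduces {V : Type*} (G : Set (MarkedBinomial V)) (m m' : V →₀ ℕ) : Prop :=
  ∃ g ∈ G, g.head ≤ m ∧ m' = m - g.head + g.tail

/-- One-step reduction of a polynomial with respect to a collection of marked binomials. -/
noncomputable def PolyReduces {V K : Type*} [Field K] (G : Set (MarkedBinomial V))
    (f f' : MvPolynomial V K) : Prop :=
  ∃ g ∈ G, ∃ m ∈ f.support, g.head ≤ m ∧
    f' = f - MvPolynomial.monomial (m - g.head) (MvPolynomial.coeff m f) * g.toPoly K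

/-- The image monomial (in the `W`-variables) of a monomial `T` in the `V`-variables under
the monomial map sending the variable `v` to the monomial with exponent vector `u v`. -/
noncomputable def fiberMap {V W : Type*} (u : V → (W →₀ ℕ)) (T : V →₀ ℕ) : W →₀ ℕ :=
  T.sum fun v e => e • u v

/-- `T` is a sink of the fiber graph over the multidegree `μ` (with respect to the
marked binomials `G` and the monomial map determined by `u`): it lies in the fiber and
has no outgoing edge inside the fiber. -/
noncomputable def IsFiberSink {V W : Type*} (G : Set (MarkedBinomial V)) (u : V → (W →₀ ℕ))
    (μ : W →₀ ℕ) (T : V →₀ ℕ) : Prop :=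
  fiberMap u T = μ ∧ ∀ T', Reduces G T T' → fiberMap u T' ≠ μ

/-- `I` is a monomial ideal. -/
def IsMonomialIdeal {n : ℕ} {K : Type*} [Field K] (I : Ideal (MvPolynomial (Fin n) K)) : Prop :=
  ∃ M : Set (Fin n →₀ ℕ), I = Ideal.span ((fun m => (MvPolynomial.monomial m (1 : K))) '' M)

/-- `I` is a strongly stable (Borel) ideal: a monomial ideal such that whenever `x_i`
divides a monomial `m ∈ I` and `j < i`, also `x_j · m / x_i ∈ I`. -/
def StronglyStable {n : ℕ} {K : Type*} [Field K] (I : Ideal (MvPolynomial (Fin n) K)) : Prop :=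
  IsMonomialIdeal I ∧ ∀ m : Fin n →₀ ℕ, MvPolynomial.monomial m (1 : K) ∈ I →
    ∀ i j : Fin n, j < i → m i ≠ 0 →
      MvPolynomial.monomial (m - Finsupp.single i 1 + Finsupp.single j 1) (1 : K) ∈ I

/-- The smallest strongly stable ideal containing the given monomials. -/
noncomputable def smallestStronglyStable {n : ℕ} (K : Type*) [Field K]
    (Ms : Set (Fin n →₀ ℕ)) : Ideal (MvPolynomial (Fin n) K) :=
  sInf {I | StronglyStable I ∧ ∀ m ∈ Ms, MvPolynomial.monomial m (1 : K) ∈ I}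

/-- The minimal monomial generators of an ideal generated in the single degree `d`:
the degree-`d` monomials lying in `I`. -/
def MinGens {n : ℕ} {K : Type*} [Field K] (I : Ideal (MvPolynomial (Fin n) K)) (d : ℕ) :
    Set (Fin n →₀ ℕ) :=
  {m | (m.sum fun _ e => e) = d ∧ MvPolynomial.monomial m (1 : K) ∈ I}

/-- `u ≻_rlex v` (reverse lexicographic, `x_1 > … > x_n`, for exponent vectors of equal
total degree): at the largest index where they differ, `u` has the smaller exponent. -/
def RlexGt {n : ℕ} (u v : Fin n →₀ ℕ) : Prop :=
  ∃ k : Fin n, u k < v k ∧ ∀ l : Fin n, k < l → u l = v l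

/-- The (degree-)reverse lexicographic order on monomials of `K[V]` induced by the strict
variable order `vgt` (where `vgt k l` means the variable `k` is greater than `l`). -/
def VarRevlexGt {V : Type*} (vgt : V → V → Prop) (m m' : V →₀ ℕ) : Prop :=
  (m.sum fun _ e => e) > (m'.sum fun _ e => e) ∨
    ((m.sum fun _ e => e) = (m'.sum fun _ e => e) ∧
      ∃ k, m k < m' k ∧ ∀ l, vgt k l → m l = m' l)

/-- The minimal monomial generators of the strongly stable ideal `B(x_a x_b)` (`a ≤ b`):
the monomials `x_i x_j` with `i ≤ j`, `i ≤ a`, `j ≤ b`. -/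
def BM {n : ℕ} (a b : Fin n) : Set (Fin n →₀ ℕ) :=
  {m | ∃ i j : Fin n, i ≤ j ∧ i ≤ a ∧ j ≤ b ∧ m = Finsupp.single i 1 + Finsupp.single j 1}

/-- The minimal monomial generators of `B(x_c x_d)` not in `B(x_a x_b)` (for
`c < a ≤ b < d`): the monomials `x_i x_j` with `i ≤ c` and `b < j ≤ d`. -/
def BN {n : ℕ} (b c d : Fin n) : Set (Fin n →₀ ℕ) :=
  {m | ∃ i j : Fin n, i ≤ c ∧ b < j ∧ j ≤ d ∧ m = Finsupp.single i 1 + Finsupp.single j 1}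

/-- `u ≻_mrlex v`: every element of `B_N` is greater than every element of `B_M`, and
within `B_M` (resp. `B_N`) the order agrees with `≻_rlex`. -/
def MrlexGt {n : ℕ} (a b c d : Fin n) (u v : Fin n →₀ ℕ) : Prop :=
  (u ∈ BN b c d ∧ v ∈ BM a b) ∨ (u ∈ BM a b ∧ v ∈ BM a b ∧ RlexGt u v) ∨
    (u ∈ BN b c d ∧ v ∈ BN b c d ∧ RlexGt u v)

/-- The collection `G₁` of marked binomials `T_u T_v − T_{u'} T_{v'}` with `u v = u' v'`
and `u, v ≻_rlex v'`, marked at `T_u T_v`. -/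
def G1 {n : ℕ} (a b c d : Fin n) : Set (MarkedBinomial ↥(BM a b ∪ BN b c d)) :=
  {g | ∃ u v u' v' : ↥(BM a b ∪ BN b c d),
    (u : Fin n →₀ ℕ) + (v : Fin n →₀ ℕ) = (u' : Fin n →₀ ℕ) + (v' : Fin n →₀ ℕ) ∧
    RlexGt (u : Fin n →₀ ℕ) (v' : Fin n →₀ ℕ) ∧ RlexGt (v : Fin n →₀ ℕ) (v' : Fin n →₀ ℕ) ∧
    g.head = Finsupp.single u 1 + Finsupp.single v 1 ∧
    g.tail = Finsupp.single u' 1 + Finsupp.single v' 1}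

/-- The collection `G₂` of marked binomials `T_u T_v − T_{u'} T_{v'}` with `u v = u' v'`
and `u, v ≻_mrlex v'`, marked at `T_u T_v`. -/
def G2 {n : ℕ} (a b c d : Fin n) : Set (MarkedBinomial ↥(BM a b ∪ BN b c d)) :=
  {g | ∃ u v u' v' : ↥(BM a b ∪ BN b c d),
    (u : Fin n →₀ ℕ) + (v : Fin n →₀ ℕ) = (u' : Fin n →₀ ℕ) + (v' : Fin n →₀ ℕ) ∧
    MrlexGt a b c d (u : Fin n →₀ ℕ) (v' : Fin n →₀ ℕ) ∧
    MrlexGt a b c d (v : Fin n →₀ ℕ) (v' : Fin n →₀ ℕ) ∧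
    g.head = Finsupp.single u 1 + Finsupp.single v 1 ∧
    g.tail = Finsupp.single u' 1 + Finsupp.single v' 1}

/-- `w` is the smallest (with respect to the variable order induced by `≻_rlex`) variable
factor of the monomial `T` whose underlying monomial lies in `S`. -/
def IsLeastFactorIn {n : ℕ} {V : Set (Fin n →₀ ℕ)} (S : Set (Fin n →₀ ℕ))
    (T : ↥V →₀ ℕ) (w : ↥V) : Prop :=
  w ∈ T.support ∧ (w : Fin n →₀ ℕ) ∈ S ∧
    ∀ v ∈ T.support, (v : Fin n →₀ ℕ) ∈ S →
      v = w ∨ RlexGt (v : Fin n →₀ ℕ) (w : Fin n →₀ ℕ)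

/-- `m` is the `≻_rlex`-smallest element of `S` dividing `μ`. -/
def IsLeastDivisorIn {n : ℕ} (S : Set (Fin n →₀ ℕ)) (μ m : Fin n →₀ ℕ) : Prop :=
  m ∈ S ∧ m ≤ μ ∧ ∀ m' ∈ S, m' ≤ μ → m' = m ∨ RlexGt m' m

/-- The head and tail variable order on `T`-variables (indexed by `S₁`) and `Z`-variables
(indexed by `B_{M₂} ∪ B_{N₂}`): `T_u > T_v ⟺ u ≻_rlex v`, every `T`-variable is greater
than every `Z`-variable, and `Z_u > Z_v ⟺ u ≻_mrlex v`. -/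
def HTVarGt {n : ℕ} (a₂ b₂ c₂ d₂ : Fin n) (S₁ S₂ : Set (Fin n →₀ ℕ)) :
    (↥S₁ ⊕ ↥S₂) → (↥S₁ ⊕ ↥S₂) → Prop :=
  fun w w' =>
    match w, w' with
    | Sum.inl u, Sum.inl v => RlexGt (u : Fin n →₀ ℕ) (v : Fin n →₀ ℕ)
    | Sum.inl _, Sum.inr _ => True
    | Sum.inr _, Sum.inl _ => False
    | Sum.inr u, Sum.inr v => MrlexGt a₂ b₂ c₂ d₂ (u : Fin n →₀ ℕ) (v : Fin n →₀ ℕ)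

/-- The collection `G₃` of marked binomials `T_u Z_v − T_{u'} Z_{v'}` with
`u v = u' v'` and `v ≻_mrlex v'`, marked at `T_u Z_v`. -/
def G3TZ {n : ℕ} (a₁ b₁ c₁ d₁ a₂ b₂ c₂ d₂ : Fin n) :
    Set (MarkedBinomial (↥(BM a₁ b₁ ∪ BN b₁ c₁ d₁) ⊕ ↥(BM a₂ b₂ ∪ BN b₂ c₂ d₂))) :=
  {g | ∃ (u u' : ↥(BM a₁ b₁ ∪ BN b₁ c₁ d₁)) (v v' : ↥(BM a₂ b₂ ∪ BN b₂ c₂ d₂)),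
    (u : Fin n →₀ ℕ) + (v : Fin n →₀ ℕ) = (u' : Fin n →₀ ℕ) + (v' : Fin n →₀ ℕ) ∧
    MrlexGt a₂ b₂ c₂ d₂ (v : Fin n →₀ ℕ) (v' : Fin n →₀ ℕ) ∧
    g.head = Finsupp.single (Sum.inl u) 1 + Finsupp.single (Sum.inr v) 1 ∧
    g.tail = Finsupp.single (Sum.inl u') 1 + Finsupp.single (Sum.inr v') 1}

/-- The full marked collection `G = G₁ ∪ G₂ ∪ G₃` for the pair of strongly stable ideals
`I₁ = B(x_{a₁}x_{b₁}, x_{c₁}x_{d₁})` and `I₂ = B(x_{a₂}x_{b₂}, x_{c₂}x_{d₂})`, with `G₁`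
in the `T`-variables, `G₂` in the `Z`-variables, and `G₃` mixed. -/
noncomputable def GHT {n : ℕ} (a₁ b₁ c₁ d₁ a₂ b₂ c₂ d₂ : Fin n) :
    Set (MarkedBinomial (↥(BM a₁ b₁ ∪ BN b₁ c₁ d₁) ⊕ ↥(BM a₂ b₂ ∪ BN b₂ c₂ d₂))) :=
  (MarkedBinomial.map Sum.inl '' G1 a₁ b₁ c₁ d₁) ∪
    (MarkedBinomial.map Sum.inr '' G2 a₂ b₂ c₂ d₂) ∪
    G3TZ a₁ b₁ c₁ d₁ a₂ b₂ c₂ d₂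

/-- The monomial map sending `T_u ↦ u·t` and `Z_v ↦ v·z`, on the level of exponent
vectors, with `t, z` the two extra variables `Sum.inr 0`, `Sum.inr 1`. -/
noncomputable def TZexp {n : ℕ} (S₁ S₂ : Set (Fin n →₀ ℕ)) :
    (↥S₁ ⊕ ↥S₂) → ((Fin n ⊕ Fin 2) →₀ ℕ) :=
  Sum.elim
    (fun u => Finsupp.mapDomain Sum.inl (u : Fin n →₀ ℕ) +
      Finsupp.single (Sum.inr 0) 1)
    (fun v => Finsupp.mapDomain Sum.inl (v : Fin n →₀ ℕ) +
      Finsupp.single (Sum.inr 1) 1)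

section abstract

/-- The graded order on monomials in which, among monomials of equal degree, the one with the
smaller exponent at the smallest variable where they differ is the greater one. -/
noncomputable def gradedRevlexOrd (V : Type*) [LinearOrder V] : MonomialOrd V where
  gt m m' := m'.degree < m.degree ∨ (m.degree = m'.degree ∧ toLex m < toLex m')
  irrefl m h := by simp at h
  trans := by
    rintro m₁ m₂ m₃ (h | ⟨h, h'⟩) (k | ⟨k, k'⟩)
    · exact Or.inl (k.trans h)
    · exact Or.inl (k ▸ h)
    · exact Or.inl (h ▸ k)
    · exact Or.inr ⟨h.trans k, h'.trans k'⟩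
  total m₁ m₂ h := by
    rcases lt_trichotomy m₁.degree m₂.degree with hd | hd | hd
    · exact Or.inr (Or.inl hd)
    · rcases lt_or_gt_of_ne (toLex.injective.ne h) with hl | hl
      · exact Or.inl (Or.inr ⟨hd, hl⟩)
      · exact Or.inr (Or.inr ⟨hd.symm, hl⟩)
    · exact Or.inl (Or.inl hd)
  add_right := by
    rintro m₁ m₂ m₃ (h | ⟨h, h'⟩)
    · left
      simpa using h
    · right
      refine ⟨by simpa using h, ?_⟩
      rw [toLex_add, toLex_add]
      exact add_lt_add_left h' _
  gt_zero m h := by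
    left
    rw [map_zero]
    exact Nat.pos_of_ne_zero (by rwa [Ne, Finsupp.degree_eq_zero_iff])

/-- No marked term of `G` divides the monomial `m`. -/
def IsStandardMonomial {V : Type*} (G : Set (MarkedBinomial V)) (m : V →₀ ℕ) : Prop :=
  ∀ g ∈ G, ¬ g.head ≤ m

theorem IsStandardMonomial.mono {V : Type*} {G : Set (MarkedBinomial V)} {m m' : V →₀ ℕ}
    (h : IsStandardMonomial G m) (hm : m' ≤ m) : IsStandardMonomial G m' :=
  fun g hg hle => h g hg (hle.trans hm)

variable {V W K : Type*} [Field K] [LinearOrder V] {G : Set (MarkedBinomial V)}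
  {F : (V →₀ ℕ) →+ (W →₀ ℕ)} {φ : MvPolynomial V K →ₐ[K] MvPolynomial W K}

open MvPolynomial in
theorem exists_standard_sub_mem_span [Finite V] (K : Type*) [Field K]
    (hF : ∀ g ∈ G, F g.head = F g.tail) (hdeg : ∀ g ∈ G, g.head.degree = g.tail.degree)
    (hlex : ∀ g ∈ G, toLex g.head < toLex g.tail) (m : V →₀ ℕ) :
    ∃ m', IsStandardMonomial G m' ∧ F m' = F m ∧ (m' = m ∨ (gradedRevlexOrd V).gt m m') ∧
      (monomial m (1 : K) - monomial m' 1) ∈ Ideal.span ((fun g => g.toPoly K) '' G) := by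
  let A : Set (V →₀ ℕ) := {m' | m'.degree = m.degree ∧ F m' = F m ∧ toLex m ≤ toLex m' ∧
    (monomial m (1 : K) - monomial m' 1) ∈ Ideal.span ((fun g => g.toPoly K) '' G)}
  have hfin : A.Finite := by
    refine (Set.finite_Iic (Finsupp.equivFunOnFinite.symm fun _ : V => m.degree)).subset ?_
    intro m' hm' v
    rw [← hm'.1]
    exact Finsupp.le_degree v m'
  obtain ⟨m', ⟨h1, h2, h3, h4⟩, hmax⟩ :=
    Set.exists_max_image A toLex hfin ⟨m, rfl, rfl, le_rfl, by simp⟩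
  refine ⟨m', ?_, h2, ?_, h4⟩
  · intro g hg hle
    obtain ⟨r, rfl⟩ := exists_add_of_le hle
    have hlt : toLex (g.head + r) < toLex (g.tail + r) := by
      rw [toLex_add, toLex_add]
      exact add_lt_add_left (hlex g hg) _
    refine absurd (hmax (g.tail + r) ⟨?_, ?_, h3.trans hlt.le, ?_⟩) hlt.not_ge
    · rw [← h1, map_add, map_add, hdeg g hg]
    · rw [← h2, map_add, map_add, hF g hg]
    · have : (monomial m (1 : K) - monomial (g.tail + r) 1) =
          (monomial m (1 : K) - monomial (g.head + r) 1) + monomial r 1 * g.toPoly K := by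
        simp only [MarkedBinomial.toPoly, mul_sub, monomial_mul, one_mul, add_comm r]
        ring
      rw [this]
      exact add_mem h4 (Ideal.mul_mem_left _ _ (Ideal.subset_span ⟨g, hg, rfl⟩))
  · rcases eq_or_ne m' m with h | h
    · exact Or.inl h
    · exact Or.inr (Or.inr ⟨h1.symm, lt_of_le_of_ne h3 (toLex.injective.ne h.symm)⟩)

open MvPolynomial in
theorem exists_ne_mem_support_of_mem_ker (hφ : ∀ m c, φ (monomial m c) = monomial (F m) c)
    {f : MvPolynomial V K} (hf : φ f = 0) {m : V →₀ ℕ} (hm : m ∈ f.support) :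
    ∃ m' ∈ f.support, m' ≠ m ∧ F m' = F m := by
  classical
  by_contra! hcon
  have h : coeff (F m) (φ f) = coeff m f := by
    conv_lhs => rw [f.as_sum]
    simp only [map_sum, hφ, coeff_sum]
    rw [Finset.sum_eq_single m, coeff_monomial, if_pos rfl]
    · intro m' hm' hne
      rw [coeff_monomial, if_neg (hcon m' hm' hne)]
    · intro h
      exact absurd hm h
  rw [hf, coeff_zero] at h
  exact mem_support_iff.mp hm h.symm

open MvPolynomial in
theorem ker_eq_span_of_standard_unique [Finite V]
    (hφ : ∀ m c, φ (monomial m c) = monomial (F m) c)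
    (hF : ∀ g ∈ G, F g.head = F g.tail) (hdeg : ∀ g ∈ G, g.head.degree = g.tail.degree)
    (hlex : ∀ g ∈ G, toLex g.head < toLex g.tail)
    (huniq : ∀ m m', IsStandardMonomial G m → IsStandardMonomial G m' → F m = F m' → m = m') :
    RingHom.ker φ.toRingHom = Ideal.span ((fun g => g.toPoly K) '' G) := by
  have hle : Ideal.span ((fun g => g.toPoly K) '' G) ≤ RingHom.ker φ.toRingHom := by
    rw [Ideal.span_le]
    rintro _ ⟨g, hg, rfl⟩
    change φ (g.toPoly K) = 0
    rw [MarkedBinomial.toPoly, map_sub, hφ, hφ, hF g hg, sub_self]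
  refine le_antisymm (fun f hf => ?_) hle
  choose nf hirr hfib hgt hmem using exists_standard_sub_mem_span K hF hdeg hlex
  have key : f - ∑ m ∈ f.support, monomial (nf m) (coeff m f) ∈
      Ideal.span ((fun g => g.toPoly K) '' G) := by
    nth_rw 1 [f.as_sum]
    rw [← Finset.sum_sub_distrib]
    refine sum_mem fun m _ => ?_
    have : (monomial m (coeff m f) - monomial (nf m) (coeff m f)) =
        C (coeff m f) * (monomial m (1 : K) - monomial (nf m) 1) := by
      rw [mul_sub, C_mul_monomial, C_mul_monomial, mul_one]
    rw [this]
    exact Ideal.mul_mem_left _ _ (hmem m)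
  have hzero : ∑ m ∈ f.support, monomial (nf m) (coeff m f) = 0 := by
    by_contra hne
    obtain ⟨m, hm⟩ := support_nonempty.mpr hne
    have hker : φ (∑ m ∈ f.support, monomial (nf m) (coeff m f)) = 0 := by
      have h1 : φ (f - ∑ m ∈ f.support, monomial (nf m) (coeff m f)) = 0 := hle key
      have h2 : φ f = 0 := hf
      rwa [map_sub, h2, zero_sub, neg_eq_zero] at h1
    have hsupp : ∀ m ∈ (∑ m ∈ f.support, monomial (nf m) (coeff m f)).support,
        IsStandardMonomial G m := by
      intro m hm
      obtain ⟨m₀, _, hm₀⟩ := Finset.mem_biUnion.mp (support_sum hm)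
      rw [Finset.mem_singleton.mp (support_monomial_subset hm₀)]
      exact hirr m₀
    obtain ⟨m', hm', hne', hFm⟩ := exists_ne_mem_support_of_mem_ker hφ hker hm
    exact hne' (huniq _ _ (hsupp _ hm') (hsupp _ hm) hFm)
  rwa [hzero, sub_zero] at key

open MvPolynomial in
theorem isMarkedGB_of_standard_unique [Finite V]
    (hφ : ∀ m c, φ (monomial m c) = monomial (F m) c)
    (hF : ∀ g ∈ G, F g.head = F g.tail) (hdeg : ∀ g ∈ G, g.head.degree = g.tail.degree)
    (hlex : ∀ g ∈ G, toLex g.head < toLex g.tail)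
    (huniq : ∀ m m', IsStandardMonomial G m → IsStandardMonomial G m' → F m = F m' → m = m') :
    IsMarkedGB (gradedRevlexOrd V).gt G (RingHom.ker φ.toRingHom) := by
  have hmem : ∀ g ∈ G, g.toPoly K ∈ RingHom.ker φ.toRingHom := by
    intro g hg
    change φ (g.toPoly K) = 0
    rw [MarkedBinomial.toPoly, map_sub, hφ, hφ, hF g hg, sub_self]
  have hgt : ∀ g ∈ G, (gradedRevlexOrd V).gt g.head g.tail := fun g hg =>
    Or.inr ⟨hdeg g hg, hlex g hg⟩
  refine ⟨hmem, hgt, le_antisymm (Ideal.span_mono ?_) (Ideal.span_le.mpr ?_)⟩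
  · rintro _ ⟨g, hg, rfl⟩
    have hne : g.tail ≠ g.head := fun h => (hlex g hg).ne (congrArg toLex h.symm)
    have hhead : coeff g.head (g.toPoly K) = 1 := by
      simp [MarkedBinomial.toPoly, coeff_monomial, hne]
    refine ⟨g.toPoly K, hmem g hg, ?_, g.head, ⟨?_, ?_⟩, rfl⟩
    · intro h
      simp [h] at hhead
    · rw [mem_support_iff, hhead]
      exact one_ne_zero
    · intro m hm hne'
      rw [mem_support_iff, MarkedBinomial.toPoly, coeff_sub, coeff_monomial, coeff_monomial,
        if_neg (Ne.symm hne')] at hm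
      by_cases h : g.tail = m
      · exact h ▸ hgt g hg
      · simp [h] at hm
  · rintro _ ⟨f, hf, -, m, ⟨hm, hlead⟩, rfl⟩
    by_cases hirr : IsStandardMonomial G m
    · obtain ⟨m', hm', hne, hFm⟩ := exists_ne_mem_support_of_mem_ker hφ hf hm
      obtain ⟨m'', h1, h2, h3, -⟩ := exists_standard_sub_mem_span K hF hdeg hlex m'
      have := huniq _ _ h1 hirr (h2.trans hFm)
      subst this
      have hlt := hlead m' hm' hne
      rcases h3 with h3 | h3
      · exact absurd h3.symm hne
      · exact absurd ((gradedRevlexOrd V).trans hlt h3) ((gradedRevlexOrd V).irrefl _)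
    · simp only [IsStandardMonomial, not_forall, not_not] at hirr
      obtain ⟨g, hg, hle⟩ := hirr
      obtain ⟨r, rfl⟩ := exists_add_of_le hle
      have : (monomial (g.head + r) (1 : K)) = monomial r 1 * monomial g.head 1 := by
        rw [monomial_mul, one_mul, add_comm]
      rw [this]
      exact Ideal.mul_mem_left _ _ (Ideal.subset_span ⟨g, hg, rfl⟩)

theorem toLex_add_single_lt {p q r s : V} (hp : s < p) (hq : s < q) :
    toLex (Finsupp.single p 1 + Finsupp.single q 1 : V →₀ ℕ) <
      toLex (Finsupp.single r 1 + Finsupp.single s 1) := by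
  rw [Finsupp.Lex.lt_iff]
  refine ⟨min r s, fun w hw => ?_, ?_⟩
  · obtain ⟨h1, h2⟩ := lt_min_iff.mp hw
    change (Finsupp.single p 1 + Finsupp.single q 1 : V →₀ ℕ) w =
      (Finsupp.single r 1 + Finsupp.single s 1 : V →₀ ℕ) w
    simp [(h2.trans hp).ne', (h2.trans hq).ne', h1.ne', h2.ne']
  · change (Finsupp.single p 1 + Finsupp.single q 1 : V →₀ ℕ) (min r s) <
      (Finsupp.single r 1 + Finsupp.single s 1 : V →₀ ℕ) (min r s)
    have h1 : p ≠ min r s := ((min_le_right r s).trans_lt hp).ne'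
    have h2 : q ≠ min r s := ((min_le_right r s).trans_lt hq).ne'
    rcases min_choice r s with h | h <;> rw [h] at h1 h2 ⊢ <;>
      simp [Finsupp.single_apply, h1, h2]

end abstract

/-- The pair `x_i x_j` is a generator of `B(x_a x_b)`. -/
def PairM (a b i j : ℕ) : Prop := (i ≤ a ∨ j ≤ a) ∧ i ≤ b ∧ j ≤ b

/-- The pair `x_i x_j` is a generator of `B(x_c x_d)` outside `B(x_a x_b)`. -/
def PairN (b c d i j : ℕ) : Prop := (i ≤ c ∧ b < j ∧ j ≤ d) ∨ (j ≤ c ∧ b < i ∧ i ≤ d)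

/-- The pair `x_i x_j` is a generator of `B(x_a x_b, x_c x_d)`. -/
def PairE (a b c d i j : ℕ) : Prop := PairM a b i j ∨ PairN b c d i j

/-- The pair `x_i x_j` is greater than `x_k x_l` in the reverse lexicographic order. -/
def PairGt (i j k l : ℕ) : Prop :=
  max i j < max k l ∨ (max i j = max k l ∧ min i j < min k l)

/-- A weight `g` on the indices certifying that no arrangement of the given multidegree uses a
pair of `B(x_{a₂} x_{b₂})` in its `Z`-part. -/
def HasSeparatingWeight (a₁ b₁ c₁ d₁ a₂ b₂ c₂ d₂ : ℕ)
    (T1 : ℕ → ℕ → Prop) (T2 : ℕ → ℕ → ℕ → ℕ → Prop) (Z1 : ℕ → ℕ → Prop) : Prop :=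
  ∃ (g : ℕ → ℤ) (tT tZ δ : ℤ), (∀ x y, PairE a₁ b₁ c₁ d₁ x y → g x + g y ≤ tT) ∧
    (∀ x y, PairN b₂ c₂ d₂ x y → g x + g y ≤ tZ) ∧
    (∀ x y, PairM a₂ b₂ x y → g x + g y ≤ tZ - δ) ∧
    (∀ x y, Z1 x y → tZ ≤ g x + g y) ∧ 1 ≤ δ ∧
    ((∀ x y, T1 x y → tT ≤ g x + g y) ∨
      (2 ≤ δ ∧ ∃ x₀ y₀, T1 x₀ y₀ ∧ tT - 1 ≤ g x₀ + g y₀ ∧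
        ∀ z w, T2 x₀ y₀ z w → tT ≤ g z + g w))

section weights

variable {a₁ b₁ c₁ d₁ a₂ b₂ c₂ d₂ i κ : ℕ} {T1 : ℕ → ℕ → Prop}
  {T2 : ℕ → ℕ → ℕ → ℕ → Prop} {Z1 : ℕ → ℕ → Prop}

theorem hasSeparatingWeight_of_lt (h11 : c₁ < a₁) (h12 : a₁ ≤ b₁) (h13 : b₁ < d₁)
    (h21 : c₂ < a₂) (h22 : a₂ ≤ b₂) (hκ : b₂ < κ)
    (hZ1 : ∀ x y, Z1 x y → (i ≤ x ∧ κ ≤ y) ∨ (i ≤ y ∧ κ ≤ x)) (hκd : d₁ < κ) :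
    HasSeparatingWeight a₁ b₁ c₁ d₁ a₂ b₂ c₂ d₂ T1 T2 Z1 := by
  refine ⟨fun x => if κ ≤ x then 1 else 0, 0, 1, 1, ?_, ?_, ?_, ?_, le_rfl, Or.inl ?_⟩ <;>
    intro x y h <;> dsimp only
  · unfold PairE PairM PairN at h; split_ifs <;> omega
  · unfold PairN at h; split_ifs <;> omega
  · unfold PairM at h; split_ifs <;> omega
  · have := hZ1 x y h; split_ifs <;> omega
  · split_ifs <;> omega

theorem hasSeparatingWeight_of_forall_gt (h21 : c₂ < a₂) (h22 : a₂ ≤ b₂) (hκ : b₂ < κ)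
    (hZ1 : ∀ x y, Z1 x y → (i ≤ x ∧ κ ≤ y) ∨ (i ≤ y ∧ κ ≤ x))
    (hK : ∀ x y, T1 x y → b₂ < x ∧ b₂ < y) :
    HasSeparatingWeight a₁ b₁ c₁ d₁ a₂ b₂ c₂ d₂ T1 T2 Z1 := by
  refine ⟨fun x => if b₂ < x then 1 else 0, 2, 1, 1, ?_, ?_, ?_, ?_, le_rfl, Or.inl ?_⟩ <;>
    intro x y h <;> dsimp only
  · split_ifs <;> omega
  · unfold PairN at h; split_ifs <;> omega
  · unfold PairM at h; split_ifs <;> omega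
  · have := hZ1 x y h; split_ifs <;> omega
  · have := hK x y h
    split_ifs <;> omega

theorem hasSeparatingWeight_of_forall_or (h11 : c₁ < a₁)
    (h21 : c₂ < a₂) (h22 : a₂ ≤ b₂) (hκ : b₂ < κ) (hκa : a₁ < κ)
    (hZ1 : ∀ x y, Z1 x y → (i ≤ x ∧ κ ≤ y) ∨ (i ≤ y ∧ κ ≤ x))
    (hA : ∀ x y, T1 x y → (a₁ < x ∧ b₂ < x) ∨ (a₁ < y ∧ b₂ < y)) :
    HasSeparatingWeight a₁ b₁ c₁ d₁ a₂ b₂ c₂ d₂ T1 T2 Z1 := by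
  refine ⟨fun x => if a₁ < x ∧ b₂ < x then 1 else 0, 1, 1, 1, ?_, ?_, ?_, ?_, le_rfl,
    Or.inl ?_⟩ <;> intro x y h <;> dsimp only
  · unfold PairE PairM PairN at h; split_ifs <;> omega
  · unfold PairN at h; split_ifs <;> omega
  · unfold PairM at h; split_ifs <;> omega
  · have := hZ1 x y h; split_ifs <;> omega
  · have := hA x y h; split_ifs <;> omega

theorem hasSeparatingWeight_of_exceptional (h11 : c₁ < a₁) (h12 : a₁ ≤ b₁)
    (h21 : c₂ < a₂) (h22 : a₂ ≤ b₂) (hκ : b₂ < κ) (hκb : b₁ < κ)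
    (hZ1 : ∀ x y, Z1 x y → (i ≤ x ∧ κ ≤ y) ∨ (i ≤ y ∧ κ ≤ x))
    {x₀ s₀ : ℕ} (h₀ : T1 x₀ s₀) (hs : b₂ < s₀ ∧ c₁ < s₀)
    (hB : ∀ z w, T2 x₀ s₀ z w →
      (b₂ < z ∧ c₁ < z ∧ b₂ < w ∧ c₁ < w) ∨ (b₁ < z ∧ b₂ < z) ∨ (b₁ < w ∧ b₂ < w)) :
    HasSeparatingWeight a₁ b₁ c₁ d₁ a₂ b₂ c₂ d₂ T1 T2 Z1 := by
  refine ⟨fun x => (if b₂ < x ∧ c₁ < x then 1 else 0) +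
    (if b₁ < x ∧ b₂ < x then 1 else 0), 2, 2, 2,
    ?_, ?_, ?_, ?_, by norm_num, Or.inr ⟨le_rfl, x₀, s₀, h₀, ?_, ?_⟩⟩
  · intro x y h; unfold PairE PairM PairN at h; dsimp only; split_ifs <;> omega
  · intro x y h; unfold PairN at h; dsimp only; split_ifs <;> omega
  · intro x y h; unfold PairM at h; dsimp only; split_ifs <;> omega
  · intro x y h; have := hZ1 x y h; dsimp only; split_ifs <;> omega
  · dsimp only; split_ifs <;> omega
  · intro x y h; have := hB x y h; dsimp only; split_ifs <;> omega

theorem hasSeparatingWeight_of_lt_left (h11 : c₁ < a₁) (h12 : a₁ ≤ b₁)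
    (h21 : c₂ < a₂) (h22 : a₂ ≤ b₂) (hκ : b₂ < κ) (hκb : b₁ < κ) (hi : c₁ < i)
    (hZ1 : ∀ x y, Z1 x y → (i ≤ x ∧ κ ≤ y) ∨ (i ≤ y ∧ κ ≤ x))
    (hA : ∀ x y, T1 x y → (c₁ < x ∧ c₁ < y) ∨ (c₁ < y ∧ b₁ < y ∧ b₂ < y) ∨
      (c₁ < x ∧ b₁ < x ∧ b₂ < x)) :
    HasSeparatingWeight a₁ b₁ c₁ d₁ a₂ b₂ c₂ d₂ T1 T2 Z1 := by
  refine ⟨fun x => (if b₁ < x ∧ b₂ < x then 1 else 0) - (if x ≤ c₁ then 1 else 0), 0, 1, 1,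
    ?_, ?_, ?_, ?_, le_rfl, Or.inl ?_⟩ <;> intro x y h <;> dsimp only
  · unfold PairE PairM PairN at h; split_ifs <;> omega
  · unfold PairN at h; split_ifs <;> omega
  · unfold PairM at h; split_ifs <;> omega
  · have := hZ1 x y h; split_ifs <;> omega
  · have := hA x y h; split_ifs <;> omega

theorem hasSeparatingWeight_of_two (h11 : c₁ < a₁) (h12 : a₁ ≤ b₁)
    (h21 : c₂ < a₂) (h22 : a₂ ≤ b₂) (hκ : b₂ < κ) (hκb : b₁ < κ)
    (hZ1 : ∀ x y, Z1 x y → (i ≤ x ∧ κ ≤ y) ∨ (i ≤ y ∧ κ ≤ x))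
    (hA : ∀ x y, T1 x y → (a₂ < x ∧ c₁ < x ∧ a₂ < y ∧ c₁ < y) ∨ (b₁ < x ∧ b₂ < x) ∨
      (b₁ < y ∧ b₂ < y)) :
    HasSeparatingWeight a₁ b₁ c₁ d₁ a₂ b₂ c₂ d₂ T1 T2 Z1 := by
  refine ⟨fun x => (if a₂ < x ∧ c₁ < x then 1 else 0) + (if b₁ < x ∧ b₂ < x then 1 else 0),
    2, 2, 1, ?_, ?_, ?_, ?_, le_rfl, Or.inl ?_⟩ <;> intro x y h <;> dsimp only
  · unfold PairE PairM PairN at h; split_ifs <;> omega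
  · unfold PairN at h; split_ifs <;> omega
  · unfold PairM at h; split_ifs <;> omega
  · have := hZ1 x y h; split_ifs <;> omega
  · have := hA x y h; split_ifs <;> omega

set_option maxHeartbeats 1000000 in
theorem hasSeparatingWeight
    (h11 : c₁ < a₁) (h12 : a₁ ≤ b₁) (h13 : b₁ < d₁) (h21 : c₂ < a₂) (h22 : a₂ ≤ b₂)
    (hκ : b₂ < κ) (hZ1 : ∀ x y, Z1 x y → (i ≤ x ∧ κ ≤ y) ∨ (i ≤ y ∧ κ ≤ x))
    (hT1 : ∀ x y, T1 x y → PairE a₁ b₁ c₁ d₁ x y)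
    (symm : ∀ x y, T1 x y → T1 y x)
    (hT21 : ∀ x y z w, T2 x y z w → T1 z w)
    (dich : ∀ x y z w, T1 x y → T1 z w →
      (x = z ∧ y = w) ∨ (x = w ∧ y = z) ∨ T2 x y z w)
    (hT2 : ∀ x y z w, T2 x y z w → ∀ p q r s, (p = x ∧ q = y ∨ p = y ∧ q = x) →
      (r = z ∧ s = w ∨ r = w ∧ s = z) →
      ¬ (PairE a₁ b₁ c₁ d₁ p r ∧ PairE a₁ b₁ c₁ d₁ q s ∧ q < r ∧ s < p))
    (hle : ∀ x s, T1 x s → s ≤ κ)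
    (hTZ : ∀ x s, T1 x s → x ≤ b₂ → ¬ PairE a₁ b₁ c₁ d₁ κ s)
    (hTZM : ∀ x s, T1 x s → PairM a₂ b₂ x s → ¬ PairE a₁ b₁ c₁ d₁ i κ) :
    HasSeparatingWeight a₁ b₁ c₁ d₁ a₂ b₂ c₂ d₂ T1 T2 Z1 := by
  unfold PairE PairM PairN at hT1 hTZ
  unfold PairE PairM PairN at hT2
  by_cases hκd : d₁ < κ
  · exact hasSeparatingWeight_of_lt h11 h12 h13 h21 h22 hκ hZ1 hκd
  by_cases hK : ∀ x y, T1 x y → b₂ < x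
  · exact hasSeparatingWeight_of_forall_gt h21 h22 hκ hZ1
      fun x y h => ⟨hK x y h, hK y x (symm x y h)⟩
  push Not at hK
  obtain ⟨x₀, s₀, h₀, hx₀⟩ := hK
  have f₀ := hTZ _ _ h₀ hx₀
  have l₀ := hle _ _ h₀
  have e₀ := hT1 _ _ h₀
  have f₀' := hTZ _ _ (symm _ _ h₀)
  have hκa : a₁ < κ := by omega
  have certA := hasSeparatingWeight_of_forall_or (T1 := T1) (T2 := T2) (d₁ := d₁) (d₂ := d₂)
    (b₁ := b₁) h11 h21 h22 hκ hκa hZ1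
  by_cases hκb : κ ≤ b₁
  · apply certA
    intro y z h
    have e := hT1 _ _ h
    have l1 := hle _ _ h
    have l2 := hle _ _ (symm _ _ h)
    have f1 := hTZ _ _ h
    have f2 := hTZ _ _ (symm _ _ h)
    by_contra hcon
    rcases dich _ _ _ _ h₀ h with ⟨rfl, rfl⟩ | ⟨rfl, rfl⟩ | h2
    · omega
    · omega
    · have g1 := hT2 _ _ _ _ h2 s₀ x₀ y z (by omega) (by omega)
      clear hT2
      omega
  push Not at hκb hκd
  have e₀ : c₁ < s₀ := by omega
  have e₁ : s₀ ≤ b₂ → c₁ < x₀ := by omega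
  have hTZ' : ∀ x s, T1 x s → x ≤ b₂ → c₁ < s := by
    intro x s h hx
    have := hTZ x s h hx
    omega
  have e := hT1 _ _ h₀
  have hcc : ∀ y z, T1 y z → c₁ < y ∨ c₁ < z := by
    intro y z h
    have f1 := hTZ' _ _ h
    have f2 := hTZ' _ _ (symm _ _ h)
    by_contra hcon
    rcases dich _ _ _ _ h₀ h with ⟨rfl, rfl⟩ | ⟨rfl, rfl⟩ | h2
    · omega
    · omega
    · have g1 := hT2 _ _ _ _ h2 s₀ x₀ y z (by omega) (by omega)
      clear hT2
      omega
  have certB {x₀ s₀} := hasSeparatingWeight_of_exceptional (x₀ := x₀) (s₀ := s₀)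
    (T1 := T1) (T2 := T2) (d₁ := d₁) (d₂ := d₂)
    h11 h12 h21 h22 hκ hκb hZ1
  clear f₀ f₀' hTZ
  by_cases hA : ∃ x s, T1 x s ∧ x ≤ c₁ ∧ s ≤ b₁
  · obtain ⟨x, s, h, hx, hs⟩ := hA
    have hcs := (hcc _ _ h)
    have hbs : b₂ < s := by
      by_contra hcon
      have := hTZ' _ _ (symm _ _ h) (by omega)
      omega
    by_cases hsa : a₁ < s
    · apply certA
      intro y z h'
      have f1 := hTZ' _ _ h'
      have f2 := hTZ' _ _ (symm _ _ h')
      have f3 := hcc _ _ h'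
      have e' := hT1 _ _ h'
      by_contra hcon
      rcases dich _ _ _ _ h h' with ⟨rfl, rfl⟩ | ⟨rfl, rfl⟩ | h2
      · omega
      · omega
      · have g1 := hT2 _ _ _ _ h2 s x y z (by omega) (by omega)
        have g2 := hT2 _ _ _ _ h2 s x z y (by omega) (by omega)
        clear hT2
        omega
    · refine certB h ⟨hbs, by omega⟩ ?_
      intro z w h2
      have h' := hT21 _ _ _ _ h2
      have f1 := hTZ' _ _ h'
      have f2 := hTZ' _ _ (symm _ _ h')
      have f3 := hcc _ _ h'
      have e' := hT1 _ _ h'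
      have g1 := hT2 _ _ _ _ h2 s x z w (by omega) (by omega)
      have g2 := hT2 _ _ _ _ h2 s x w z (by omega) (by omega)
      clear hT2
      by_contra hcon
      omega
  have hA' : ∀ x s, T1 x s → x ≤ c₁ → b₁ < s ∧ b₂ < s ∧ c₁ < s := by
    intro x s h hx
    have hs : b₁ < s := by
      by_contra hcon
      exact hA ⟨x, s, h, hx, by omega⟩
    have := hTZ' _ _ (symm _ _ h)
    omega
  clear hA
  by_cases hi : c₁ < i
  · apply hasSeparatingWeight_of_lt_left h11 h12 h21 h22 hκ hκb hi hZ1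
    intro x y h
    have := hA' _ _ h
    have := hA' _ _ (symm _ _ h)
    omega
  by_cases hB : ∃ x s, T1 x s ∧ c₁ < x ∧ x ≤ a₂ ∧ b₂ < s ∧ s ≤ b₁
  · obtain ⟨x, s, h, hx, hxa, hsb, hs⟩ := hB
    by_cases hC : ∃ x s, T1 x s ∧ c₁ < x ∧ x ≤ b₂ ∧ b₂ < s ∧ s ≤ a₁
    · obtain ⟨x', s', h', hx', hxb', hsb', hs'⟩ := hC
      refine certB h' ⟨hsb', by omega⟩ ?_
      intro z w h2
      have h'' := hT21 _ _ _ _ h2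
      have f1 := hTZ' _ _ h''
      have f2 := hTZ' _ _ (symm _ _ h'')
      have f3 := hA' _ _ h''
      have f4 := hA' _ _ (symm _ _ h'')
      have e' := hT1 _ _ h''
      have e'' := hT1 _ _ h'
      have g1 := hT2 _ _ _ _ h2 s' x' z w (by omega) (by omega)
      have g2 := hT2 _ _ _ _ h2 s' x' w z (by omega) (by omega)
      have m1 := hTZM _ _ h''
      have l'' := hle _ _ h''
      unfold PairM PairE PairN at m1
      by_contra hcon
      rcases dich _ _ _ _ h h'' with ⟨rfl, rfl⟩ | ⟨rfl, rfl⟩ | h3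
      · clear hT2
        omega
      · clear hT2
        omega
      · have g3 := hT2 _ _ _ _ h3 s x z w (by omega) (by omega)
        have g4 := hT2 _ _ _ _ h3 s x w z (by omega) (by omega)
        clear hT2
        have hz : z ≤ b₂ ∨ w ≤ b₂ := by omega
        have hw : c₁ < z ∧ c₁ < w := by omega
        rcases hz with hz | hz
        · by_cases hwb : w ≤ b₂
          · omega
          · omega
        · by_cases hzb : z ≤ b₂
          · omega
          · omega
    · apply certA
      have hC' : ∀ x s, T1 x s → c₁ < x → x ≤ b₂ → b₂ < s → a₁ < s := by
        intro x s h h1 h2 h3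
        by_contra hcon
        exact hC ⟨x, s, h, h1, h2, h3, by omega⟩
      have hsa := hC' _ _ h hx (by omega) hsb
      intro y z h'
      have f1 := hTZ' _ _ h'
      have f2 := hTZ' _ _ (symm _ _ h')
      have f3 := hA' _ _ h'
      have f4 := hA' _ _ (symm _ _ h')
      have f5 := hC' _ _ h'
      have f6 := hC' _ _ (symm _ _ h')
      have e' := hT1 _ _ h'
      have m1 := hTZM _ _ h'
      unfold PairM PairE PairN at m1
      by_contra hcon
      rcases dich _ _ _ _ h h' with ⟨rfl, rfl⟩ | ⟨rfl, rfl⟩ | h2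
      · omega
      · omega
      · have g1 := hT2 _ _ _ _ h2 s x y z (by omega) (by omega)
        have g2 := hT2 _ _ _ _ h2 s x z y (by omega) (by omega)
        clear hT2
        omega
  · apply hasSeparatingWeight_of_two h11 h12 h21 h22 hκ hκb hZ1
    have hB' : ∀ x s, T1 x s → c₁ < x → x ≤ a₂ → b₂ < s → b₁ < s := by
      intro x s h h1 h2 h3
      by_contra hcon
      exact hB ⟨x, s, h, h1, h2, h3, by omega⟩
    intro y z h'
    have f1 := hTZ' _ _ h'
    have f2 := hTZ' _ _ (symm _ _ h')
    have f3 := hA' _ _ h'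
    have f4 := hA' _ _ (symm _ _ h')
    have f5 := hB' _ _ h'
    have f6 := hB' _ _ (symm _ _ h')
    have m1 := hTZM _ _ h'
    clear hT2
    unfold PairM PairE PairN at m1
    by_contra hcon
    have hw : c₁ < y ∧ c₁ < z := by omega
    by_cases hy : y ≤ b₂ <;> by_cases hz : z ≤ b₂ <;> omega

end weights

section edges

variable {n : ℕ}

/-- The exponent vector of the quadratic monomial `x_i x_j`. -/
noncomputable def edge (i j : Fin n) : Fin n →₀ ℕ :=
  Finsupp.single i 1 + Finsupp.single j 1

theorem edge_comm (i j : Fin n) : edge i j = edge j i := add_comm _ _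

theorem edge_eq_edge_iff {i j k l : Fin n} :
    edge i j = edge k l ↔ (i = k ∧ j = l) ∨ (i = l ∧ j = k) := by
  unfold edge
  rw [Finsupp.single_add_single_eq_single_add_single one_ne_zero one_ne_zero]
  simp only [true_and]
  omega

theorem edge_apply (i j k : Fin n) :
    edge i j k = (if i = k then 1 else 0) + (if j = k then 1 else 0) := by
  simp [edge, Finsupp.single_apply]

theorem edge_mem_BM {a b i j : Fin n} (hab : a ≤ b) : edge i j ∈ BM a b ↔ PairM a b i j := by
  unfold PairM
  constructor
  · rintro ⟨k, l, h1, h2, h3, h⟩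
    have := edge_eq_edge_iff.mp (show edge i j = edge k l from h)
    omega
  · intro h
    rcases le_total i j with hij | hij
    · exact ⟨i, j, hij, by omega, by omega, rfl⟩
    · exact ⟨j, i, hij, by omega, by omega, edge_comm i j⟩

theorem edge_mem_BN {b c d i j : Fin n} : edge i j ∈ BN b c d ↔ PairN b c d i j := by
  unfold PairN
  constructor
  · rintro ⟨k, l, h1, h2, h3, h⟩
    have := edge_eq_edge_iff.mp (show edge i j = edge k l from h)
    omega
  · rintro (h | h)
    · exact ⟨i, j, by omega, by omega, by omega, rfl⟩
    · exact ⟨j, i, by omega, by omega, by omega, edge_comm i j⟩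

theorem edge_mem {a b c d i j : Fin n} (hab : a ≤ b) :
    edge i j ∈ BM a b ∪ BN b c d ↔ PairE a b c d i j := by
  rw [Set.mem_union, edge_mem_BM hab, edge_mem_BN, PairE]

theorem exists_eq_edge {a b c d : Fin n} (hcb : c ≤ b) {u : Fin n →₀ ℕ}
    (hu : u ∈ BM a b ∪ BN b c d) : ∃ i j, i ≤ j ∧ u = edge i j := by
  rcases hu with ⟨i, j, h1, -, -, rfl⟩ | ⟨i, j, h1, h2, -, rfl⟩
  · exact ⟨i, j, h1, rfl⟩
  · exact ⟨i, j, (h1.trans hcb).trans h2.le, rfl⟩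

theorem notMem_BM_of_mem_BN {a b c d : Fin n} (hab : a ≤ b)
    {u : Fin n →₀ ℕ} (hu : u ∈ BN b c d) : u ∉ BM a b := by
  obtain ⟨i, j, h1, h2, h3, rfl⟩ := hu
  change edge i j ∉ BM a b
  rw [edge_mem_BM hab, PairM]
  omega

theorem rlexGt_edge_of_le {i j k l : Fin n} (hij : i ≤ j) (hkl : k ≤ l)
    (h : j < l ∨ (j = l ∧ i < k)) : RlexGt (edge i j) (edge k l) := by
  rcases h with h | ⟨rfl, h⟩
  · refine ⟨l, ?_, fun m hm => ?_⟩ <;> simp only [edge_apply] <;> split_ifs <;> omega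
  · refine ⟨k, ?_, fun m hm => ?_⟩ <;> simp only [edge_apply] <;> split_ifs <;> omega

theorem rlexGt_edge {i j k l : Fin n} (h : PairGt i j k l) : RlexGt (edge i j) (edge k l) := by
  unfold PairGt at h
  rcases le_total i j with hij | hij <;> rcases le_total k l with hkl | hkl
  · exact rlexGt_edge_of_le hij hkl (by omega)
  · exact edge_comm k l ▸ rlexGt_edge_of_le hij hkl (by omega)
  · exact edge_comm i j ▸ rlexGt_edge_of_le hij hkl (by omega)
  · exact edge_comm i j ▸ edge_comm k l ▸ rlexGt_edge_of_le hij hkl (by omega)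

theorem exists_swap_of_lt {a b c d : Fin n} (hca : c < a) (hab : a ≤ b) {u : Fin n →₀ ℕ}
    (hu : u ∈ BM a b ∪ BN b c d) {k y : Fin n} (hk : 0 < u k) (hy : y < k) :
    ∃ u' ∈ BM a b ∪ BN b c d, Finsupp.single y 1 + u = Finsupp.single k 1 + u' := by
  obtain ⟨i, j, -, rfl⟩ := exists_eq_edge (hca.le.trans hab) hu
  rw [edge_apply] at hk
  rw [edge_mem hab] at hu
  have : i = k ∨ j = k := by
    by_contra! h
    simp [h] at hk
  rcases this with rfl | rfl
  · refine ⟨edge y j, ?_, ?_⟩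
    · rw [edge_mem hab]
      unfold PairE PairM PairN at *
      omega
    · unfold edge
      abel
  · refine ⟨edge i y, ?_, ?_⟩
    · rw [edge_mem hab]
      unfold PairE PairM PairN at *
      omega
    · unfold edge
      abel

end edges

section exponents

variable {V W : Type*}

/-- The map on exponent vectors induced by the monomial map sending the variable `v` to the
monomial with exponent vector `U v`. -/
noncomputable def expHom (U : V → W →₀ ℕ) : (V →₀ ℕ) →+ (W →₀ ℕ) :=
  (Finsupp.linearCombination ℕ U).toAddMonoidHom

@[simp] theorem expHom_single (U : V → W →₀ ℕ) (v : V) :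
    expHom U (Finsupp.single v 1) = U v := by
  simp [expHom]

theorem expHom_apply (U : V → W →₀ ℕ) (m : V →₀ ℕ) :
    expHom U m = m.sum fun v e => e • U v := Finsupp.linearCombination_apply ℕ m

theorem single_le_of_ne_zero {m : V →₀ ℕ} {v : V} (h : m v ≠ 0) : Finsupp.single v 1 ≤ m := by
  rw [Finsupp.single_le_iff]
  exact Nat.one_le_iff_ne_zero.mpr h

theorem single_add_single_le_of_ne {m : V →₀ ℕ} {v w : V} (hne : v ≠ w) (hv : m v ≠ 0)
    (hw : m w ≠ 0) : Finsupp.single v 1 + Finsupp.single w 1 ≤ m := by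
  classical
  intro x
  rw [Finsupp.add_apply, Finsupp.single_apply, Finsupp.single_apply]
  split_ifs with h1 h2 h2
  · exact absurd (h1.trans h2.symm) hne
  · subst h1
    omega
  · subst h2
    omega
  · omega

theorem ne_zero_of_single_add_le {m r : V →₀ ℕ} {v : V} (h : Finsupp.single v 1 + r ≤ m) :
    m v ≠ 0 := by
  have := h v
  simp at this
  omega

theorem exists_apply_pos_of_expHom_pos {U : V → W →₀ ℕ} {m : V →₀ ℕ} {y : W}
    (h : 0 < expHom U m y) : ∃ v, m v ≠ 0 ∧ 0 < U v y := by
  by_contra! hcon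
  rw [expHom_apply, Finsupp.sum_apply] at h
  refine h.ne' (Finset.sum_eq_zero fun v hv => ?_)
  have := hcon v (Finsupp.mem_support_iff.mp hv)
  simp only [Finsupp.smul_apply, smul_eq_mul, mul_eq_zero]
  omega

theorem le_expHom_apply {U : V → W →₀ ℕ} {m : V →₀ ℕ} {v : V} (hv : m v ≠ 0) (y : W) :
    U v y ≤ expHom U m y := by
  obtain ⟨r, rfl⟩ := exists_add_of_le (single_le_of_ne_zero hv)
  rw [map_add, expHom_single, Finsupp.add_apply]
  omega

theorem exists_single_add_single_le {U : V → W →₀ ℕ} {m : V →₀ ℕ} {v : V} {y : W}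
    (hv : m v ≠ 0) (h : U v y < expHom U m y) :
    ∃ w, Finsupp.single v 1 + Finsupp.single w 1 ≤ m ∧ 0 < U w y := by
  obtain ⟨r, rfl⟩ := exists_add_of_le (single_le_of_ne_zero hv)
  rw [map_add, expHom_single, Finsupp.add_apply] at h
  obtain ⟨w, hw, hpos⟩ := exists_apply_pos_of_expHom_pos (show 0 < expHom U r y by omega)
  exact ⟨w, add_le_add le_rfl (single_le_of_ne_zero hw), hpos⟩

theorem weight_expHom_nonneg {U : V → W →₀ ℕ} (ψ : (W →₀ ℕ) →+ ℤ) {m : V →₀ ℕ}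
    (h : ∀ v, m v ≠ 0 → 0 ≤ ψ (U v)) : 0 ≤ ψ (expHom U m) := by
  rw [expHom_apply, Finsupp.sum, map_sum]
  refine Finset.sum_nonneg fun v hv => ?_
  rw [map_nsmul]
  exact nsmul_nonneg (h v (Finsupp.mem_support_iff.mp hv)) _

theorem weight_le_weight_expHom {U : V → W →₀ ℕ} (ψ : (W →₀ ℕ) →+ ℤ) {m : V →₀ ℕ} {v : V}
    (hv : m v ≠ 0) (h : ∀ w, Finsupp.single v 1 + Finsupp.single w 1 ≤ m → 0 ≤ ψ (U w)) :
    ψ (U v) ≤ ψ (expHom U m) := by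
  obtain ⟨r, rfl⟩ := exists_add_of_le (single_le_of_ne_zero hv)
  rw [map_add, map_add, expHom_single]
  have := weight_expHom_nonneg (U := U) ψ (m := r) fun w hw =>
    h w (add_le_add le_rfl (single_le_of_ne_zero hw))
  omega

/-- A standard monomial is determined by its image as soon as any two nonzero standard monomials
with the same image have a variable in common. -/
theorem eq_of_expHom_eq {G : Set (MarkedBinomial V)} {U : V → W →₀ ℕ} (hU : ∀ v, U v ≠ 0)
    (hshare : ∀ m m', IsStandardMonomial G m → IsStandardMonomial G m' →
      expHom U m = expHom U m' → m ≠ 0 → m' ≠ 0 → ∃ v, m v ≠ 0 ∧ m' v ≠ 0)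
    (m m' : V →₀ ℕ) (hm : IsStandardMonomial G m) (hm' : IsStandardMonomial G m')
    (h : expHom U m = expHom U m') : m = m' := by
  have hzero : ∀ r : V →₀ ℕ, expHom U r = 0 → r = 0 := by
    intro r hr
    ext v
    by_contra hv
    refine hU v (Finsupp.ext fun y => ?_)
    have := le_expHom_apply (U := U) hv y
    rw [hr] at this
    simpa using this
  induction hd : m.degree using Nat.strong_induction_on generalizing m m' with
  | _ d ih =>
    rcases eq_or_ne m 0 with rfl | hne
    · rw [map_zero] at h
      exact (hzero m' h.symm).symm
    rcases eq_or_ne m' 0 with rfl | hne'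
    · rw [map_zero] at h
      exact hzero m h
    obtain ⟨v, hv, hv'⟩ := hshare m m' hm hm' h hne hne'
    obtain ⟨r, rfl⟩ := exists_add_of_le (single_le_of_ne_zero hv)
    obtain ⟨r', rfl⟩ := exists_add_of_le (single_le_of_ne_zero hv')
    rw [map_add, map_add] at h
    rw [map_add, Finsupp.degree_single] at hd
    rw [ih r.degree (by omega) r r' (hm.mono (self_le_add_left _ _))
      (hm'.mono (self_le_add_left _ _))
      (add_left_cancel h) rfl]

end exponents

section reesVariables

variable {n : ℕ} {a₁ b₁ c₁ d₁ a₂ b₂ c₂ d₂ : Fin n}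

/-- The variables of the polynomial ring presenting the multi-Rees algebra. -/
abbrev ReesVar (a₁ b₁ c₁ d₁ a₂ b₂ c₂ d₂ : Fin n) : Type :=
  Fin n ⊕ (↥(BM a₁ b₁ ∪ BN b₁ c₁ d₁) ⊕ ↥(BM a₂ b₂ ∪ BN b₂ c₂ d₂))

/-- The marked binomials `x_i T_u - x_j T_{u'}`, `x_i Z_v - x_j Z_{v'}` and `G₁ ∪ G₂ ∪ G₃`. -/
noncomputable def reesQuadrics (a₁ b₁ c₁ d₁ a₂ b₂ c₂ d₂ : Fin n) :
    Set (MarkedBinomial (ReesVar a₁ b₁ c₁ d₁ a₂ b₂ c₂ d₂)) :=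
  ({g | ∃ (i j : Fin n) (u u' : ↥(BM a₁ b₁ ∪ BN b₁ c₁ d₁)), i < j ∧
        Finsupp.single i 1 + (u : Fin n →₀ ℕ) = Finsupp.single j 1 + (u' : Fin n →₀ ℕ) ∧
        g.head = Finsupp.single (Sum.inl i) 1 + Finsupp.single (Sum.inr (Sum.inl u)) 1 ∧
        g.tail = Finsupp.single (Sum.inl j) 1 + Finsupp.single (Sum.inr (Sum.inl u')) 1} ∪
    {g | ∃ (i j : Fin n) (v v' : ↥(BM a₂ b₂ ∪ BN b₂ c₂ d₂)), i < j ∧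
        Finsupp.single i 1 + (v : Fin n →₀ ℕ) = Finsupp.single j 1 + (v' : Fin n →₀ ℕ) ∧
        g.head = Finsupp.single (Sum.inl i) 1 + Finsupp.single (Sum.inr (Sum.inr v)) 1 ∧
        g.tail = Finsupp.single (Sum.inl j) 1 + Finsupp.single (Sum.inr (Sum.inr v')) 1}) ∪
    (MarkedBinomial.map Sum.inr '' GHT a₁ b₁ c₁ d₁ a₂ b₂ c₂ d₂)

/-- The exponent vectors of the images of the variables in `S[t, z]`. -/
noncomputable def reesExp (a₁ b₁ c₁ d₁ a₂ b₂ c₂ d₂ : Fin n) :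
    ReesVar a₁ b₁ c₁ d₁ a₂ b₂ c₂ d₂ → (Fin n ⊕ Fin 2) →₀ ℕ :=
  Sum.elim (fun i => Finsupp.single (Sum.inl i) 1)
    (TZexp (BM a₁ b₁ ∪ BN b₁ c₁ d₁) (BM a₂ b₂ ∪ BN b₂ c₂ d₂))

open Classical in
/-- The key by which the variables are ordered: first the `x_i`, with `x_n` the smallest, then the
`Z_v` by `≻_mrlex`, then the `T_u` by `≻_rlex`. -/
noncomputable def varKey (a₁ b₁ c₁ d₁ a₂ b₂ c₂ d₂ : Fin n) :
    ReesVar a₁ b₁ c₁ d₁ a₂ b₂ c₂ d₂ → ℕ ×ₗ (Colex (Fin n →₀ ℕ))ᵒᵈ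
  | Sum.inl i => toLex (0, OrderDual.toDual (toColex (Finsupp.single i 1)))
  | Sum.inr (Sum.inl u) => toLex (3, OrderDual.toDual (toColex (u : Fin n →₀ ℕ)))
  | Sum.inr (Sum.inr v) => toLex (if (v : Fin n →₀ ℕ) ∈ BM a₂ b₂ then 1 else 2,
      OrderDual.toDual (toColex (v : Fin n →₀ ℕ)))

theorem varKey_injective :
    Function.Injective (varKey a₁ b₁ c₁ d₁ a₂ b₂ c₂ d₂) := by
  intro v w h
  rcases v with i | u | v <;> rcases w with j | u' | v' <;>
    simp only [varKey, EmbeddingLike.apply_eq_iff_eq, Prod.mk.injEq] at h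
  · rw [Finsupp.single_left_injective one_ne_zero h.2]
  · omega
  · split_ifs at h <;> simp at h
  · omega
  · rw [Subtype.ext h.2]
  · split_ifs at h <;> simp at h
  · split_ifs at h <;> simp at h
  · split_ifs at h <;> simp at h
  · rw [Subtype.ext h.2]

theorem toColex_lt_iff_rlexGt {u v : Fin n →₀ ℕ} : toColex u < toColex v ↔ RlexGt u v := by
  rw [Finsupp.Colex.lt_iff]
  exact exists_congr fun k => and_comm

theorem varKey_X_lt_X {i j : Fin n} (h : i < j) :
    varKey a₁ b₁ c₁ d₁ a₂ b₂ c₂ d₂ (Sum.inl j) <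
      varKey a₁ b₁ c₁ d₁ a₂ b₂ c₂ d₂ (Sum.inl i) := by
  rw [varKey, varKey, Prod.Lex.toLex_lt_toLex]
  exact Or.inr ⟨rfl, OrderDual.toDual_lt_toDual.mpr (Finsupp.Colex.single_lt_iff.mpr h)⟩

theorem varKey_X_lt_inr (i : Fin n) (w : ↥(BM a₁ b₁ ∪ BN b₁ c₁ d₁) ⊕ ↥(BM a₂ b₂ ∪ BN b₂ c₂ d₂)) :
    varKey a₁ b₁ c₁ d₁ a₂ b₂ c₂ d₂ (Sum.inl i) <
      varKey a₁ b₁ c₁ d₁ a₂ b₂ c₂ d₂ (Sum.inr w) := by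
  rcases w with u | v <;> rw [varKey, varKey, Prod.Lex.toLex_lt_toLex] <;> left <;> dsimp only
  · omega
  · split_ifs <;> omega

theorem varKey_Z_lt_T (u : ↥(BM a₁ b₁ ∪ BN b₁ c₁ d₁)) (v : ↥(BM a₂ b₂ ∪ BN b₂ c₂ d₂)) :
    varKey a₁ b₁ c₁ d₁ a₂ b₂ c₂ d₂ (Sum.inr (Sum.inr v)) <
      varKey a₁ b₁ c₁ d₁ a₂ b₂ c₂ d₂ (Sum.inr (Sum.inl u)) := by
  rw [varKey, varKey, Prod.Lex.toLex_lt_toLex]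
  left
  dsimp only
  split_ifs <;> omega

theorem varKey_T_lt_T_iff {u v : ↥(BM a₁ b₁ ∪ BN b₁ c₁ d₁)} :
    varKey a₁ b₁ c₁ d₁ a₂ b₂ c₂ d₂ (Sum.inr (Sum.inl v)) <
      varKey a₁ b₁ c₁ d₁ a₂ b₂ c₂ d₂ (Sum.inr (Sum.inl u)) ↔
      RlexGt (u : Fin n →₀ ℕ) (v : Fin n →₀ ℕ) := by
  rw [varKey, varKey, Prod.Lex.toLex_lt_toLex]
  simp [toColex_lt_iff_rlexGt]

theorem varKey_Z_lt_Z_iff (hab : a₂ ≤ b₂) {u v : ↥(BM a₂ b₂ ∪ BN b₂ c₂ d₂)} :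
    varKey a₁ b₁ c₁ d₁ a₂ b₂ c₂ d₂ (Sum.inr (Sum.inr v)) <
      varKey a₁ b₁ c₁ d₁ a₂ b₂ c₂ d₂ (Sum.inr (Sum.inr u)) ↔
      MrlexGt a₂ b₂ c₂ d₂ (u : Fin n →₀ ℕ) (v : Fin n →₀ ℕ) := by
  obtain ⟨u, hu⟩ := u
  obtain ⟨v, hv⟩ := v
  rw [varKey, varKey, Prod.Lex.toLex_lt_toLex]
  have hu' := fun h => notMem_BM_of_mem_BN (d := d₂) (c := c₂) (u := u) hab h
  have hv' := fun h => notMem_BM_of_mem_BN (d := d₂) (c := c₂) (u := v) hab h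
  simp only [MrlexGt, OrderDual.toDual_lt_toDual, toColex_lt_iff_rlexGt]
  rw [Set.mem_union] at hu hv
  by_cases h1 : u ∈ BM a₂ b₂ <;> by_cases h2 : v ∈ BM a₂ b₂ <;> simp [h1, h2] at * <;>
    simp_all

end reesVariables

section standard

variable {n : ℕ} {a₁ b₁ c₁ d₁ a₂ b₂ c₂ d₂ : Fin n}

theorem finite_generators (a b c d : Fin n) : (BM a b ∪ BN b c d).Finite := by
  refine (Set.finite_range fun p : Fin n × Fin n => edge p.1 p.2).subset ?_
  rintro _ (⟨i, j, -, -, -, rfl⟩ | ⟨i, j, -, -, -, rfl⟩) <;> exact ⟨(i, j), rfl⟩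

theorem reesExp_T_apply_inl (u : ↥(BM a₁ b₁ ∪ BN b₁ c₁ d₁)) (x : Fin n) :
    reesExp a₁ b₁ c₁ d₁ a₂ b₂ c₂ d₂ (Sum.inr (Sum.inl u)) (Sum.inl x) = (u : Fin n →₀ ℕ) x := by
  simp [reesExp, TZexp, Finsupp.mapDomain_apply Sum.inl_injective]

theorem reesExp_Z_apply_inl (v : ↥(BM a₂ b₂ ∪ BN b₂ c₂ d₂)) (x : Fin n) :
    reesExp a₁ b₁ c₁ d₁ a₂ b₂ c₂ d₂ (Sum.inr (Sum.inr v)) (Sum.inl x) = (v : Fin n →₀ ℕ) x := by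
  simp [reesExp, TZexp, Finsupp.mapDomain_apply Sum.inl_injective]

theorem reesExp_apply_inr_one_pos_iff {w : ReesVar a₁ b₁ c₁ d₁ a₂ b₂ c₂ d₂} :
    0 < reesExp a₁ b₁ c₁ d₁ a₂ b₂ c₂ d₂ w (Sum.inr 1) ↔ ∃ v, w = Sum.inr (Sum.inr v) := by
  have h : ∀ u : Fin n →₀ ℕ,
      Finsupp.mapDomain (Sum.inl : Fin n → Fin n ⊕ Fin 2) u (Sum.inr 1) = 0 := fun u =>
    Finsupp.mapDomain_of_notMem_range u _ (by simp)
  rcases w with i | u | v <;> simp [reesExp, TZexp, h]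

theorem reesExp_ne_zero (w : ReesVar a₁ b₁ c₁ d₁ a₂ b₂ c₂ d₂) :
    reesExp a₁ b₁ c₁ d₁ a₂ b₂ c₂ d₂ w ≠ 0 := by
  rcases w with i | u | v <;> simp [reesExp, TZexp]

/-- The additive weight on exponent vectors with given values on the variables. -/
noncomputable def weightHom {W : Type*} (g : W → ℤ) : (W →₀ ℕ) →+ ℤ :=
  Finsupp.liftAddHom fun x => multiplesHom ℤ (g x)

@[simp] theorem weightHom_single {W : Type*} (g : W → ℤ) (x : W) :
    weightHom g (Finsupp.single x 1) = g x := by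
  simp [weightHom]

theorem weightHom_T (g : Fin n ⊕ Fin 2 → ℤ) {i j : Fin n}
    (h : edge i j ∈ BM a₁ b₁ ∪ BN b₁ c₁ d₁) :
    weightHom g (reesExp a₁ b₁ c₁ d₁ a₂ b₂ c₂ d₂ (Sum.inr (Sum.inl ⟨_, h⟩))) =
      g (Sum.inl i) + g (Sum.inl j) + g (Sum.inr 0) := by
  simp [reesExp, TZexp, edge, Finsupp.mapDomain_add, Finsupp.mapDomain_single]

theorem weightHom_Z (g : Fin n ⊕ Fin 2 → ℤ) {i j : Fin n}
    (h : edge i j ∈ BM a₂ b₂ ∪ BN b₂ c₂ d₂) :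
    weightHom g (reesExp a₁ b₁ c₁ d₁ a₂ b₂ c₂ d₂ (Sum.inr (Sum.inr ⟨_, h⟩))) =
      g (Sum.inl i) + g (Sum.inl j) + g (Sum.inr 1) := by
  simp [reesExp, TZexp, edge, Finsupp.mapDomain_add, Finsupp.mapDomain_single]

variable {m m' : ReesVar a₁ b₁ c₁ d₁ a₂ b₂ c₂ d₂ →₀ ℕ}

theorem not_X_add_T_le
    (hm : IsStandardMonomial (reesQuadrics a₁ b₁ c₁ d₁ a₂ b₂ c₂ d₂) m)
    {i j : Fin n} {u u' : ↥(BM a₁ b₁ ∪ BN b₁ c₁ d₁)} (hij : i < j)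
    (h : Finsupp.single i 1 + (u : Fin n →₀ ℕ) = Finsupp.single j 1 + (u' : Fin n →₀ ℕ)) :
    ¬ Finsupp.single (Sum.inl i) 1 + Finsupp.single (Sum.inr (Sum.inl u)) 1 ≤ m :=
  hm ⟨_, Finsupp.single (Sum.inl j) 1 + Finsupp.single (Sum.inr (Sum.inl u')) 1⟩
    (Or.inl (Or.inl ⟨i, j, u, u', hij, h, rfl, rfl⟩))

theorem not_X_add_Z_le
    (hm : IsStandardMonomial (reesQuadrics a₁ b₁ c₁ d₁ a₂ b₂ c₂ d₂) m)
    {i j : Fin n} {v v' : ↥(BM a₂ b₂ ∪ BN b₂ c₂ d₂)} (hij : i < j)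
    (h : Finsupp.single i 1 + (v : Fin n →₀ ℕ) = Finsupp.single j 1 + (v' : Fin n →₀ ℕ)) :
    ¬ Finsupp.single (Sum.inl i) 1 + Finsupp.single (Sum.inr (Sum.inr v)) 1 ≤ m :=
  hm ⟨_, Finsupp.single (Sum.inl j) 1 + Finsupp.single (Sum.inr (Sum.inr v')) 1⟩
    (Or.inl (Or.inr ⟨i, j, v, v', hij, h, rfl, rfl⟩))

theorem not_T_add_T_le
    (hm : IsStandardMonomial (reesQuadrics a₁ b₁ c₁ d₁ a₂ b₂ c₂ d₂) m)
    {u v u' v' : ↥(BM a₁ b₁ ∪ BN b₁ c₁ d₁)}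
    (h : (u : Fin n →₀ ℕ) + v = u' + v') (hu : RlexGt (u : Fin n →₀ ℕ) (v' : Fin n →₀ ℕ))
    (hv : RlexGt (v : Fin n →₀ ℕ) (v' : Fin n →₀ ℕ)) :
    ¬ Finsupp.single (Sum.inr (Sum.inl u)) 1 + Finsupp.single (Sum.inr (Sum.inl v)) 1 ≤ m := by
  have := hm _ (Or.inr ⟨_, Or.inl (Or.inl ⟨⟨_, Finsupp.single u' 1 + Finsupp.single v' 1⟩,
    ⟨u, v, u', v', h, hu, hv, rfl, rfl⟩, rfl⟩), rfl⟩)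
  simpa [MarkedBinomial.map, Finsupp.mapDomain_add, Finsupp.mapDomain_single] using this

theorem not_Z_add_Z_le
    (hm : IsStandardMonomial (reesQuadrics a₁ b₁ c₁ d₁ a₂ b₂ c₂ d₂) m)
    {u v u' v' : ↥(BM a₂ b₂ ∪ BN b₂ c₂ d₂)}
    (h : (u : Fin n →₀ ℕ) + v = u' + v')
    (hu : MrlexGt a₂ b₂ c₂ d₂ (u : Fin n →₀ ℕ) (v' : Fin n →₀ ℕ))
    (hv : MrlexGt a₂ b₂ c₂ d₂ (v : Fin n →₀ ℕ) (v' : Fin n →₀ ℕ)) :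
    ¬ Finsupp.single (Sum.inr (Sum.inr u)) 1 + Finsupp.single (Sum.inr (Sum.inr v)) 1 ≤ m := by
  have := hm _ (Or.inr ⟨_, Or.inl (Or.inr ⟨⟨_, Finsupp.single u' 1 + Finsupp.single v' 1⟩,
    ⟨u, v, u', v', h, hu, hv, rfl, rfl⟩, rfl⟩), rfl⟩)
  simpa [MarkedBinomial.map, Finsupp.mapDomain_add, Finsupp.mapDomain_single] using this

theorem not_T_add_Z_le
    (hm : IsStandardMonomial (reesQuadrics a₁ b₁ c₁ d₁ a₂ b₂ c₂ d₂) m)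
    {u u' : ↥(BM a₁ b₁ ∪ BN b₁ c₁ d₁)} {v v' : ↥(BM a₂ b₂ ∪ BN b₂ c₂ d₂)}
    (h : (u : Fin n →₀ ℕ) + (v : Fin n →₀ ℕ) = (u' : Fin n →₀ ℕ) + (v' : Fin n →₀ ℕ))
    (hv : MrlexGt a₂ b₂ c₂ d₂ (v : Fin n →₀ ℕ) (v' : Fin n →₀ ℕ)) :
    ¬ Finsupp.single (Sum.inr (Sum.inl u)) 1 + Finsupp.single (Sum.inr (Sum.inr v)) 1 ≤ m := by
  have := hm _ (Or.inr ⟨⟨_, Finsupp.single (Sum.inl u') 1 + Finsupp.single (Sum.inr v') 1⟩,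
    Or.inr ⟨u, u', v, v', h, hv, rfl, rfl⟩, rfl⟩)
  simpa [MarkedBinomial.map, Finsupp.mapDomain_add, Finsupp.mapDomain_single] using this

theorem add_eq_add_of_swap {u u' v v' : Fin n →₀ ℕ} {y k : Fin n}
    (hu : Finsupp.single y 1 + u = Finsupp.single k 1 + u')
    (hv : Finsupp.single k 1 + v = Finsupp.single y 1 + v') : u + v = u' + v' := by
  have h := congrArg₂ (· + ·) hu hv
  refine add_left_cancel (a := Finsupp.single y 1 + Finsupp.single k 1) ?_
  calc Finsupp.single y 1 + Finsupp.single k 1 + (u + v)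
      = Finsupp.single y 1 + u + (Finsupp.single k 1 + v) := by abel
    _ = Finsupp.single k 1 + u' + (Finsupp.single y 1 + v') := h
    _ = Finsupp.single y 1 + Finsupp.single k 1 + (u' + v') := by abel

theorem lt_or_of_rlexGt_edge {i j k l : Fin n} (hij : i ≤ j) (hkl : k ≤ l)
    (h : RlexGt (edge i j) (edge k l)) : j < l ∨ (j = l ∧ i < k) := by
  by_contra hcon
  have hlt := toColex_lt_iff_rlexGt.mpr h
  by_cases heq : i = k ∧ j = l
  · rw [heq.1, heq.2] at hlt
    exact lt_irrefl _ hlt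
  · exact lt_asymm hlt (toColex_lt_iff_rlexGt.mpr (rlexGt_edge_of_le hkl hij (by omega)))

theorem X_mem_of_isGreatest (hca₁ : c₁ < a₁) (hab₁ : a₁ ≤ b₁) (hca₂ : c₂ < a₂) (hab₂ : a₂ ≤ b₂)
    (hm : IsStandardMonomial (reesQuadrics a₁ b₁ c₁ d₁ a₂ b₂ c₂ d₂) m)
    (hX : ∃ i, m (Sum.inl i) ≠ 0) {k : Fin n}
    (hk : 0 < expHom (reesExp a₁ b₁ c₁ d₁ a₂ b₂ c₂ d₂) m (Sum.inl k))
    (hmax : ∀ l, 0 < expHom (reesExp a₁ b₁ c₁ d₁ a₂ b₂ c₂ d₂) m (Sum.inl l) → l ≤ k) :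
    m (Sum.inl k) ≠ 0 := by
  obtain ⟨i, hi⟩ := hX
  have hik : i ≤ k := by
    apply hmax
    have := le_expHom_apply (U := reesExp a₁ b₁ c₁ d₁ a₂ b₂ c₂ d₂) hi (Sum.inl i)
    simp only [reesExp, Sum.elim_inl, Finsupp.single_eq_same] at this
    exact this
  rcases hik.eq_or_lt with rfl | hik
  · exact hi
  by_contra hcon
  obtain ⟨w, hw, hpos⟩ := exists_apply_pos_of_expHom_pos hk
  rcases w with j | u | v
  · simp only [reesExp, Sum.elim_inl, Finsupp.single_apply, Sum.inl.injEq] at hpos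
    split_ifs at hpos with h
    · exact (h ▸ hw) hcon
    · omega
  · rw [reesExp_T_apply_inl] at hpos
    obtain ⟨u', hu', h⟩ := exists_swap_of_lt hca₁ hab₁ u.2 hpos hik
    exact not_X_add_T_le hm (u' := ⟨u', hu'⟩) hik h (single_add_single_le_of_ne (by simp) hi hw)
  · rw [reesExp_Z_apply_inl] at hpos
    obtain ⟨v', hv', h⟩ := exists_swap_of_lt hca₂ hab₂ v.2 hpos hik
    exact not_X_add_Z_le hm (v' := ⟨v', hv'⟩) hik h (single_add_single_le_of_ne (by simp) hi hw)

theorem not_Z_add_le_of_swap (hca₁ : c₁ < a₁) (hab₁ : a₁ ≤ b₁) (hca₂ : c₂ < a₂) (hab₂ : a₂ ≤ b₂)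
    (hm : IsStandardMonomial (reesQuadrics a₁ b₁ c₁ d₁ a₂ b₂ c₂ d₂) m)
    {v v' : ↥(BM a₂ b₂ ∪ BN b₂ c₂ d₂)} {w : ReesVar a₁ b₁ c₁ d₁ a₂ b₂ c₂ d₂}
    (hX : ∀ i, w ≠ Sum.inl i) {y k : Fin n} (hyk : y < k)
    (hv : Finsupp.single k 1 + (v : Fin n →₀ ℕ) = Finsupp.single y 1 + (v' : Fin n →₀ ℕ))
    (hlt : MrlexGt a₂ b₂ c₂ d₂ (v : Fin n →₀ ℕ) (v' : Fin n →₀ ℕ))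
    (hle : varKey a₁ b₁ c₁ d₁ a₂ b₂ c₂ d₂ (Sum.inr (Sum.inr v)) ≤
      varKey a₁ b₁ c₁ d₁ a₂ b₂ c₂ d₂ w)
    (hk : 0 < reesExp a₁ b₁ c₁ d₁ a₂ b₂ c₂ d₂ w (Sum.inl k)) :
    ¬ Finsupp.single (Sum.inr (Sum.inr v)) 1 + Finsupp.single w 1 ≤ m := by
  rcases w with i | u | u
  · exact absurd rfl (hX i)
  · rw [reesExp_T_apply_inl] at hk
    obtain ⟨u', hu', hu⟩ := exists_swap_of_lt hca₁ hab₁ u.2 hk hyk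
    rw [add_comm]
    exact not_T_add_Z_le hm (u' := ⟨u', hu'⟩) (add_eq_add_of_swap hu hv) hlt
  · rw [reesExp_Z_apply_inl] at hk
    obtain ⟨u', hu', hu⟩ := exists_swap_of_lt hca₂ hab₂ u.2 hk hyk
    rw [add_comm]
    refine not_Z_add_Z_le hm (u' := ⟨u', hu'⟩) (add_eq_add_of_swap hu hv) ?_ hlt
    have h := (varKey_Z_lt_Z_iff (a₁ := a₁) (b₁ := b₁) (c₁ := c₁) (d₁ := d₁) hab₂).mpr hlt
    exact (varKey_Z_lt_Z_iff hab₂).mp (h.trans_le hle)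

theorem not_mrlexGt_of_isLeast_of_mem_iff (hca₁ : c₁ < a₁) (hab₁ : a₁ ≤ b₁) (hca₂ : c₂ < a₂)
    (hab₂ : a₂ ≤ b₂)
    (hm : IsStandardMonomial (reesQuadrics a₁ b₁ c₁ d₁ a₂ b₂ c₂ d₂) m)
    (hX : ∀ i, m (Sum.inl i) = 0)
    (h : expHom (reesExp a₁ b₁ c₁ d₁ a₂ b₂ c₂ d₂) m =
      expHom (reesExp a₁ b₁ c₁ d₁ a₂ b₂ c₂ d₂) m')
    {v v' : ↥(BM a₂ b₂ ∪ BN b₂ c₂ d₂)} (hv : m (Sum.inr (Sum.inr v)) ≠ 0)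
    (hv' : m' (Sum.inr (Sum.inr v')) ≠ 0)
    (hleast : ∀ w, m (Sum.inr (Sum.inr w)) ≠ 0 →
      varKey a₁ b₁ c₁ d₁ a₂ b₂ c₂ d₂ (Sum.inr (Sum.inr v)) ≤
        varKey a₁ b₁ c₁ d₁ a₂ b₂ c₂ d₂ (Sum.inr (Sum.inr w)))
    (hkind : (v : Fin n →₀ ℕ) ∈ BM a₂ b₂ ↔ (v' : Fin n →₀ ℕ) ∈ BM a₂ b₂) :
    ¬ MrlexGt a₂ b₂ c₂ d₂ (v : Fin n →₀ ℕ) (v' : Fin n →₀ ℕ) := by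
  intro hgt
  obtain ⟨v, hvm⟩ := v
  obtain ⟨v', hvm'⟩ := v'
  obtain ⟨i₁, j₁, hij₁, rfl⟩ := exists_eq_edge (hca₂.le.trans hab₂) hvm
  obtain ⟨i₂, j₂, hij₂, rfl⟩ := exists_eq_edge (hca₂.le.trans hab₂) hvm'
  dsimp only at hgt hkind
  have hrlex : RlexGt (edge i₁ j₁) (edge i₂ j₂) := by
    rcases hgt with ⟨h1, h2⟩ | ⟨-, -, h⟩ | ⟨-, -, h⟩
    · exact absurd (hkind.mpr h2) (notMem_BM_of_mem_BN hab₂ h1)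
    · exact h
    · exact h
  have hmr : ∀ {i j : Fin n} (e : edge i j ∈ BM a₂ b₂ ∪ BN b₂ c₂ d₂),
      (edge i j ∈ BM a₂ b₂ ↔ edge i₁ j₁ ∈ BM a₂ b₂) → RlexGt (edge i₁ j₁) (edge i j) →
      MrlexGt a₂ b₂ c₂ d₂ (edge i₁ j₁) (edge i j) := by
    intro i j e hk hr
    by_cases h1 : edge i₁ j₁ ∈ BM a₂ b₂
    · exact Or.inr (Or.inl ⟨h1, hk.mpr h1, hr⟩)
    · exact Or.inr (Or.inr ⟨hvm.resolve_left h1, e.resolve_left (hk.not.mpr h1), hr⟩)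
  suffices ∃ y k l, y < k ∧ edge i₁ j₁ = edge y l ∧ edge i₁ j₁ k < edge i₂ j₂ k ∧
      (edge k l ∈ BM a₂ b₂ ∪ BN b₂ c₂ d₂) ∧
      (edge k l ∈ BM a₂ b₂ ↔ edge i₁ j₁ ∈ BM a₂ b₂) ∧ RlexGt (edge i₁ j₁) (edge k l) by
    obtain ⟨y, k, l, hyk, he, hlt, hmem, hk, hr⟩ := this
    have hlt' : reesExp a₁ b₁ c₁ d₁ a₂ b₂ c₂ d₂ (Sum.inr (Sum.inr ⟨_, hvm⟩)) (Sum.inl k) <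
        expHom (reesExp a₁ b₁ c₁ d₁ a₂ b₂ c₂ d₂) m (Sum.inl k) := by
      rw [h]
      refine lt_of_lt_of_le ?_ (le_expHom_apply hv' _)
      rwa [reesExp_Z_apply_inl, reesExp_Z_apply_inl]
    obtain ⟨w, hw, hpos⟩ := exists_single_add_single_le hv hlt'
    have hw0 : m w ≠ 0 := ne_zero_of_single_add_le (add_comm (Finsupp.single _ 1) _ ▸ hw)
    refine not_Z_add_le_of_swap hca₁ hab₁ hca₂ hab₂ hm (v' := ⟨edge k l, hmem⟩)
      ?_ hyk ?_ (hmr hmem hk hr) ?_ hpos hw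
    · rintro i rfl
      exact hw0 (hX i)
    · dsimp only
      rw [he]
      unfold edge
      abel
    · rcases w with i | u | u
      · exact absurd (hX i) hw0
      · exact (varKey_Z_lt_T _ _).le
      · exact hleast u hw0
  rw [edge_mem_BM hab₂, edge_mem_BM hab₂] at hkind
  rw [edge_mem hab₂] at hvm hvm'
  unfold PairE at hvm hvm'
  rcases lt_or_of_rlexGt_edge hij₁ hij₂ hrlex with hlt | ⟨rfl, hlt⟩
  · refine ⟨j₁, j₂, i₁, hlt, edge_comm _ _, ?_, ?_, ?_, ?_⟩
    · simp only [edge_apply]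
      split_ifs <;> omega
    · rw [edge_mem hab₂]
      unfold PairE PairM PairN at *
      omega
    · rw [edge_mem_BM hab₂, edge_mem_BM hab₂]
      unfold PairM PairN at *
      omega
    · rw [edge_comm j₂]
      exact rlexGt_edge_of_le hij₁ (by omega) (by omega)
  · refine ⟨i₁, i₂, j₁, hlt, rfl, ?_, ?_, ?_, hrlex⟩
    · simp only [edge_apply]
      split_ifs <;> omega
    · rw [edge_mem hab₂]
      exact hvm'
    · rw [edge_mem_BM hab₂, edge_mem_BM hab₂]
      exact hkind.symm

theorem not_rlexGt_of_isLeast (hca₁ : c₁ < a₁) (hab₁ : a₁ ≤ b₁)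
    (hm : IsStandardMonomial (reesQuadrics a₁ b₁ c₁ d₁ a₂ b₂ c₂ d₂) m)
    (hX : ∀ i, m (Sum.inl i) = 0) (hZ : ∀ v, m (Sum.inr (Sum.inr v)) = 0)
    (h : expHom (reesExp a₁ b₁ c₁ d₁ a₂ b₂ c₂ d₂) m =
      expHom (reesExp a₁ b₁ c₁ d₁ a₂ b₂ c₂ d₂) m')
    {u u' : ↥(BM a₁ b₁ ∪ BN b₁ c₁ d₁)} (hu : m (Sum.inr (Sum.inl u)) ≠ 0)
    (hu' : m' (Sum.inr (Sum.inl u')) ≠ 0)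
    (hleast : ∀ w, m (Sum.inr (Sum.inl w)) ≠ 0 →
      ¬ RlexGt (u : Fin n →₀ ℕ) (w : Fin n →₀ ℕ)) :
    ¬ RlexGt (u : Fin n →₀ ℕ) (u' : Fin n →₀ ℕ) := by
  intro hgt
  obtain ⟨u, hum⟩ := u
  obtain ⟨u', hum'⟩ := u'
  obtain ⟨i₁, j₁, hij₁, rfl⟩ := exists_eq_edge (hca₁.le.trans hab₁) hum
  obtain ⟨i₂, j₂, hij₂, rfl⟩ := exists_eq_edge (hca₁.le.trans hab₁) hum'
  dsimp only at hgt hleast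
  have key : ∀ k, edge i₁ j₁ k < edge i₂ j₂ k → ∃ w : ↥(BM a₁ b₁ ∪ BN b₁ c₁ d₁),
      Finsupp.single (Sum.inr (Sum.inl ⟨_, hum⟩)) 1 + Finsupp.single (Sum.inr (Sum.inl w)) 1 ≤ m ∧
      0 < (w : Fin n →₀ ℕ) k := by
    intro k hlt
    have hlt' : reesExp a₁ b₁ c₁ d₁ a₂ b₂ c₂ d₂ (Sum.inr (Sum.inl ⟨_, hum⟩)) (Sum.inl k) <
        expHom (reesExp a₁ b₁ c₁ d₁ a₂ b₂ c₂ d₂) m (Sum.inl k) := by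
      rw [h]
      refine lt_of_lt_of_le ?_ (le_expHom_apply hu' _)
      rwa [reesExp_T_apply_inl, reesExp_T_apply_inl]
    obtain ⟨w, hw, hpos⟩ := exists_single_add_single_le hu hlt'
    have hw0 : m w ≠ 0 := ne_zero_of_single_add_le (add_comm (Finsupp.single _ 1) _ ▸ hw)
    rcases w with i | w | w
    · exact absurd (hX i) hw0
    · rw [reesExp_T_apply_inl] at hpos
      exact ⟨w, hw, hpos⟩
    · exact absurd (hZ w) hw0
  rcases lt_or_of_rlexGt_edge hij₁ hij₂ hgt with hlt | ⟨rfl, hlt⟩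
  · obtain ⟨⟨w, hwm⟩, hw, hpos⟩ := key j₂ (by
      simp only [edge_apply]
      split_ifs <;> omega)
    have hw0 := ne_zero_of_single_add_le (add_comm (Finsupp.single _ 1) _ ▸ hw)
    obtain ⟨k, l, hkl, rfl⟩ := exists_eq_edge (hca₁.le.trans hab₁) hwm
    refine hleast _ hw0 (rlexGt_edge_of_le hij₁ hkl (Or.inl ?_))
    simp only [edge_apply] at hpos
    split_ifs at hpos <;> omega
  · obtain ⟨w, hw, hpos⟩ := key i₂ (by
      simp only [edge_apply]
      split_ifs <;> omega)
    have hw0 := ne_zero_of_single_add_le (add_comm (Finsupp.single _ 1) _ ▸ hw)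
    obtain ⟨w', hw', hsw⟩ := exists_swap_of_lt hca₁ hab₁ w.2 hpos hlt
    have hgt' : RlexGt (w : Fin n →₀ ℕ) (edge i₂ j₁) := by
      rw [← toColex_lt_iff_rlexGt] at hgt ⊢
      refine lt_of_le_of_lt (not_lt.mp fun hlt' => ?_) hgt
      exact hleast w hw0 (toColex_lt_iff_rlexGt.mp hlt')
    rw [add_comm] at hw
    refine not_T_add_T_le hm (u' := ⟨w', hw'⟩) (v' := ⟨_, hum'⟩) ?_ hgt' hgt hw
    refine add_eq_add_of_swap hsw ?_
    dsimp only [edge]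
    abel

end standard

section separation

variable {n : ℕ} {a₁ b₁ c₁ d₁ a₂ b₂ c₂ d₂ : Fin n}
  {m m' : ReesVar a₁ b₁ c₁ d₁ a₂ b₂ c₂ d₂ →₀ ℕ}

/-- Every `Z_v` in a standard monomial lies weakly beyond the greatest one, coordinatewise. -/
theorem le_of_isGreatest_Z (hab₂ : a₂ ≤ b₂)
    (hm : IsStandardMonomial (reesQuadrics a₁ b₁ c₁ d₁ a₂ b₂ c₂ d₂) m)
    {i κ k l : Fin n} {v₀ v : ↥(BM a₂ b₂ ∪ BN b₂ c₂ d₂)}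
    (hv₀ : m (Sum.inr (Sum.inr v₀)) ≠ 0) (hv : m (Sum.inr (Sum.inr v)) ≠ 0)
    (h₀ : (v₀ : Fin n →₀ ℕ) = edge i κ) (h : (v : Fin n →₀ ℕ) = edge k l)
    (hi : i ≤ c₂ ∧ b₂ < κ ∧ κ ≤ d₂) (hk : k ≤ c₂ ∧ b₂ < l ∧ l ≤ d₂) (hcb : c₂ < b₂)
    (hmax : varKey a₁ b₁ c₁ d₁ a₂ b₂ c₂ d₂ (Sum.inr (Sum.inr v)) ≤
      varKey a₁ b₁ c₁ d₁ a₂ b₂ c₂ d₂ (Sum.inr (Sum.inr v₀))) : i ≤ k ∧ κ ≤ l := by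
  have hN : ∀ {p q : Fin n}, p ≤ c₂ → b₂ < q → q ≤ d₂ → edge p q ∈ BN b₂ c₂ d₂ :=
    fun hp hq hq' => edge_mem_BN.mpr (Or.inl ⟨hp, hq, hq'⟩)
  have hgt : ∀ {p q r s : Fin n}, p ≤ c₂ → b₂ < q → q ≤ d₂ → r ≤ c₂ → b₂ < s → s ≤ d₂ →
      (q < s ∨ (q = s ∧ p < r)) → MrlexGt a₂ b₂ c₂ d₂ (edge p q) (edge r s) :=
    fun h1 h2 h3 h4 h5 h6 h7 => Or.inr (Or.inr ⟨hN h1 h2 h3, hN h4 h5 h6,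
      rlexGt_edge_of_le (by omega) (by omega) h7⟩)
  have hng : ¬ MrlexGt a₂ b₂ c₂ d₂ (v : Fin n →₀ ℕ) (v₀ : Fin n →₀ ℕ) := fun hcon =>
    not_lt_of_ge hmax ((varKey_Z_lt_Z_iff hab₂).mpr hcon)
  rw [h, h₀] at hng
  have hκ : κ ≤ l := not_lt.mp fun hlt => hng
    (hgt hk.1 hk.2.1 hk.2.2 hi.1 hi.2.1 hi.2.2 (Or.inl hlt))
  refine ⟨not_lt.mp fun hlt => ?_, hκ⟩
  have hκl : κ < l := lt_of_le_of_ne hκ fun heq => hng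
    (hgt hk.1 hk.2.1 hk.2.2 hi.1 hi.2.1 hi.2.2 (Or.inr ⟨heq.symm, hlt⟩))
  have hne : v₀ ≠ v := by
    rintro rfl
    have := edge_eq_edge_iff.mp (h₀.symm.trans h)
    omega
  refine not_Z_add_Z_le hm (u := v₀) (v := v) (u' := ⟨edge k κ, Or.inr (hN hk.1 hi.2.1 hi.2.2)⟩)
    (v' := ⟨edge i l, Or.inr (hN hi.1 hk.2.1 hk.2.2)⟩) ?_ ?_ ?_
    (single_add_single_le_of_ne (by simpa using hne) hv₀ hv)
  · rw [h₀, h]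
    dsimp only [edge]
    abel
  · rw [h₀]
    exact hgt hi.1 hi.2.1 hi.2.2 hi.1 hk.2.1 hk.2.2 (Or.inl hκl)
  · rw [h]
    exact hgt hk.1 hk.2.1 hk.2.2 hi.1 hk.2.1 hk.2.2 (Or.inr ⟨rfl, hlt⟩)

/-- A standard monomial whose `Z`-variables exist and all come from `BN` admits a weight which
separates it from the monomials with a `Z`-variable from `BM`. -/
theorem exists_hasSeparatingWeight (h11 : c₁ < a₁) (h12 : a₁ ≤ b₁) (h13 : b₁ < d₁)
    (h21 : c₂ < a₂) (h22 : a₂ ≤ b₂) (hd : d₁ ≤ d₂)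
    (hm : IsStandardMonomial (reesQuadrics a₁ b₁ c₁ d₁ a₂ b₂ c₂ d₂) m)
    (hZ : ∃ v, m (Sum.inr (Sum.inr v)) ≠ 0)
    (hN : ∀ v, m (Sum.inr (Sum.inr v)) ≠ 0 → (v : Fin n →₀ ℕ) ∉ BM a₂ b₂) :
    HasSeparatingWeight a₁ b₁ c₁ d₁ a₂ b₂ c₂ d₂
      (fun x y => ∃ (p q : Fin n) (u : ↥(BM a₁ b₁ ∪ BN b₁ c₁ d₁)), p.val = x ∧ q.val = y ∧
        (u : Fin n →₀ ℕ) = edge p q ∧ m (Sum.inr (Sum.inl u)) ≠ 0)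
      (fun x y z w => ∃ (p q r s : Fin n) (u u' : ↥(BM a₁ b₁ ∪ BN b₁ c₁ d₁)),
        p.val = x ∧ q.val = y ∧ r.val = z ∧ s.val = w ∧
        (u : Fin n →₀ ℕ) = edge p q ∧ (u' : Fin n →₀ ℕ) = edge r s ∧
        Finsupp.single (Sum.inr (Sum.inl u)) 1 + Finsupp.single (Sum.inr (Sum.inl u')) 1 ≤ m)
      (fun x y => ∃ (p q : Fin n) (v : ↥(BM a₂ b₂ ∪ BN b₂ c₂ d₂)), p.val = x ∧ q.val = y ∧
        (v : Fin n →₀ ℕ) = edge p q ∧ m (Sum.inr (Sum.inr v)) ≠ 0) := by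
  have : Finite ↥(BM a₂ b₂ ∪ BN b₂ c₂ d₂) := finite_generators a₂ b₂ c₂ d₂
  obtain ⟨v₀, hv₀, hmax⟩ := Set.exists_max_image {v | m (Sum.inr (Sum.inr v)) ≠ 0}
    (fun v => varKey a₁ b₁ c₁ d₁ a₂ b₂ c₂ d₂ (Sum.inr (Sum.inr v))) (Set.toFinite _) hZ
  obtain ⟨i, κ, hi, hκ, hκd, he₀⟩ := v₀.2.resolve_left (hN v₀ hv₀)
  change (v₀ : Fin n →₀ ℕ) = edge i κ at he₀
  have tz : ∀ {x s x' s' k l : Fin n} (u : ↥(BM a₁ b₁ ∪ BN b₁ c₁ d₁)),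
      (u : Fin n →₀ ℕ) = edge x s → m (Sum.inr (Sum.inl u)) ≠ 0 →
      PairE a₁ b₁ c₁ d₁ x' s' → PairE a₂ b₂ c₂ d₂ k l →
      edge x s + edge i κ = edge x' s' + edge k l →
      ¬ MrlexGt a₂ b₂ c₂ d₂ (edge i κ) (edge k l) := by
    intro x s x' s' k l u hu hmu h1 h2 hadd hgt
    refine not_T_add_Z_le hm (u := u) (u' := ⟨_, (edge_mem h12).mpr h1⟩) (v := v₀)
      (v' := ⟨_, (edge_mem h22).mpr h2⟩) ?_ ?_
      (single_add_single_le_of_ne (by simp) hmu hv₀)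
    · rw [hu, he₀]
      exact hadd
    · rw [he₀]
      exact hgt
  have hiκ : edge i κ ∈ BN b₂ c₂ d₂ := edge_mem_BN.mpr (Or.inl ⟨hi, hκ, hκd⟩)
  refine hasSeparatingWeight (i := i.val) (κ := κ.val) h11 h12 h13 h21 h22 hκ ?_ ?_ ?_ ?_ ?_ ?_
    ?_ ?_ ?_
  · rintro _ _ ⟨p, q, v, rfl, rfl, hv, hmv⟩
    obtain ⟨k, l, hk, hl, hld, he⟩ := v.2.resolve_left (hN v hmv)
    have h := le_of_isGreatest_Z h22 hm hv₀ hmv he₀ he ⟨hi, hκ, hκd⟩ ⟨hk, hl, hld⟩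
      (h21.trans_le h22) (hmax v hmv)
    rcases edge_eq_edge_iff.mp (hv.symm.trans he) with ⟨rfl, rfl⟩ | ⟨rfl, rfl⟩
    · exact Or.inl h
    · exact Or.inr h
  · rintro _ _ ⟨p, q, u, rfl, rfl, hu, -⟩
    exact (edge_mem h12).mp (hu ▸ u.2)
  · rintro _ _ ⟨p, q, u, rfl, rfl, hu, hmu⟩
    exact ⟨q, p, u, rfl, rfl, hu.trans (edge_comm p q), hmu⟩
  · rintro _ _ _ _ ⟨p, q, r, s, u, u', rfl, rfl, rfl, rfl, -, hu', hle⟩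
    exact ⟨r, s, u', rfl, rfl, hu',
      ne_zero_of_single_add_le (add_comm (Finsupp.single _ 1) _ ▸ hle)⟩
  · rintro _ _ _ _ ⟨p, q, u, rfl, rfl, hu, hmu⟩ ⟨r, s, u', rfl, rfl, hu', hmu'⟩
    by_cases heq : u = u'
    · subst heq
      have := edge_eq_edge_iff.mp (hu.symm.trans hu')
      omega
    · exact Or.inr (Or.inr ⟨p, q, r, s, u, u', rfl, rfl, rfl, rfl, hu, hu',
        single_add_single_le_of_ne (by simpa using heq) hmu hmu'⟩)
  · rintro _ _ _ _ ⟨x, y, z, w, u, u', rfl, rfl, rfl, rfl, hu, hu', hle⟩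
    suffices H : ∀ p q r s : Fin n, (u : Fin n →₀ ℕ) = edge p q →
        (u' : Fin n →₀ ℕ) = edge r s →
        ¬ (PairE a₁ b₁ c₁ d₁ p r ∧ PairE a₁ b₁ c₁ d₁ q s ∧ q < r ∧ s < p) by
      rintro _ _ _ _ (⟨rfl, rfl⟩ | ⟨rfl, rfl⟩) (⟨rfl, rfl⟩ | ⟨rfl, rfl⟩)
      · exact H _ _ _ _ hu hu'
      · exact H _ _ _ _ hu (hu'.trans (edge_comm _ _))
      · exact H _ _ _ _ (hu.trans (edge_comm _ _)) hu'
      · exact H _ _ _ _ (hu.trans (edge_comm _ _)) (hu'.trans (edge_comm _ _))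
    rintro p q r s hu hu' ⟨h1, h2, h3, h4⟩
    refine not_T_add_T_le hm (u' := ⟨_, (edge_mem h12).mpr h2⟩)
      (v' := ⟨_, (edge_mem h12).mpr h1⟩) ?_ ?_ ?_ hle
    · rw [hu, hu']
      dsimp only [edge]
      abel
    · rw [hu]
      apply rlexGt_edge
      unfold PairGt
      omega
    · rw [hu']
      apply rlexGt_edge
      unfold PairGt
      omega
  · rintro _ _ ⟨x, s, u, rfl, rfl, hu, hmu⟩
    by_contra! hlt
    have hE := (edge_mem h12).mp (hu ▸ u.2)
    refine tz (x' := x) (s' := κ) (k := i) (l := s) u hu hmu ?_ ?_ ?_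
      (Or.inr (Or.inr ⟨hiκ, ?_, ?_⟩))
    · unfold PairE PairM PairN at *
      omega
    · unfold PairE PairM PairN at *
      omega
    · unfold edge
      abel
    · rw [edge_mem_BN]
      unfold PairE PairM PairN at *
      omega
    · exact rlexGt_edge_of_le (by omega) (by omega) (Or.inl hlt)
  · rintro _ _ ⟨x, s, u, rfl, rfl, hu, hmu⟩ hx hE
    have hM : PairM a₂ b₂ i x := by
      unfold PairM
      omega
    refine tz u hu hmu hE (Or.inl hM) ?_ (Or.inl ⟨hiκ, (edge_mem_BM h22).mpr hM⟩)
    unfold edge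
    abel
  · rintro _ _ ⟨x, s, u, rfl, rfl, hu, hmu⟩ hM hE
    exact tz u hu hmu hE (Or.inl hM) (add_comm _ _) (Or.inl ⟨hiκ, (edge_mem_BM h22).mpr hM⟩)

theorem exists_Z_mem_BM (h11 : c₁ < a₁) (h12 : a₁ ≤ b₁) (h13 : b₁ < d₁)
    (h21 : c₂ < a₂) (h22 : a₂ ≤ b₂) (hd : d₁ ≤ d₂)
    (hm : IsStandardMonomial (reesQuadrics a₁ b₁ c₁ d₁ a₂ b₂ c₂ d₂) m)
    (hX : ∀ i, m (Sum.inl i) = 0) (hX' : ∀ i, m' (Sum.inl i) = 0)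
    (h : expHom (reesExp a₁ b₁ c₁ d₁ a₂ b₂ c₂ d₂) m =
      expHom (reesExp a₁ b₁ c₁ d₁ a₂ b₂ c₂ d₂) m')
    (hZ : ∃ v, m (Sum.inr (Sum.inr v)) ≠ 0)
    (hZ' : ∃ v, m' (Sum.inr (Sum.inr v)) ≠ 0 ∧ (v : Fin n →₀ ℕ) ∈ BM a₂ b₂) :
    ∃ v, m (Sum.inr (Sum.inr v)) ≠ 0 ∧ (v : Fin n →₀ ℕ) ∈ BM a₂ b₂ := by
  by_contra! hN
  obtain ⟨g, tT, tZ, δ, hE, hNle, hMle, hZ1, hδ, hT⟩ :=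
    exists_hasSeparatingWeight h11 h12 h13 h21 h22 hd hm hZ hN
  obtain ⟨⟨v, hv⟩, hmv, hvM⟩ := hZ'
  have hca₁ := h11.le.trans h12
  have hca₂ := h21.le.trans h22
  set ψ : (Fin n ⊕ Fin 2 →₀ ℕ) →+ ℤ :=
    weightHom (Sum.elim (fun x : Fin n => g x) ![-tT, -tZ]) with hψ
  have hψT : ∀ {p q : Fin n} (u : ↥(BM a₁ b₁ ∪ BN b₁ c₁ d₁)), (u : Fin n →₀ ℕ) = edge p q →
      ψ (reesExp a₁ b₁ c₁ d₁ a₂ b₂ c₂ d₂ (Sum.inr (Sum.inl u))) = g p + g q - tT := by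
    rintro p q ⟨_, hu⟩ rfl
    rw [hψ, weightHom_T]
    simp [sub_eq_add_neg]
  have hψZ : ∀ {p q : Fin n} (u : ↥(BM a₂ b₂ ∪ BN b₂ c₂ d₂)), (u : Fin n →₀ ℕ) = edge p q →
      ψ (reesExp a₁ b₁ c₁ d₁ a₂ b₂ c₂ d₂ (Sum.inr (Sum.inr u))) = g p + g q - tZ := by
    rintro p q ⟨_, hu⟩ rfl
    rw [hψ, weightHom_Z]
    simp [sub_eq_add_neg]
  have hZpos : ∀ w, m (Sum.inr (Sum.inr w)) ≠ 0 →
      0 ≤ ψ (reesExp a₁ b₁ c₁ d₁ a₂ b₂ c₂ d₂ (Sum.inr (Sum.inr w))) := by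
    intro w hw
    obtain ⟨p, q, -, he⟩ := exists_eq_edge hca₂ w.2
    rw [hψZ w he]
    have := hZ1 p q ⟨p, q, w, rfl, rfl, he, hw⟩
    omega
  have hlow : δ ≤ -ψ (expHom (reesExp a₁ b₁ c₁ d₁ a₂ b₂ c₂ d₂) m') := by
    obtain ⟨i, j, -, rfl⟩ := exists_eq_edge hca₂ hv
    refine le_trans ?_ (weight_le_weight_expHom (-ψ) hmv fun w hw => ?_)
    · rw [AddMonoidHom.neg_apply, hψZ _ rfl]
      have := hMle _ _ ((edge_mem_BM h22).mp hvM)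
      omega
    · have hw0 : m' w ≠ 0 := ne_zero_of_single_add_le (add_comm (Finsupp.single _ 1) _ ▸ hw)
      rw [AddMonoidHom.neg_apply]
      rcases w with k | u | u
      · exact absurd (hX' k) hw0
      · obtain ⟨p, q, -, he⟩ := exists_eq_edge hca₁ u.2
        rw [hψT u he]
        have := hE p q ((edge_mem h12).mp (he ▸ u.2))
        omega
      · obtain ⟨p, q, -, he⟩ := exists_eq_edge hca₂ u.2
        rw [hψZ u he]
        rcases (edge_mem h22).mp (he ▸ u.2) with hM' | hN'
        · have := hMle _ _ hM'
          omega
        · have := hNle _ _ hN'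
          omega
  rw [← h] at hlow
  rcases hT with hT | ⟨hδ2, x₀, y₀, ⟨p₀, q₀, u₀, rfl, rfl, he₀, hu₀⟩, hge, hT2⟩
  · have : 0 ≤ ψ (expHom (reesExp a₁ b₁ c₁ d₁ a₂ b₂ c₂ d₂) m) := by
      refine weight_expHom_nonneg ψ fun w hw0 => ?_
      rcases w with k | u | u
      · exact absurd (hX k) hw0
      · obtain ⟨p, q, -, he⟩ := exists_eq_edge hca₁ u.2
        rw [hψT u he]
        have := hT p q ⟨p, q, u, rfl, rfl, he, hw0⟩
        omega
      · exact hZpos u hw0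
    omega
  · have := weight_le_weight_expHom (U := reesExp a₁ b₁ c₁ d₁ a₂ b₂ c₂ d₂) ψ hu₀ fun w hw => by
      have hw0 : m w ≠ 0 := ne_zero_of_single_add_le (add_comm (Finsupp.single _ 1) _ ▸ hw)
      rcases w with k | u | u
      · exact absurd (hX k) hw0
      · obtain ⟨p, q, -, he⟩ := exists_eq_edge hca₁ u.2
        rw [hψT u he]
        have := hT2 p q ⟨p₀, q₀, p, q, u₀, u, rfl, rfl, rfl, rfl, he₀, he, hw⟩
        omega
      · exact hZpos u hw0
    rw [hψT u₀ he₀] at this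
    omega

end separation

section share

variable {n : ℕ} {a₁ b₁ c₁ d₁ a₂ b₂ c₂ d₂ : Fin n}
  {m m' : ReesVar a₁ b₁ c₁ d₁ a₂ b₂ c₂ d₂ →₀ ℕ}

theorem exists_X_of_expHom_eq (hcb₁ : c₁ ≤ b₁) (hcb₂ : c₂ ≤ b₂)
    (h : expHom (reesExp a₁ b₁ c₁ d₁ a₂ b₂ c₂ d₂) m =
      expHom (reesExp a₁ b₁ c₁ d₁ a₂ b₂ c₂ d₂) m')
    (hX : ∃ i, m (Sum.inl i) ≠ 0) : ∃ i, m' (Sum.inl i) ≠ 0 := by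
  by_contra! hX'
  obtain ⟨i, hi⟩ := hX
  set ψ : (Fin n ⊕ Fin 2 →₀ ℕ) →+ ℤ := weightHom (Sum.elim (fun _ => 1) fun _ => -2) with hψ
  have hψX : ∀ j, ψ (reesExp a₁ b₁ c₁ d₁ a₂ b₂ c₂ d₂ (Sum.inl j)) = 1 := fun j => by
    simp [hψ, reesExp]
  have hψTZ : ∀ w, ψ (reesExp a₁ b₁ c₁ d₁ a₂ b₂ c₂ d₂ (Sum.inr w)) = 0 := by
    rintro (⟨u, hu⟩ | ⟨v, hv⟩)
    · obtain ⟨p, q, -, rfl⟩ := exists_eq_edge hcb₁ hu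
      rw [hψ, weightHom_T]
      simp
    · obtain ⟨p, q, -, rfl⟩ := exists_eq_edge hcb₂ hv
      rw [hψ, weightHom_Z]
      simp
  have h1 := weight_le_weight_expHom (U := reesExp a₁ b₁ c₁ d₁ a₂ b₂ c₂ d₂) ψ hi fun w _ => by
    rcases w with j | w
    · rw [hψX]
      exact zero_le_one
    · rw [hψTZ]
  have h2 := weight_expHom_nonneg (U := reesExp a₁ b₁ c₁ d₁ a₂ b₂ c₂ d₂) (-ψ) (m := m')
    fun w hw => by
      rcases w with j | w
      · exact absurd (hX' j) hw
      · rw [AddMonoidHom.neg_apply, hψTZ, neg_zero]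
  rw [hψX, h] at h1
  rw [AddMonoidHom.neg_apply] at h2
  omega

theorem exists_Z_of_expHom_eq
    (h : expHom (reesExp a₁ b₁ c₁ d₁ a₂ b₂ c₂ d₂) m =
      expHom (reesExp a₁ b₁ c₁ d₁ a₂ b₂ c₂ d₂) m')
    (hZ : ∃ v, m (Sum.inr (Sum.inr v)) ≠ 0) : ∃ v, m' (Sum.inr (Sum.inr v)) ≠ 0 := by
  obtain ⟨v, hv⟩ := hZ
  have hpos := (reesExp_apply_inr_one_pos_iff.mpr ⟨v, rfl⟩).trans_le
    (le_expHom_apply (U := reesExp a₁ b₁ c₁ d₁ a₂ b₂ c₂ d₂) hv (Sum.inr 1))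
  rw [h] at hpos
  obtain ⟨w, hw, hw'⟩ := exists_apply_pos_of_expHom_pos hpos
  obtain ⟨v', rfl⟩ := reesExp_apply_inr_one_pos_iff.mp hw'
  exact ⟨v', hw⟩

theorem varKey_le_of_isLeast_Z (h11 : c₁ < a₁) (h12 : a₁ ≤ b₁) (h13 : b₁ < d₁)
    (h21 : c₂ < a₂) (h22 : a₂ ≤ b₂) (hd : d₁ ≤ d₂)
    (hm : IsStandardMonomial (reesQuadrics a₁ b₁ c₁ d₁ a₂ b₂ c₂ d₂) m)
    (hX : ∀ i, m (Sum.inl i) = 0) (hX' : ∀ i, m' (Sum.inl i) = 0)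
    (h : expHom (reesExp a₁ b₁ c₁ d₁ a₂ b₂ c₂ d₂) m =
      expHom (reesExp a₁ b₁ c₁ d₁ a₂ b₂ c₂ d₂) m')
    {v v' : ↥(BM a₂ b₂ ∪ BN b₂ c₂ d₂)} (hv : m (Sum.inr (Sum.inr v)) ≠ 0)
    (hv' : m' (Sum.inr (Sum.inr v')) ≠ 0)
    (hleast : ∀ w, m (Sum.inr (Sum.inr w)) ≠ 0 →
      varKey a₁ b₁ c₁ d₁ a₂ b₂ c₂ d₂ (Sum.inr (Sum.inr v)) ≤
        varKey a₁ b₁ c₁ d₁ a₂ b₂ c₂ d₂ (Sum.inr (Sum.inr w))) :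
    varKey a₁ b₁ c₁ d₁ a₂ b₂ c₂ d₂ (Sum.inr (Sum.inr v)) ≤
      varKey a₁ b₁ c₁ d₁ a₂ b₂ c₂ d₂ (Sum.inr (Sum.inr v')) := by
  rw [← not_lt, varKey_Z_lt_Z_iff h22]
  by_cases hkind : (v : Fin n →₀ ℕ) ∈ BM a₂ b₂ ↔ (v' : Fin n →₀ ℕ) ∈ BM a₂ b₂
  · exact not_mrlexGt_of_isLeast_of_mem_iff h11 h12 h21 h22 hm hX h hv hv' hleast hkind
  by_cases hvM : (v : Fin n →₀ ℕ) ∈ BM a₂ b₂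
  · rintro (⟨hN, -⟩ | ⟨-, hM, -⟩ | ⟨hN, -, -⟩)
    · exact notMem_BM_of_mem_BN h22 hN hvM
    · exact hkind (iff_of_true hvM hM)
    · exact notMem_BM_of_mem_BN h22 hN hvM
  · obtain ⟨w, hw, hwM⟩ := exists_Z_mem_BM h11 h12 h13 h21 h22 hd hm hX hX' h ⟨v, hv⟩
      ⟨v', hv', by tauto⟩
    exact absurd ((varKey_Z_lt_Z_iff h22).mpr (Or.inl ⟨v.2.resolve_left hvM, hwM⟩))
      (hleast w hw).not_gt

theorem exists_mem_of_expHom_eq (h11 : c₁ < a₁) (h12 : a₁ ≤ b₁) (h13 : b₁ < d₁)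
    (h21 : c₂ < a₂) (h22 : a₂ ≤ b₂) (hd : d₁ ≤ d₂)
    (hm : IsStandardMonomial (reesQuadrics a₁ b₁ c₁ d₁ a₂ b₂ c₂ d₂) m)
    (hm' : IsStandardMonomial (reesQuadrics a₁ b₁ c₁ d₁ a₂ b₂ c₂ d₂) m')
    (h : expHom (reesExp a₁ b₁ c₁ d₁ a₂ b₂ c₂ d₂) m =
      expHom (reesExp a₁ b₁ c₁ d₁ a₂ b₂ c₂ d₂) m')
    (hne : m ≠ 0) (hne' : m' ≠ 0) : ∃ v, m v ≠ 0 ∧ m' v ≠ 0 := by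
  have hcb₁ := h11.le.trans h12
  have hcb₂ := h21.le.trans h22
  by_cases hX : ∃ i, m (Sum.inl i) ≠ 0
  · have hX' := exists_X_of_expHom_eq hcb₁ hcb₂ h hX
    obtain ⟨i, hi⟩ := hX
    obtain ⟨k, hk, hmax⟩ := Set.exists_max_image
      {k | 0 < expHom (reesExp a₁ b₁ c₁ d₁ a₂ b₂ c₂ d₂) m (Sum.inl k)} id (Set.toFinite _)
      ⟨i, (show 0 < _ by simp [reesExp]).trans_le (le_expHom_apply hi _)⟩
    refine ⟨Sum.inl k, X_mem_of_isGreatest h11 h12 h21 h22 hm ⟨i, hi⟩ hk hmax, ?_⟩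
    simp only [Set.mem_ofPred_eq, h] at hk hmax
    exact X_mem_of_isGreatest h11 h12 h21 h22 hm' hX' hk hmax
  have hX' : ¬ ∃ i, m' (Sum.inl i) ≠ 0 := fun hX' => hX (exists_X_of_expHom_eq hcb₁ hcb₂ h.symm hX')
  push Not at hX hX'
  by_cases hZ : ∃ v, m (Sum.inr (Sum.inr v)) ≠ 0
  · have hZ' := exists_Z_of_expHom_eq h hZ
    have : Finite ↥(BM a₂ b₂ ∪ BN b₂ c₂ d₂) := finite_generators a₂ b₂ c₂ d₂
    obtain ⟨v, hv, hmin⟩ := Set.exists_min_image {v | m (Sum.inr (Sum.inr v)) ≠ 0}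
      (fun v => varKey a₁ b₁ c₁ d₁ a₂ b₂ c₂ d₂ (Sum.inr (Sum.inr v))) (Set.toFinite _) hZ
    obtain ⟨v', hv', hmin'⟩ := Set.exists_min_image {v | m' (Sum.inr (Sum.inr v)) ≠ 0}
      (fun v => varKey a₁ b₁ c₁ d₁ a₂ b₂ c₂ d₂ (Sum.inr (Sum.inr v))) (Set.toFinite _) hZ'
    have heq := varKey_injective (le_antisymm
      (varKey_le_of_isLeast_Z h11 h12 h13 h21 h22 hd hm hX hX' h hv hv' hmin)
      (varKey_le_of_isLeast_Z h11 h12 h13 h21 h22 hd hm' hX' hX h.symm hv' hv hmin'))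
    exact ⟨_, hv, heq ▸ hv'⟩
  have hZ' : ¬ ∃ v, m' (Sum.inr (Sum.inr v)) ≠ 0 := fun hZ' => hZ (exists_Z_of_expHom_eq h.symm hZ')
  push Not at hZ hZ'
  have hT : ∀ r : ReesVar a₁ b₁ c₁ d₁ a₂ b₂ c₂ d₂ →₀ ℕ, r ≠ 0 → (∀ i, r (Sum.inl i) = 0) →
      (∀ v, r (Sum.inr (Sum.inr v)) = 0) → ∃ u, r (Sum.inr (Sum.inl u)) ≠ 0 ∧
        ∀ w, r (Sum.inr (Sum.inl w)) ≠ 0 → ¬ RlexGt (u : Fin n →₀ ℕ) (w : Fin n →₀ ℕ) := by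
    intro r hr hrX hrZ
    have : Finite ↥(BM a₁ b₁ ∪ BN b₁ c₁ d₁) := finite_generators a₁ b₁ c₁ d₁
    obtain ⟨u, hu, hmin⟩ := Set.exists_min_image {u | r (Sum.inr (Sum.inl u)) ≠ 0}
      (fun u => varKey a₁ b₁ c₁ d₁ a₂ b₂ c₂ d₂ (Sum.inr (Sum.inl u))) (Set.toFinite _) (by
        obtain ⟨w, hw⟩ := Finsupp.ne_iff.mp hr
        rcases w with i | u | v
        · exact absurd (hrX i) hw
        · exact ⟨u, hw⟩
        · exact absurd (hrZ v) hw)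
    exact ⟨u, hu, fun w hw hgt => (hmin w hw).not_gt (varKey_T_lt_T_iff.mpr hgt)⟩
  obtain ⟨u, hu, hmin⟩ := hT m hne hX hZ
  obtain ⟨u', hu', hmin'⟩ := hT m' hne' hX' hZ'
  have h1 := not_rlexGt_of_isLeast h11 h12 hm hX hZ h hu hu' hmin
  have h2 := not_rlexGt_of_isLeast h11 h12 hm' hX' hZ' h.symm hu' hu hmin'
  rw [← toColex_lt_iff_rlexGt, not_lt] at h1 h2
  have heq : u = u' := Subtype.ext (toColex.injective (le_antisymm h2 h1))
  exact ⟨_, hu, heq ▸ hu'⟩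

end share

section presentation

open MvPolynomial in
theorem exists_isMarkedGB_of_quadratic {V W L K : Type*} [Field K] [Finite V] [LinearOrder L]
    {key : V → L} (hkey : Function.Injective key) {G : Set (MarkedBinomial V)} {U : V → W →₀ ℕ}
    (hU : ∀ v, U v ≠ 0)
    (hG : ∀ g ∈ G, ∃ p q r s, g.head = Finsupp.single p 1 + Finsupp.single q 1 ∧
      g.tail = Finsupp.single r 1 + Finsupp.single s 1 ∧ U p + U q = U r + U s ∧
      key s < key p ∧ key s < key q)
    (hshare : ∀ m m', IsStandardMonomial G m → IsStandardMonomial G m' →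
      expHom U m = expHom U m' → m ≠ 0 → m' ≠ 0 → ∃ v, m v ≠ 0 ∧ m' v ≠ 0)
    {φ : MvPolynomial V K →ₐ[K] MvPolynomial W K} (hφ : ∀ v, φ (X v) = monomial (U v) 1) :
    ∃ ord : MonomialOrd V, IsMarkedGB ord.gt G (RingHom.ker φ.toRingHom) ∧
      RingHom.ker φ.toRingHom = Ideal.span ((fun g => g.toPoly K) '' G) := by
  let _ : LinearOrder V := LinearOrder.lift' key hkey
  have hmonomial : ∀ m (c : K), φ (monomial m c) = monomial (expHom U m) c := by
    intro m c
    rw [monomial_eq, map_mul, ← algebraMap_eq, AlgHom.commutes, Finsupp.prod, map_prod,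
      expHom_apply, Finsupp.sum, ← mul_one c, ← C_mul_monomial, mul_one, monomial_sum_one]
    simp [hφ, monomial_pow, algebraMap_eq]
  have hF : ∀ g ∈ G, expHom U g.head = expHom U g.tail := by
    intro g hg
    obtain ⟨p, q, r, s, h1, h2, h3, -, -⟩ := hG g hg
    rw [h1, h2, map_add, map_add, expHom_single, expHom_single, expHom_single, expHom_single, h3]
  have hdeg : ∀ g ∈ G, g.head.degree = g.tail.degree := by
    intro g hg
    obtain ⟨p, q, r, s, h1, h2, -⟩ := hG g hg
    simp [h1, h2]
  have hlex : ∀ g ∈ G, toLex g.head < toLex g.tail := by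
    intro g hg
    obtain ⟨p, q, r, s, h1, h2, -, h3, h4⟩ := hG g hg
    rw [h1, h2]
    exact toLex_add_single_lt h3 h4
  have huniq := eq_of_expHom_eq hU hshare
  exact ⟨gradedRevlexOrd V, isMarkedGB_of_standard_unique hmonomial hF hdeg hlex huniq,
    ker_eq_span_of_standard_unique hmonomial hF hdeg hlex huniq⟩

theorem reesQuadrics_spec {n : ℕ} {a₁ b₁ c₁ d₁ a₂ b₂ c₂ d₂ : Fin n} (h22 : a₂ ≤ b₂)
    {g : MarkedBinomial (ReesVar a₁ b₁ c₁ d₁ a₂ b₂ c₂ d₂)}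
    (hg : g ∈ reesQuadrics a₁ b₁ c₁ d₁ a₂ b₂ c₂ d₂) :
    ∃ p q r s, g.head = Finsupp.single p 1 + Finsupp.single q 1 ∧
      g.tail = Finsupp.single r 1 + Finsupp.single s 1 ∧
      reesExp a₁ b₁ c₁ d₁ a₂ b₂ c₂ d₂ p + reesExp a₁ b₁ c₁ d₁ a₂ b₂ c₂ d₂ q =
        reesExp a₁ b₁ c₁ d₁ a₂ b₂ c₂ d₂ r + reesExp a₁ b₁ c₁ d₁ a₂ b₂ c₂ d₂ s ∧
      varKey a₁ b₁ c₁ d₁ a₂ b₂ c₂ d₂ s < varKey a₁ b₁ c₁ d₁ a₂ b₂ c₂ d₂ p ∧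
      varKey a₁ b₁ c₁ d₁ a₂ b₂ c₂ d₂ s < varKey a₁ b₁ c₁ d₁ a₂ b₂ c₂ d₂ q := by
  have hmap : ∀ {x y z w : Fin n →₀ ℕ}, x + y = z + w →
      Finsupp.mapDomain (Sum.inl : Fin n → Fin n ⊕ Fin 2) x + Finsupp.mapDomain Sum.inl y =
        Finsupp.mapDomain Sum.inl z + Finsupp.mapDomain Sum.inl w := fun h => by
    rw [← Finsupp.mapDomain_add, h, Finsupp.mapDomain_add]
  obtain ⟨head, tail⟩ := g
  rcases hg with (⟨i, j, u, u', hij, h, rfl, rfl⟩ | ⟨i, j, v, v', hij, h, rfl, rfl⟩) |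
    ⟨_, (⟨_, ⟨u, v, u', v', h, hu, hv, h1, h2⟩, rfl⟩ |
      ⟨_, ⟨u, v, u', v', h, hu, hv, h1, h2⟩, rfl⟩) |
      ⟨u, u', v, v', h, hv, h1, h2⟩, heq⟩
  · refine ⟨_, _, _, _, rfl, add_comm _ _, ?_, varKey_X_lt_X hij, varKey_X_lt_inr _ _⟩
    have := hmap h
    simp only [Finsupp.mapDomain_single] at this
    simp only [reesExp, TZexp, Sum.elim_inl, Sum.elim_inr]
    rw [← add_assoc, this]
    abel
  · refine ⟨_, _, _, _, rfl, add_comm _ _, ?_, varKey_X_lt_X hij, varKey_X_lt_inr _ _⟩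
    have := hmap h
    simp only [Finsupp.mapDomain_single] at this
    simp only [reesExp, TZexp, Sum.elim_inl, Sum.elim_inr]
    rw [← add_assoc, this]
    abel
  · simp only [MarkedBinomial.map, h1, h2, Finsupp.mapDomain_add, Finsupp.mapDomain_single,
      MarkedBinomial.mk.injEq] at heq
    refine ⟨_, _, _, _, heq.1.symm, heq.2.symm, ?_, varKey_T_lt_T_iff.mpr hu,
      varKey_T_lt_T_iff.mpr hv⟩
    simp only [reesExp, TZexp, Sum.elim_inl, Sum.elim_inr]
    rw [add_add_add_comm, hmap h]
    abel
  · simp only [MarkedBinomial.map, h1, h2, Finsupp.mapDomain_add, Finsupp.mapDomain_single,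
      MarkedBinomial.mk.injEq] at heq
    refine ⟨_, _, _, _, heq.1.symm, heq.2.symm, ?_, (varKey_Z_lt_Z_iff h22).mpr hu,
      (varKey_Z_lt_Z_iff h22).mpr hv⟩
    simp only [reesExp, TZexp, Sum.elim_inr]
    rw [add_add_add_comm, hmap h]
    abel
  · simp only [MarkedBinomial.map, h1, h2, Finsupp.mapDomain_add, Finsupp.mapDomain_single,
      MarkedBinomial.mk.injEq] at heq
    refine ⟨_, _, _, _, heq.1.symm, heq.2.symm, ?_, varKey_Z_lt_T _ _,
      (varKey_Z_lt_Z_iff h22).mpr hv⟩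
    simp only [reesExp, TZexp, Sum.elim_inl, Sum.elim_inr]
    rw [add_add_add_comm, hmap h]
    abel

end presentation

/-- For strongly stable ideals `I₁ = B(x_{a₁}x_{b₁}, x_{c₁}x_{d₁})` and
`I₂ = B(x_{a₂}x_{b₂}, x_{c₂}x_{d₂})` with `cᵢ < aᵢ ≤ bᵢ < dᵢ` and `d₁ ≤ d₂`, there is a
monomial order on `S[T_u, Z_v]` for which the quadratic marked binomials
`{x_i T_u − x_j T_{u'} : i < j, x_i u = x_j u'} ∪ {x_i Z_v − x_j Z_{v'} : i < j,
x_i v = x_j v'} ∪ G₁ ∪ G₂ ∪ G₃` form a Gröbner basis of the defining ideal `ker φ` of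
the multi-Rees algebra `R(I₁ ⊕ I₂)`, with the marked terms as initial terms; in
particular, `ker φ` is generated by these quadratic binomials. -/
theorem multiRees_two_quadrics_GB {n : ℕ} {K : Type} [Field K]
    (a₁ b₁ c₁ d₁ a₂ b₂ c₂ d₂ : Fin n)
    (h11 : c₁ < a₁) (h12 : a₁ ≤ b₁) (h13 : b₁ < d₁)
    (h21 : c₂ < a₂) (h22 : a₂ ≤ b₂) (h23 : b₂ < d₂) (hd : d₁ ≤ d₂)
    (φ : MvPolynomial
        (Fin n ⊕ (↥(BM a₁ b₁ ∪ BN b₁ c₁ d₁) ⊕ ↥(BM a₂ b₂ ∪ BN b₂ c₂ d₂))) K →ₐ[K]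
      MvPolynomial (Fin n ⊕ Fin 2) K)
    (hφ : φ = MvPolynomial.aeval (Sum.elim
      (fun i => (MvPolynomial.X (Sum.inl i) : MvPolynomial (Fin n ⊕ Fin 2) K))
      (fun w => MvPolynomial.monomial
        (TZexp (BM a₁ b₁ ∪ BN b₁ c₁ d₁) (BM a₂ b₂ ∪ BN b₂ c₂ d₂) w) (1 : K)))) :
    ∃ ord : MonomialOrd
        (Fin n ⊕ (↥(BM a₁ b₁ ∪ BN b₁ c₁ d₁) ⊕ ↥(BM a₂ b₂ ∪ BN b₂ c₂ d₂))),
      IsMarkedGB ord.gt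
        (({g : MarkedBinomial
              (Fin n ⊕ (↥(BM a₁ b₁ ∪ BN b₁ c₁ d₁) ⊕ ↥(BM a₂ b₂ ∪ BN b₂ c₂ d₂))) |
            ∃ (i j : Fin n) (u u' : ↥(BM a₁ b₁ ∪ BN b₁ c₁ d₁)), i < j ∧
              Finsupp.single i 1 + (u : Fin n →₀ ℕ) =
                Finsupp.single j 1 + (u' : Fin n →₀ ℕ) ∧
              g.head = Finsupp.single (Sum.inl i) 1 +
                Finsupp.single (Sum.inr (Sum.inl u)) 1 ∧
              g.tail = Finsupp.single (Sum.inl j) 1 +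
                Finsupp.single (Sum.inr (Sum.inl u')) 1} ∪
          {g : MarkedBinomial
              (Fin n ⊕ (↥(BM a₁ b₁ ∪ BN b₁ c₁ d₁) ⊕ ↥(BM a₂ b₂ ∪ BN b₂ c₂ d₂))) |
            ∃ (i j : Fin n) (v v' : ↥(BM a₂ b₂ ∪ BN b₂ c₂ d₂)), i < j ∧
              Finsupp.single i 1 + (v : Fin n →₀ ℕ) =
                Finsupp.single j 1 + (v' : Fin n →₀ ℕ) ∧
              g.head = Finsupp.single (Sum.inl i) 1 +
                Finsupp.single (Sum.inr (Sum.inr v)) 1 ∧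
              g.tail = Finsupp.single (Sum.inl j) 1 +
                Finsupp.single (Sum.inr (Sum.inr v')) 1}) ∪
          (MarkedBinomial.map Sum.inr '' GHT a₁ b₁ c₁ d₁ a₂ b₂ c₂ d₂))
        (RingHom.ker φ.toRingHom) ∧
      RingHom.ker φ.toRingHom =
        Ideal.span ((fun g => g.toPoly K) ''
          (({g : MarkedBinomial
                (Fin n ⊕ (↥(BM a₁ b₁ ∪ BN b₁ c₁ d₁) ⊕ ↥(BM a₂ b₂ ∪ BN b₂ c₂ d₂))) |
              ∃ (i j : Fin n) (u u' : ↥(BM a₁ b₁ ∪ BN b₁ c₁ d₁)), i < j ∧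
                Finsupp.single i 1 + (u : Fin n →₀ ℕ) =
                  Finsupp.single j 1 + (u' : Fin n →₀ ℕ) ∧
                g.head = Finsupp.single (Sum.inl i) 1 +
                  Finsupp.single (Sum.inr (Sum.inl u)) 1 ∧
                g.tail = Finsupp.single (Sum.inl j) 1 +
                  Finsupp.single (Sum.inr (Sum.inl u')) 1} ∪
            {g : MarkedBinomial
                (Fin n ⊕ (↥(BM a₁ b₁ ∪ BN b₁ c₁ d₁) ⊕ ↥(BM a₂ b₂ ∪ BN b₂ c₂ d₂))) |
              ∃ (i j : Fin n) (v v' : ↥(BM a₂ b₂ ∪ BN b₂ c₂ d₂)), i < j ∧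
                Finsupp.single i 1 + (v : Fin n →₀ ℕ) =
                  Finsupp.single j 1 + (v' : Fin n →₀ ℕ) ∧
                g.head = Finsupp.single (Sum.inl i) 1 +
                  Finsupp.single (Sum.inr (Sum.inr v)) 1 ∧
                g.tail = Finsupp.single (Sum.inl j) 1 +
                  Finsupp.single (Sum.inr (Sum.inr v')) 1}) ∪
            (MarkedBinomial.map Sum.inr '' GHT a₁ b₁ c₁ d₁ a₂ b₂ c₂ d₂))) := by
  have : Finite ↥(BM a₁ b₁ ∪ BN b₁ c₁ d₁) := finite_generators a₁ b₁ c₁ d₁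
  have : Finite ↥(BM a₂ b₂ ∪ BN b₂ c₂ d₂) := finite_generators a₂ b₂ c₂ d₂
  exact exists_isMarkedGB_of_quadratic varKey_injective reesExp_ne_zero
    (fun g hg => reesQuadrics_spec h22 hg)
    (fun m m' hm hm' h => exists_mem_of_expHom_eq h11 h12 h13 h21 h22 hd hm hm' h) (by
      rintro (i | w)
      · rw [hφ, MvPolynomial.aeval_X]
        rfl
      · rw [hφ, MvPolynomial.aeval_X]
        rfl)
end

section
/- Let a, b, c be non-negative integers and, in S = K[x_1, …, x_6] over a field K, let I_1 = B(x_3^2 x_6^a, x_1 x_5 x_6^a), I_2 = B(x_3^2 x_6^b, x_2 x_4 x_6^b), and I_3 = B(x_2 x_4 x_6^c, x_1 x_5 x_6^c). Then the cubic binomial F = T^{(1)}_{x_1x_5x_6^a} · T^{(2)}_{x_3^2x_6^b} · T^{(3)}_{x_2x_4x_6^c} − T^{(1)}_{x_3^2x_6^a} · T^{(2)}_{x_2x_4x_6^b} · T^{(3)}_{x_1x_5x_6^c} belongs to the toric ideal T(I_1 ⊕ I_2 ⊕ I_3), but F does not belong to the ideal generated by the homogeneous elements of T(I_1 ⊕ I_2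 ⊕ I_3) of degree at most 2; hence T(I_1 ⊕ I_2 ⊕ I_3) has a minimal generator of degree 3. -/
/-- `I₁ = B(x₃² x₆^a, x₁ x₅ x₆^a)` in `K[x₁, …, x₆]`. -/
noncomputable def Iex17_1 (K : Type) [Field K] (a : ℕ) : Ideal (MvPolynomial (Fin 6) K) :=
  smallestStronglyStable K
    {Finsupp.single (2 : Fin 6) 2 + Finsupp.single 5 a,
     Finsupp.single (0 : Fin 6) 1 + Finsupp.single 4 1 + Finsupp.single 5 a}

/-- `I₂ = B(x₃² x₆^b, x₂ x₄ x₆^b)` in `K[x₁, …, x₆]`. -/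
noncomputable def Iex17_2 (K : Type) [Field K] (b : ℕ) : Ideal (MvPolynomial (Fin 6) K) :=
  smallestStronglyStable K
    {Finsupp.single (2 : Fin 6) 2 + Finsupp.single 5 b,
     Finsupp.single (1 : Fin 6) 1 + Finsupp.single 3 1 + Finsupp.single 5 b}

/-- `I₃ = B(x₂ x₄ x₆^c, x₁ x₅ x₆^c)` in `K[x₁, …, x₆]`. -/
noncomputable def Iex17_3 (K : Type) [Field K] (c : ℕ) : Ideal (MvPolynomial (Fin 6) K) :=
  smallestStronglyStable K
    {Finsupp.single (1 : Fin 6) 1 + Finsupp.single 3 1 + Finsupp.single 5 c,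
     Finsupp.single (0 : Fin 6) 1 + Finsupp.single 4 1 + Finsupp.single 5 c}

/-- The toric map `T^{(i)}_u ↦ u·t_i` for the triple `I₁, I₂, I₃`. -/
noncomputable def phi17 (K : Type) [Field K] (a b c : ℕ) :
    MvPolynomial (↥(MinGens (Iex17_1 K a) (a + 2)) ⊕
      (↥(MinGens (Iex17_2 K b) (b + 2)) ⊕ ↥(MinGens (Iex17_3 K c) (c + 2)))) K →ₐ[K]
    MvPolynomial (Fin 6 ⊕ Fin 3) K :=
  MvPolynomial.aeval (Sum.elim
    (fun u => MvPolynomial.monomial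
      (Finsupp.mapDomain Sum.inl (u : Fin 6 →₀ ℕ) + Finsupp.single (Sum.inr 0) 1) 1)
    (Sum.elim
      (fun v => MvPolynomial.monomial
        (Finsupp.mapDomain Sum.inl (v : Fin 6 →₀ ℕ) + Finsupp.single (Sum.inr 1) 1) 1)
      (fun w => MvPolynomial.monomial
        (Finsupp.mapDomain Sum.inl (w : Fin 6 →₀ ℕ) + Finsupp.single (Sum.inr 2) 1) 1)))

/-- The sum of the exponents of `x_i` over all `i ≥ k`. -/
def suffixSum {n : ℕ} (k : Fin n) (m : Fin n →₀ ℕ) : ℕ := ∑ i ∈ Finset.Ici k, m i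

theorem suffixSum_add {n : ℕ} (k : Fin n) (m m' : Fin n →₀ ℕ) :
    suffixSum k (m + m') = suffixSum k m + suffixSum k m' := by
  simp [suffixSum, Finset.sum_add_distrib]

theorem suffixSum_single {n : ℕ} (k i : Fin n) (e : ℕ) :
    suffixSum k (Finsupp.single i e) = if k ≤ i then e else 0 := by
  simp [suffixSum, Finsupp.single_apply]

/-- Replacing a variable of a monomial by an earlier one does not increase suffix sums. -/
theorem suffixSum_swap_le {n : ℕ} (k : Fin n) {m : Fin n →₀ ℕ} {i j : Fin n} (hji : j < i)
    (hi : m i ≠ 0) :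
    suffixSum k (m - Finsupp.single i 1 + Finsupp.single j 1) ≤ suffixSum k m := by
  have h : m - Finsupp.single i 1 + Finsupp.single i 1 = m :=
    tsub_add_cancel_of_le (by simpa using Nat.one_le_iff_ne_zero.mpr hi)
  conv_rhs => rw [← h]
  rw [suffixSum_add, suffixSum_add, suffixSum_single, suffixSum_single]
  split_ifs <;> omega

theorem degree_swap {n : ℕ} {m : Fin n →₀ ℕ} {i : Fin n} (j : Fin n) (hi : m i ≠ 0) :
    (m - Finsupp.single i 1 + Finsupp.single j 1).degree = m.degree := by
  have h : m - Finsupp.single i 1 + Finsupp.single i 1 = m :=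
    tsub_add_cancel_of_le (by simpa using Nat.one_le_iff_ne_zero.mpr hi)
  conv_rhs => rw [← h]
  simp only [map_add, Finsupp.degree_single]

/-- A set of monomials closed under Borel moves generates a strongly stable ideal. -/
theorem stronglyStable_span {n : ℕ} (K : Type*) [Field K] (D : Set (Fin n →₀ ℕ))
    (hD : ∀ m ∈ D, ∀ i j : Fin n, j < i → m i ≠ 0 →
      m - Finsupp.single i 1 + Finsupp.single j 1 ∈ D) :
    StronglyStable
      (Ideal.span ((fun m => (MvPolynomial.monomial m (1 : K))) '' D)) := by
  refine ⟨⟨D, rfl⟩, fun m hm i j hji hi => ?_⟩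
  rw [MvPolynomial.mem_ideal_span_monomial_image] at hm ⊢
  obtain ⟨m', hm', hle⟩ := hm m (by simp [MvPolynomial.mem_support_iff])
  intro x hx
  obtain rfl : x = m - Finsupp.single i 1 + Finsupp.single j 1 := by
    by_contra hne
    rw [MvPolynomial.mem_support_iff, MvPolynomial.coeff_monomial, if_neg (Ne.symm hne)] at hx
    exact hx rfl
  by_cases h : m' i = 0
  · refine ⟨m', hm', fun l => ?_⟩
    have hl := hle l
    simp only [Finsupp.add_apply, Finsupp.tsub_apply, Finsupp.single_apply]
    by_cases hil : i = l
    · subst hil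
      simp [h]
    · rw [if_neg hil]
      omega
  · refine ⟨_, hD m' hm' i j hji h, ?_⟩
    gcongr

/-- The minimal generators of the strongly stable ideal generated by `Ms` lie in every set of
monomials of the same degree that contains `Ms` and is closed under Borel moves. -/
theorem minGens_smallestStronglyStable_subset {n : ℕ} (K : Type*) [Field K] {d : ℕ}
    {Ms D : Set (Fin n →₀ ℕ)} (hMs : Ms ⊆ D) (hdeg : ∀ m ∈ D, m.degree = d)
    (hD : ∀ m ∈ D, ∀ i j : Fin n, j < i → m i ≠ 0 →
      m - Finsupp.single i 1 + Finsupp.single j 1 ∈ D) :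
    MinGens (smallestStronglyStable K Ms) d ⊆ D := by
  rintro m ⟨hmd, hm⟩
  have hmem : MvPolynomial.monomial m (1 : K) ∈
      Ideal.span ((fun m => (MvPolynomial.monomial m (1 : K))) '' D) :=
    (sInf_le (a := Ideal.span ((fun m => (MvPolynomial.monomial m (1 : K))) '' D))
      ⟨stronglyStable_span K D hD,
        fun x hx => Ideal.subset_span (Set.mem_image_of_mem _ (hMs hx))⟩ :
      smallestStronglyStable K Ms ≤ _) hm
  rw [MvPolynomial.mem_ideal_span_monomial_image] at hmem
  obtain ⟨m', hm', hle⟩ := hmem m (by simp [MvPolynomial.mem_support_iff])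
  have hdm : m.degree = d := hmd
  have hsum : (m - m').degree + m'.degree = m.degree := by
    rw [← map_add, tsub_add_cancel_of_le hle]
  have h0 : m - m' = 0 := by
    rw [← Finsupp.degree_eq_zero_iff]
    have := hdeg m' hm'
    omega
  rwa [le_antisymm hle (tsub_eq_zero_iff_le.mp h0)] at hm'

theorem minGens_Iex17_1 (K : Type) [Field K] (a : ℕ) (m : Fin 6 →₀ ℕ)
    (hm : m ∈ MinGens (Iex17_1 K a) (a + 2)) :
    m.degree = a + 2 ∧ suffixSum 5 m ≤ a ∧ (suffixSum 3 m ≤ a ∨ suffixSum 1 m ≤ a + 1) := by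
  refine minGens_smallestStronglyStable_subset K (D := {m | m.degree = a + 2 ∧
    suffixSum 5 m ≤ a ∧ (suffixSum 3 m ≤ a ∨ suffixSum 1 m ≤ a + 1)}) ?_
    (fun m hm => hm.1) ?_ hm
  · rintro x (rfl | rfl) <;>
      simp [suffixSum_add, suffixSum_single, Finsupp.degree_single] <;> omega
  · rintro m ⟨h, h5, h'⟩ i j hji hi
    have := fun k => suffixSum_swap_le k hji hi
    exact ⟨(degree_swap j hi).trans h, (this 5).trans h5,
      h'.imp (this 3).trans (this 1).trans⟩

theorem minGens_Iex17_2 (K : Type) [Field K] (b : ℕ) (m : Fin 6 →₀ ℕ)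
    (hm : m ∈ MinGens (Iex17_2 K b) (b + 2)) :
    m.degree = b + 2 ∧ suffixSum 4 m ≤ b ∧ suffixSum 3 m ≤ b + 1 ∧
      (suffixSum 3 m ≤ b ∨ suffixSum 2 m ≤ b + 1) := by
  refine minGens_smallestStronglyStable_subset K (D := {m | m.degree = b + 2 ∧
    suffixSum 4 m ≤ b ∧ suffixSum 3 m ≤ b + 1 ∧
      (suffixSum 3 m ≤ b ∨ suffixSum 2 m ≤ b + 1)}) ?_ (fun m hm => hm.1) ?_ hm
  · rintro x (rfl | rfl) <;>
      simp [suffixSum_add, suffixSum_single, Finsupp.degree_single] <;> omega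
  · rintro m ⟨h, h4, h3, h'⟩ i j hji hi
    have := fun k => suffixSum_swap_le k hji hi
    exact ⟨(degree_swap j hi).trans h, (this 4).trans h4, (this 3).trans h3,
      h'.imp (this 3).trans (this 2).trans⟩

theorem minGens_Iex17_3 (K : Type) [Field K] (c : ℕ) (m : Fin 6 →₀ ℕ)
    (hm : m ∈ MinGens (Iex17_3 K c) (c + 2)) :
    m.degree = c + 2 ∧ suffixSum 5 m ≤ c ∧ suffixSum 2 m ≤ c + 1 ∧
      (suffixSum 4 m ≤ c ∨ suffixSum 1 m ≤ c + 1) := by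
  refine minGens_smallestStronglyStable_subset K (D := {m | m.degree = c + 2 ∧
    suffixSum 5 m ≤ c ∧ suffixSum 2 m ≤ c + 1 ∧
      (suffixSum 4 m ≤ c ∨ suffixSum 1 m ≤ c + 1)}) ?_ (fun m hm => hm.1) ?_ hm
  · rintro x (rfl | rfl) <;>
      simp [suffixSum_add, suffixSum_single, Finsupp.degree_single] <;> omega
  · rintro m ⟨h, h5, h2, h'⟩ i j hji hi
    have := fun k => suffixSum_swap_le k hji hi
    exact ⟨(degree_swap j hi).trans h, (this 5).trans h5, (this 2).trans h2,
      h'.imp (this 4).trans (this 1).trans⟩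

set_option maxHeartbeats 800000 in
/-- The only two factorizations of `x₁x₂x₃²x₄x₅x₆^(a+b+c)` into a product of generators of
`I₁`, `I₂` and `I₃`. -/
theorem factorization_cases (K : Type) [Field K] (a b c : ℕ) {p q r : Fin 6 →₀ ℕ}
    (hp : p ∈ MinGens (Iex17_1 K a) (a + 2)) (hq : q ∈ MinGens (Iex17_2 K b) (b + 2))
    (hr : r ∈ MinGens (Iex17_3 K c) (c + 2))
    (h : p + q + r = Finsupp.single 0 1 + Finsupp.single 1 1 + Finsupp.single 2 2 +
      Finsupp.single 3 1 + Finsupp.single 4 1 + Finsupp.single 5 (a + b + c)) :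
    (p = Finsupp.single 0 1 + Finsupp.single 4 1 + Finsupp.single 5 a ∧
        q = Finsupp.single 2 2 + Finsupp.single 5 b ∧
        r = Finsupp.single 1 1 + Finsupp.single 3 1 + Finsupp.single 5 c) ∨
      (p = Finsupp.single 2 2 + Finsupp.single 5 a ∧
        q = Finsupp.single 1 1 + Finsupp.single 3 1 + Finsupp.single 5 b ∧
        r = Finsupp.single 0 1 + Finsupp.single 4 1 + Finsupp.single 5 c) := by
  have hs1 : ∀ m : Fin 6 →₀ ℕ, suffixSum 1 m = m 1 + m 2 + m 3 + m 4 + m 5 := fun m => by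
    rw [suffixSum, show Finset.Ici (1 : Fin 6) = {1, 2, 3, 4, 5} by decide]; simp; ring
  have hs2 : ∀ m : Fin 6 →₀ ℕ, suffixSum 2 m = m 2 + m 3 + m 4 + m 5 := fun m => by
    rw [suffixSum, show Finset.Ici (2 : Fin 6) = {2, 3, 4, 5} by decide]; simp; ring
  have hs3 : ∀ m : Fin 6 →₀ ℕ, suffixSum 3 m = m 3 + m 4 + m 5 := fun m => by
    rw [suffixSum, show Finset.Ici (3 : Fin 6) = {3, 4, 5} by decide]; simp; ring
  have hs4 : ∀ m : Fin 6 →₀ ℕ, suffixSum 4 m = m 4 + m 5 := fun m => by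
    rw [suffixSum, show Finset.Ici (4 : Fin 6) = {4, 5} by decide]; simp
  have hs5 : ∀ m : Fin 6 →₀ ℕ, suffixSum 5 m = m 5 := fun m => by
    rw [suffixSum, show Finset.Ici (5 : Fin 6) = {5} by decide]; simp
  have hdeg : ∀ m : Fin 6 →₀ ℕ, m.degree = m 0 + m 1 + m 2 + m 3 + m 4 + m 5 := fun m => by
    rw [Finsupp.degree_eq_sum, Fin.sum_univ_six]
  obtain ⟨p1, p2, p3⟩ := minGens_Iex17_1 K a p hp
  obtain ⟨q1, q2, q3, q4⟩ := minGens_Iex17_2 K b q hq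
  obtain ⟨r1, r2, r3, r4⟩ := minGens_Iex17_3 K c r hr
  simp only [hs1, hs2, hs3, hs4, hs5, hdeg] at p1 p2 p3 q1 q2 q3 q4 r1 r2 r3 r4
  have e0 := DFunLike.congr_fun h 0
  have e1 := DFunLike.congr_fun h 1
  have e2 := DFunLike.congr_fun h 2
  have e3 := DFunLike.congr_fun h 3
  have e4 := DFunLike.congr_fun h 4
  have e5 := DFunLike.congr_fun h 5
  simp at e0 e1 e2 e3 e4 e5
  have f5 : p 5 = a ∧ q 5 = b ∧ r 5 = c := by omega
  obtain ⟨f5p, f5q, f5r⟩ := f5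
  have hext : ∀ m m' : Fin 6 →₀ ℕ, m 0 = m' 0 → m 1 = m' 1 → m 2 = m' 2 → m 3 = m' 3 →
      m 4 = m' 4 → m 5 = m' 5 → m = m' := fun m m' h0 h1 h2 h3 h4 h5 => by
    ext i
    fin_cases i <;> assumption
  have f4q : q 4 = 0 := by omega
  have f4 : p 4 = 1 ∧ r 4 = 0 ∨ p 4 = 0 ∧ r 4 = 1 := by omega
  obtain ⟨f4p, f4r⟩ | ⟨f4p, f4r⟩ := f4
  · left
    clear r4
    replace p3 := p3.resolve_left (by omega)
    obtain ⟨p0, p1, p2, p3⟩ : p 0 = 1 ∧ p 1 = 0 ∧ p 2 = 0 ∧ p 3 = 0 := by omega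
    have q3 : q 3 = 0 := by
      by_contra hq3
      replace q4 := q4.resolve_left (by omega)
      omega
    clear q4
    have r3 : r 3 = 1 := by omega
    have r2 : r 2 = 0 := by omega
    have q2 : q 2 = 2 := by omega
    obtain ⟨q0, q1, r0, r1⟩ : q 0 = 0 ∧ q 1 = 0 ∧ r 0 = 0 ∧ r 1 = 1 := by omega
    refine ⟨hext _ _ ?_ ?_ ?_ ?_ ?_ ?_, hext _ _ ?_ ?_ ?_ ?_ ?_ ?_,
      hext _ _ ?_ ?_ ?_ ?_ ?_ ?_⟩ <;>
      simp only [p0, p1, p2, p3, f4p, f5p, q0, q1, q2, q3, f4q, f5q, r0, r1, r2, r3, f4r, f5r] <;>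
      simp
  · right
    replace r4 := r4.resolve_left (by omega)
    obtain ⟨r0, r1, r2, r3⟩ : r 0 = 1 ∧ r 1 = 0 ∧ r 2 = 0 ∧ r 3 = 0 := by omega
    replace p3 : p 3 = 0 := by
      have := p3.resolve_right (by omega)
      omega
    have q3 : q 3 = 1 := by omega
    replace q4 := q4.resolve_left (by omega)
    have q2 : q 2 = 0 := by omega
    obtain ⟨q0, q1, p0, p1, p2⟩ : q 0 = 0 ∧ q 1 = 1 ∧ p 0 = 0 ∧ p 1 = 0 ∧ p 2 = 2 := by omega
    refine ⟨hext _ _ ?_ ?_ ?_ ?_ ?_ ?_, hext _ _ ?_ ?_ ?_ ?_ ?_ ?_,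
      hext _ _ ?_ ?_ ?_ ?_ ?_ ?_⟩ <;>
      simp only [p0, p1, p2, p3, f4p, f5p, q0, q1, q2, q3, f4q, f5q, r0, r1, r2, r3, f4r, f5r] <;>
      simp

theorem fiberMap_add {V W : Type*} (u : V → (W →₀ ℕ)) (S T : V →₀ ℕ) :
    fiberMap u (S + T) = fiberMap u S + fiberMap u T := by
  unfold fiberMap
  exact Finsupp.sum_add_index' (fun _ => zero_smul ..) (fun _ _ _ => add_smul ..)

theorem fiberMap_single {V W : Type*} (u : V → (W →₀ ℕ)) (v : V) :
    fiberMap u (Finsupp.single v 1) = u v := by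
  simp [fiberMap]

/-- Split off a variable of `T` whose image involves a variable `w` of the image of `T`. -/
theorem exists_single_add_of_fiberMap_ne_zero {V W : Type*} (u : V → (W →₀ ℕ)) (T : V →₀ ℕ)
    (w : W) (h : fiberMap u T w ≠ 0) :
    ∃ v T', u v w ≠ 0 ∧ T = Finsupp.single v 1 + T' := by
  classical
  rw [fiberMap, Finsupp.sum_apply, Finsupp.sum] at h
  obtain ⟨v, hv, hvw⟩ := Finset.exists_ne_zero_of_sum_ne_zero h
  refine ⟨v, T - Finsupp.single v 1, fun h0 => hvw (by simp [h0]), ?_⟩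
  rw [add_tsub_cancel_of_le]
  simpa using Nat.one_le_iff_ne_zero.mpr (Finsupp.mem_support_iff.mp hv)

/-- A polynomial in the kernel of a monomial map has zero coefficient at every monomial that
is alone in its fiber. -/
theorem coeff_eq_zero_of_fiber_subsingleton {V W K : Type*} [Field K] (u : V → (W →₀ ℕ))
    {f : MvPolynomial V K}
    (hf : MvPolynomial.aeval (fun v => MvPolynomial.monomial (u v) (1 : K)) f = 0) {T : V →₀ ℕ}
    (hT : ∀ S, fiberMap u S = fiberMap u T → S = T) : f.coeff T = 0 := by
  classical
  have h := congrArg (MvPolynomial.coeff (fiberMap u T)) hf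
  rw [MvPolynomial.aeval_def, MvPolynomial.eval₂_eq, MvPolynomial.coeff_sum,
    MvPolynomial.coeff_zero] at h
  have hterm : ∀ S : V →₀ ℕ, MvPolynomial.coeff (fiberMap u T)
      (algebraMap K (MvPolynomial W K) (f.coeff S) *
        ∏ i ∈ S.support, MvPolynomial.monomial (u i) (1 : K) ^ S i) =
      if S = T then f.coeff T else 0 := fun S => by
    have : ∏ i ∈ S.support, MvPolynomial.monomial (u i) (1 : K) ^ S i =
        MvPolynomial.monomial (fiberMap u S) 1 := by
      simp only [MvPolynomial.monomial_pow, one_pow]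
      rw [fiberMap, Finsupp.sum, MvPolynomial.monomial_sum_one]
    rw [this, MvPolynomial.algebraMap_eq, MvPolynomial.coeff_C_mul, MvPolynomial.coeff_monomial]
    by_cases hST : S = T
    · simp [hST]
    · rw [if_neg fun h => hST (hT S h), if_neg hST, mul_zero]
  simp only [hterm, Finset.sum_ite_eq'] at h
  by_contra hne
  rw [if_pos (MvPolynomial.mem_support_iff.mpr hne)] at h
  exact hne h

/-- If the fiber of `M` consists of `M` and a coprime monomial `N`, then no element of the ideal
generated by the elements of degree less than `deg M` of the kernel involves `M`. -/
theorem coeff_eq_zero_of_mem_span_of_fiber {V W K : Type*} [Field K] (u : V → (W →₀ ℕ))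
    {M N : V →₀ ℕ} (hfib : ∀ T, fiberMap u T = fiberMap u M → T = M ∨ T = N)
    (hdisj : M ⊓ N = 0) {d : ℕ} (hd : d < M.degree) {g : MvPolynomial V K}
    (hg : g ∈ Ideal.span {f : MvPolynomial V K |
      MvPolynomial.aeval (fun v => MvPolynomial.monomial (u v) (1 : K)) f = 0 ∧
        ∃ e ≤ d, f.IsHomogeneous e}) : g.coeff M = 0 := by
  classical
  obtain ⟨n, r, s, hs⟩ := Submodule.mem_span_set'.mp hg
  obtain rfl := hs
  rw [MvPolynomial.coeff_sum]
  refine Finset.sum_eq_zero fun i _ => ?_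
  obtain ⟨f, hf, e, he, hhom⟩ := s i
  rw [smul_eq_mul, MvPolynomial.coeff_mul]
  refine Finset.sum_eq_zero fun ⟨S, T⟩ hST => ?_
  rw [Finset.HasAntidiagonal.mem_antidiagonal] at hST
  dsimp only at hST ⊢
  suffices f.coeff T = 0 by rw [this, mul_zero]
  by_cases hTe : T.degree = e
  · have hS : S ≠ 0 := by
      rintro rfl
      rw [zero_add] at hST
      subst hST
      omega
    refine coeff_eq_zero_of_fiber_subsingleton u hf fun T' hT' => ?_
    have hM : fiberMap u (S + T') = fiberMap u M := by
      rw [← hST, fiberMap_add, fiberMap_add, hT']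
    rcases hfib _ hM with h | h
    · exact add_left_cancel (h.trans hST.symm)
    · exact absurd (le_antisymm (hdisj ▸ le_inf (hST ▸ le_self_add) (h ▸ le_self_add))
        zero_le) hS
  · exact hhom.coeff_eq_zero hTe

/-- The exponent vectors of the images of the variables under the toric map. -/
noncomputable def toricExponent (A B C : Set (Fin 6 →₀ ℕ)) :
    A ⊕ (B ⊕ C) → (Fin 6 ⊕ Fin 3 →₀ ℕ) :=
  Sum.elim (fun u => Finsupp.mapDomain Sum.inl (u : Fin 6 →₀ ℕ) + Finsupp.single (Sum.inr 0) 1)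
    (Sum.elim
      (fun v => Finsupp.mapDomain Sum.inl (v : Fin 6 →₀ ℕ) + Finsupp.single (Sum.inr 1) 1)
      (fun w => Finsupp.mapDomain Sum.inl (w : Fin 6 →₀ ℕ) + Finsupp.single (Sum.inr 2) 1))

theorem phi17_eq_aeval (K : Type) [Field K] (a b c : ℕ) :
    phi17 K a b c =
      MvPolynomial.aeval (fun v => MvPolynomial.monomial (toricExponent _ _ _ v) (1 : K)) := by
  unfold phi17
  congr 1
  funext v
  rcases v with v | v | v <;> rfl

theorem toricExponent_inl_apply (A B C : Set (Fin 6 →₀ ℕ)) (v : A ⊕ (B ⊕ C)) (i : Fin 6) :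
    toricExponent A B C v (Sum.inl i) =
      Sum.elim (fun u : A => (u : Fin 6 →₀ ℕ))
        (Sum.elim (fun u : B => (u : Fin 6 →₀ ℕ)) (fun u : C => (u : Fin 6 →₀ ℕ))) v i := by
  rcases v with v | v | v <;>
    simp [toricExponent, Finsupp.mapDomain_apply Sum.inl_injective]

theorem toricExponent_inr_apply (A B C : Set (Fin 6 →₀ ℕ)) (v : A ⊕ (B ⊕ C)) (i : Fin 3) :
    toricExponent A B C v (Sum.inr i) =
      Sum.elim (fun _ : A => if i = 0 then 1 else 0)
        (Sum.elim (fun _ : B => if i = 1 then 1 else 0)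
          (fun _ : C => if i = 2 then 1 else 0)) v := by
  have h : ∀ m : Fin 6 →₀ ℕ, Finsupp.mapDomain (Sum.inl : Fin 6 → Fin 6 ⊕ Fin 3) m (Sum.inr i) = 0 :=
    fun m => Finsupp.mapDomain_of_notMem_range _ _ (by simp)
  rcases v with v | v | v <;>
    simp [toricExponent, h, Finsupp.single_apply, eq_comm]

/-- A monomial whose image has degree one in each of `t₁`, `t₂`, `t₃` is a product of three
variables, one from each block. -/
theorem eq_single_add_of_fiberMap_toricExponent (A B C : Set (Fin 6 →₀ ℕ))
    {T : A ⊕ (B ⊕ C) →₀ ℕ}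
    (hT : ∀ i, fiberMap (toricExponent A B C) T (Sum.inr i) = 1) :
    ∃ (p : A) (q : B) (r : C), T = Finsupp.single (Sum.inl p) 1 +
      Finsupp.single (Sum.inr (Sum.inl q)) 1 + Finsupp.single (Sum.inr (Sum.inr r)) 1 := by
  have split : ∀ S i, fiberMap (toricExponent A B C) S (Sum.inr i) ≠ 0 →
      ∃ v S', toricExponent A B C v (Sum.inr i) ≠ 0 ∧ S = Finsupp.single v 1 + S' ∧
        ∀ j, fiberMap (toricExponent A B C) S j =
          toricExponent A B C v j + fiberMap (toricExponent A B C) S' j := fun S i h => by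
    obtain ⟨v, S', hv, rfl⟩ := exists_single_add_of_fiberMap_ne_zero _ _ _ h
    exact ⟨v, S', hv, rfl, fun j => by rw [fiberMap_add, fiberMap_single, Finsupp.add_apply]⟩
  obtain ⟨v, T₁, hv, rfl, h₁⟩ := split T 0 (by simp [hT])
  obtain ⟨p, rfl⟩ : ∃ p, v = Sum.inl p := by
    rcases v with v | v | v <;> simp [toricExponent_inr_apply] at hv ⊢
  have h₁' : ∀ i, fiberMap (toricExponent A B C) T₁ (Sum.inr i) = if i = 0 then 0 else 1 :=
    fun i => by
      have := h₁ (Sum.inr i)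
      rw [hT, toricExponent_inr_apply, Sum.elim_inl] at this
      split_ifs at this ⊢ <;> omega
  obtain ⟨v, T₂, hv, rfl, h₂⟩ := split T₁ 1 (by simp [h₁'])
  obtain ⟨q, rfl⟩ : ∃ q, v = Sum.inr (Sum.inl q) := by
    rcases v with v | v | v <;> simp [toricExponent_inr_apply] at hv ⊢
  have h₂' : ∀ i, fiberMap (toricExponent A B C) T₂ (Sum.inr i) = if i = 2 then 1 else 0 :=
    fun i => by
      have := h₂ (Sum.inr i)
      rw [h₁', toricExponent_inr_apply, Sum.elim_inr, Sum.elim_inl] at this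
      fin_cases i <;> simp at this ⊢ <;> omega
  obtain ⟨v, T₃, hv, rfl, h₃⟩ := split T₂ 2 (by simp [h₂'])
  obtain ⟨r, rfl⟩ : ∃ r, v = Sum.inr (Sum.inr r) := by
    rcases v with v | v | v <;> simp [toricExponent_inr_apply] at hv ⊢
  have h₃' : ∀ i, fiberMap (toricExponent A B C) T₃ (Sum.inr i) = 0 := fun i => by
    have := h₃ (Sum.inr i)
    rw [h₂', toricExponent_inr_apply, Sum.elim_inr, Sum.elim_inr] at this
    omega
  have h0 : T₃ = 0 := by
    by_contra hne
    obtain ⟨v, hv⟩ := Finsupp.ne_iff.mp hne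
    have hle : Finsupp.single v 1 ≤ T₃ := by
      simpa using Nat.one_le_iff_ne_zero.mpr hv
    have hz : ∀ i, toricExponent A B C v (Sum.inr i) = 0 := fun i => by
      have := h₃' i
      rw [← add_tsub_cancel_of_le hle, fiberMap_add, fiberMap_single, Finsupp.add_apply] at this
      omega
    have z0 := hz 0
    have z1 := hz 1
    have z2 := hz 2
    rcases v with v | v | v <;> simp [toricExponent_inr_apply] at z0 z1 z2
  exact ⟨p, q, r, by rw [h0, add_zero, add_assoc]⟩

/-- For `I₁ = B(x₃²x₆^a, x₁x₅x₆^a)`, `I₂ = B(x₃²x₆^b, x₂x₄x₆^b)`,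
`I₃ = B(x₂x₄x₆^c, x₁x₅x₆^c)`, the cubic binomial
`F = T^{(1)}_{x₁x₅x₆^a} T^{(2)}_{x₃²x₆^b} T^{(3)}_{x₂x₄x₆^c} −
T^{(1)}_{x₃²x₆^a} T^{(2)}_{x₂x₄x₆^b} T^{(3)}_{x₁x₅x₆^c}` lies in the toric ideal
`T(I₁ ⊕ I₂ ⊕ I₃)` but not in the ideal generated by its homogeneous elements of degree
at most `2`; hence the toric ideal has a minimal generator of degree `3`. -/
theorem toric_cubic_generator_three_ideals (K : Type) [Field K] (a b c : ℕ)
    (v1 : ↥(MinGens (Iex17_1 K a) (a + 2)))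
    (hv1 : (v1 : Fin 6 →₀ ℕ) =
      Finsupp.single (0 : Fin 6) 1 + Finsupp.single 4 1 + Finsupp.single 5 a)
    (v4 : ↥(MinGens (Iex17_1 K a) (a + 2)))
    (hv4 : (v4 : Fin 6 →₀ ℕ) = Finsupp.single (2 : Fin 6) 2 + Finsupp.single 5 a)
    (v2 : ↥(MinGens (Iex17_2 K b) (b + 2)))
    (hv2 : (v2 : Fin 6 →₀ ℕ) = Finsupp.single (2 : Fin 6) 2 + Finsupp.single 5 b)
    (v5 : ↥(MinGens (Iex17_2 K b) (b + 2)))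
    (hv5 : (v5 : Fin 6 →₀ ℕ) =
      Finsupp.single (1 : Fin 6) 1 + Finsupp.single 3 1 + Finsupp.single 5 b)
    (v3 : ↥(MinGens (Iex17_3 K c) (c + 2)))
    (hv3 : (v3 : Fin 6 →₀ ℕ) =
      Finsupp.single (1 : Fin 6) 1 + Finsupp.single 3 1 + Finsupp.single 5 c)
    (v6 : ↥(MinGens (Iex17_3 K c) (c + 2)))
    (hv6 : (v6 : Fin 6 →₀ ℕ) =
      Finsupp.single (0 : Fin 6) 1 + Finsupp.single 4 1 + Finsupp.single 5 c) :
    (MvPolynomial.X (Sum.inl v1) * MvPolynomial.X (Sum.inr (Sum.inl v2)) *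
          MvPolynomial.X (Sum.inr (Sum.inr v3)) -
        MvPolynomial.X (Sum.inl v4) * MvPolynomial.X (Sum.inr (Sum.inl v5)) *
          MvPolynomial.X (Sum.inr (Sum.inr v6))) ∈
        RingHom.ker (phi17 K a b c).toRingHom ∧
      (MvPolynomial.X (Sum.inl v1) * MvPolynomial.X (Sum.inr (Sum.inl v2)) *
          MvPolynomial.X (Sum.inr (Sum.inr v3)) -
        MvPolynomial.X (Sum.inl v4) * MvPolynomial.X (Sum.inr (Sum.inl v5)) *
          MvPolynomial.X (Sum.inr (Sum.inr v6))) ∉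
        Ideal.span {f | f ∈ RingHom.ker (phi17 K a b c).toRingHom ∧
          ∃ e : ℕ, e ≤ 2 ∧ MvPolynomial.IsHomogeneous f e} := by
  set u := toricExponent (MinGens (Iex17_1 K a) (a + 2)) (MinGens (Iex17_2 K b) (b + 2))
    (MinGens (Iex17_3 K c) (c + 2)) with hu
  set M : _ →₀ ℕ := Finsupp.single (Sum.inl v1) 1 +
    Finsupp.single (Sum.inr (Sum.inl v2)) 1 + Finsupp.single (Sum.inr (Sum.inr v3)) 1 with hM
  set N : _ →₀ ℕ := Finsupp.single (Sum.inl v4) 1 +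
    Finsupp.single (Sum.inr (Sum.inl v5)) 1 + Finsupp.single (Sum.inr (Sum.inr v6)) 1 with hN
  have hne1 : v1 ≠ v4 := fun h => by
    simpa [hv1, hv4] using DFunLike.congr_fun (congrArg Subtype.val h) 0
  have hne2 : v2 ≠ v5 := fun h => by
    simpa [hv2, hv5] using DFunLike.congr_fun (congrArg Subtype.val h) 1
  have hne3 : v3 ≠ v6 := fun h => by
    simpa [hv3, hv6] using DFunLike.congr_fun (congrArg Subtype.val h) 0
  have hdisj : M ⊓ N = 0 := by
    classical
    ext v
    rw [Finsupp.inf_apply, Finsupp.zero_apply]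
    rcases v with v | v | v <;> simp [hM, hN, Finsupp.single_apply] <;> grind
  have hfibM : fiberMap u M = u (Sum.inl v1) +
      u (Sum.inr (Sum.inl v2)) +
      u (Sum.inr (Sum.inr v3)) := by
    simp only [hM, fiberMap_add, fiberMap_single]
  have hfib : ∀ T, fiberMap u T = fiberMap u M →
      T = M ∨ T = N := by
    intro T hT
    obtain ⟨p, q, r, rfl⟩ := eq_single_add_of_fiberMap_toricExponent _ _ _ (T := T) fun i => by
      rw [hT, hfibM]
      simp only [hu, Finsupp.add_apply, toricExponent_inr_apply, Sum.elim_inl, Sum.elim_inr]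
      fin_cases i <;> simp
    have hsum : (p : Fin 6 →₀ ℕ) + q + r = v1 + v2 + v3 := by
      ext i
      have := DFunLike.congr_fun hT (Sum.inl i)
      rw [hfibM] at this
      simpa [hu, fiberMap_add, fiberMap_single, toricExponent_inl_apply] using this
    rcases factorization_cases K a b c p.2 q.2 r.2 (by
      rw [hsum, hv1, hv2, hv3, Finsupp.single_add, Finsupp.single_add]
      abel) with ⟨h1, h2, h3⟩ | ⟨h1, h2, h3⟩
    · left
      rw [hM, Subtype.ext (h1.trans hv1.symm), Subtype.ext (h2.trans hv2.symm),
        Subtype.ext (h3.trans hv3.symm)]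
    · right
      rw [hN, Subtype.ext (h1.trans hv4.symm), Subtype.ext (h2.trans hv5.symm),
        Subtype.ext (h3.trans hv6.symm)]
  have hker : ∀ f, f ∈ RingHom.ker (phi17 K a b c).toRingHom ↔ MvPolynomial.aeval
      (fun v => MvPolynomial.monomial (u v) (1 : K)) f = 0 := fun f => by
    rw [RingHom.mem_ker, ← phi17_eq_aeval]
    rfl
  have hF : (MvPolynomial.X (Sum.inl v1) * MvPolynomial.X (Sum.inr (Sum.inl v2)) *
          MvPolynomial.X (Sum.inr (Sum.inr v3)) -
        MvPolynomial.X (Sum.inl v4) * MvPolynomial.X (Sum.inr (Sum.inl v5)) *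
          MvPolynomial.X (Sum.inr (Sum.inr v6)) : MvPolynomial _ K) =
      MvPolynomial.monomial M 1 - MvPolynomial.monomial N 1 := by
    simp only [MvPolynomial.X, MvPolynomial.monomial_mul, mul_one, hM, hN]
  constructor
  · rw [hker]
    simp only [map_sub, map_mul, MvPolynomial.aeval_X, MvPolynomial.monomial_mul, mul_one]
    rw [sub_eq_zero]
    congr 1
    simp only [hu, toricExponent, Sum.elim_inl, Sum.elim_inr, hv1, hv2, hv3, hv4, hv5, hv6,
      Finsupp.mapDomain_add, Finsupp.mapDomain_single]
    abel_nf
  · intro hmem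
    simp only [hker] at hmem
    have h0 := coeff_eq_zero_of_mem_span_of_fiber u hfib hdisj
      (d := 2) (by simp [hM]) hmem
    have hNM : N ≠ M := by
      rintro h
      rw [h, inf_idem] at hdisj
      simpa [hM] using DFunLike.congr_fun hdisj (Sum.inl v1)
    rw [hF, MvPolynomial.coeff_sub, MvPolynomial.coeff_monomial, MvPolynomial.coeff_monomial,
      if_pos rfl, if_neg hNM, sub_zero] at h0
    exact one_ne_zero h0
end

section
/- Let a, b be non-negative integers and, in S = K[x_1, …, x_4] over a field K, let I_1 = B(x_1^2 x_3^2 x_4^a, x_1 x_2^2 x_3 x_4^a) and I_2 = B(x_1^2 x_3^2 x_4^b, x_2^4 x_4^b). Then the cubic binomial F = (T^{(1)}_{x_1^2x_3^2x_4^a})^2 · T^{(2)}_{x_2^4x_4^b} − (T^{(1)}_{x_1x_2^2x_3x_4^a})^2 · T^{(2)}_{x_1^2x_3^2x_4^b} belongs to the toric ideal T(I_1 ⊕ I_2), but F does not belong to the ideal generated by the homogeneous elements of T(I_1 ⊕ I_2) of degree at most 2; hence T(I_1 ⊕ I_2) has a minimal generator of degree 3. -/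
/-- `I₁ = B(x₁²x₃²x₄^a, x₁x₂²x₃x₄^a)` in `K[x₁, …, x₄]`. -/
noncomputable def Iex18_1 (K : Type) [Field K] (a : ℕ) : Ideal (MvPolynomial (Fin 4) K) :=
  smallestStronglyStable K
    {Finsupp.single (0 : Fin 4) 2 + Finsupp.single 2 2 + Finsupp.single 3 a,
     Finsupp.single (0 : Fin 4) 1 + Finsupp.single 1 2 + Finsupp.single 2 1 +
       Finsupp.single 3 a}

/-- `I₂ = B(x₁²x₃²x₄^b, x₂⁴x₄^b)` in `K[x₁, …, x₄]`. -/
noncomputable def Iex18_2 (K : Type) [Field K] (b : ℕ) : Ideal (MvPolynomial (Fin 4) K) :=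
  smallestStronglyStable K
    {Finsupp.single (0 : Fin 4) 2 + Finsupp.single 2 2 + Finsupp.single 3 b,
     Finsupp.single (1 : Fin 4) 4 + Finsupp.single 3 b}

/-- The toric map `T^{(i)}_u ↦ u·t_i` for the pair `I₁, I₂`. -/
noncomputable def phi18 (K : Type) [Field K] (a b : ℕ) :
    MvPolynomial (↥(MinGens (Iex18_1 K a) (a + 4)) ⊕ ↥(MinGens (Iex18_2 K b) (b + 4))) K
      →ₐ[K] MvPolynomial (Fin 4 ⊕ Fin 2) K :=
  MvPolynomial.aeval (Sum.elim
    (fun u => MvPolynomial.monomial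
      (Finsupp.mapDomain Sum.inl (u : Fin 4 →₀ ℕ) + Finsupp.single (Sum.inr 0) 1) 1)
    (fun v => MvPolynomial.monomial
      (Finsupp.mapDomain Sum.inl (v : Fin 4 →₀ ℕ) + Finsupp.single (Sum.inr 1) 1) 1))

/-- A monomial of the smallest strongly stable ideal containing the monomials in `Ms` lies in
every set of monomials that contains `Ms` and is closed under multiplication and Borel moves. -/
theorem mem_of_monomial_mem_smallestStronglyStable {n : ℕ} {K : Type*} [Field K]
    {Ms M : Set (Fin n →₀ ℕ)} (hMs : Ms ⊆ M) (hup : ∀ m ∈ M, ∀ m', m ≤ m' → m' ∈ M)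
    (hborel : ∀ m ∈ M, ∀ i j : Fin n, j < i → m i ≠ 0 →
      m - Finsupp.single i 1 + Finsupp.single j 1 ∈ M)
    {m : Fin n →₀ ℕ} (hm : MvPolynomial.monomial m (1 : K) ∈ smallestStronglyStable K Ms) :
    m ∈ M := by
  have key : ∀ m : Fin n →₀ ℕ, MvPolynomial.monomial m (1 : K) ∈
      Ideal.span ((fun m => (MvPolynomial.monomial m (1 : K))) '' M) ↔ m ∈ M := by
    intro m
    constructor
    · intro h
      rw [MvPolynomial.mem_ideal_span_monomial_image] at h
      obtain ⟨m', hm', hle⟩ := h m (by classical simp [MvPolynomial.support_monomial])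
      exact hup m' hm' m hle
    · intro h
      exact Ideal.subset_span ⟨m, h, rfl⟩
  rw [smallestStronglyStable, Submodule.mem_sInf] at hm
  refine (key m).1 (hm _ ⟨⟨⟨M, rfl⟩, ?_⟩, ?_⟩)
  · intro m hm i j hij hmi
    exact (key _).2 (hborel m ((key m).1 hm) i j hij hmi)
  · intro m hm
    exact (key m).2 (hMs hm)

theorem aeval_monomial_monomial {V W R : Type*} [CommSemiring R] (w : V → (W →₀ ℕ))
    (d : V →₀ ℕ) (r : R) :
    MvPolynomial.aeval (fun v => MvPolynomial.monomial (w v) (1 : R))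
      (MvPolynomial.monomial d r) =
      MvPolynomial.monomial (Finsupp.linearCombination ℕ w d) r := by
  rw [MvPolynomial.aeval_monomial, Finsupp.linearCombination_apply, Finsupp.prod, Finsupp.sum]
  simp only [MvPolynomial.monomial_pow, one_pow]
  rw [← MvPolynomial.monomial_sum_one, MvPolynomial.algebraMap_eq, MvPolynomial.C_mul_monomial,
    mul_one]

/-- A monomial with nonzero coefficient in an element of a toric ideal shares its fiber with
another monomial of that element. -/
theorem exists_ne_of_mem_ker_aeval_monomial {V W K : Type*} [Field K] (w : V → (W →₀ ℕ))
    {g : MvPolynomial V K}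
    (hg : MvPolynomial.aeval (fun v => MvPolynomial.monomial (w v) (1 : K)) g = 0)
    {d : V →₀ ℕ} (hd : g.coeff d ≠ 0) :
    ∃ d', d' ≠ d ∧ g.coeff d' ≠ 0 ∧
      Finsupp.linearCombination ℕ w d' = Finsupp.linearCombination ℕ w d := by
  classical
  by_contra! hcon
  apply hd
  have h := congrArg (MvPolynomial.coeff (Finsupp.linearCombination ℕ w d)) hg
  rw [g.as_sum, map_sum, MvPolynomial.coeff_sum, MvPolynomial.coeff_zero] at h
  simp only [aeval_monomial_monomial, MvPolynomial.coeff_monomial] at h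
  rw [Finset.sum_eq_single d] at h
  · simpa using h
  · intro d' hd' hne
    exact if_neg (hcon d' hne (MvPolynomial.mem_support_iff.1 hd'))
  · intro hd'
    exact absurd (MvPolynomial.mem_support_iff.2 hd) hd'

/-- If the fiber of a monomial `A` consists of `A` and a coprime monomial `B` of degree greater
than `k`, then `A` does not occur in any element of the ideal generated by the elements of the
toric ideal of degree at most `k`. -/
theorem coeff_eq_zero_of_mem_span_ker {V W K : Type*} [Field K] (w : V → (W →₀ ℕ))
    {A B : V →₀ ℕ} {k : ℕ} (hdisj : ∀ c, c ≤ A → c ≤ B → c = 0) (hB : k < B.degree)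
    (hfib : ∀ c : V →₀ ℕ, c.degree = A.degree →
      Finsupp.linearCombination ℕ w c = Finsupp.linearCombination ℕ w A → c = A ∨ c = B)
    {f : MvPolynomial V K}
    (hf : f ∈ Ideal.span {f : MvPolynomial V K |
      MvPolynomial.aeval (fun v => MvPolynomial.monomial (w v) (1 : K)) f = 0 ∧
        ∃ e ≤ k, f.IsHomogeneous e}) :
    f.coeff A = 0 := by
  classical
  have hmon : ∀ (c : V →₀ ℕ) (r : K) (g : MvPolynomial V K),
      MvPolynomial.aeval (fun v => MvPolynomial.monomial (w v) (1 : K)) g = 0 →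
      (∃ e ≤ k, g.IsHomogeneous e) → (MvPolynomial.monomial c r * g).coeff A = 0 := by
    rintro c r g hg ⟨e, hek, hge⟩
    rw [MvPolynomial.coeff_monomial_mul']
    split_ifs with hcA
    · obtain ⟨d, rfl⟩ := exists_add_of_le hcA
      rw [add_tsub_cancel_left]
      by_contra hne
      have hd : g.coeff d ≠ 0 := right_ne_zero_of_mul hne
      obtain ⟨d', hd'd, hd', hw⟩ := exists_ne_of_mem_ker_aeval_monomial w hg hd
      have hde : d.degree = e := by
        rw [Finsupp.degree_eq_weight_one]; exact hge hd
      have hde' : d'.degree = e := by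
        rw [Finsupp.degree_eq_weight_one]; exact hge hd'
      rcases hfib (c + d') (by simp [hde, hde']) (by simp [hw]) with h | h
      · exact hd'd (add_left_cancel h)
      · have hc : c = 0 := hdisj c hcA (h ▸ le_self_add)
        rw [← h, hc, zero_add, hde'] at hB
        omega
    · rfl
  have hmul : ∀ p : MvPolynomial V K, (p * f).coeff A = 0 := by
    induction hf using Submodule.span_induction with
    | mem g hg =>
      intro p
      rw [p.as_sum, Finset.sum_mul, MvPolynomial.coeff_sum]
      exact Finset.sum_eq_zero fun c _ => hmon c _ g hg.1 hg.2
    | zero => simp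
    | add x y _ _ hx hy => intro p; simp [mul_add, hx p, hy p]
    | smul q x _ ih => intro p; rw [smul_eq_mul, ← mul_assoc]; exact ih (p * q)
  simpa using hmul 1

/-- The degree and partial sum conditions satisfied by the minimal generators of `I₁`. -/
theorem bounds_of_mem_minGens_one {K : Type} [Field K] {a : ℕ} {m : Fin 4 →₀ ℕ}
    (hm : m ∈ MinGens (Iex18_1 K a) (a + 4)) :
    m 0 + m 1 + m 2 + m 3 = a + 4 ∧ 4 ≤ m 0 + m 1 + m 2 ∧
      (2 ≤ m 0 ∨ 1 ≤ m 0 ∧ 3 ≤ m 0 + m 1) := by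
  have hdeg := hm.1
  rw [Finsupp.sum_fintype _ _ (fun _ => rfl)] at hdeg
  have h := mem_of_monomial_mem_smallestStronglyStable
    (M := {m : Fin 4 →₀ ℕ | 4 ≤ m 0 + m 1 + m 2 ∧ (2 ≤ m 0 ∨ 1 ≤ m 0 ∧ 3 ≤ m 0 + m 1)})
    ?_ ?_ ?_ hm.2
  · exact ⟨by simpa [Fin.sum_univ_four] using hdeg, h⟩
  · rintro m (rfl | rfl) <;> simp
  · rintro m ⟨h1, h2⟩ m' hle
    have := hle 0
    have := hle 1
    have := hle 2
    refine ⟨by omega, by omega⟩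
  · rintro m ⟨h1, h2⟩ i j hij hi
    fin_cases i <;> fin_cases j <;> simp at hij hi h1 h2 ⊢ <;> omega

/-- The degree and partial sum conditions satisfied by the minimal generators of `I₂`. -/
theorem bounds_of_mem_minGens_two {K : Type} [Field K] {b : ℕ} {m : Fin 4 →₀ ℕ}
    (hm : m ∈ MinGens (Iex18_2 K b) (b + 4)) :
    m 0 + m 1 + m 2 + m 3 = b + 4 ∧ 4 ≤ m 0 + m 1 + m 2 ∧ (2 ≤ m 0 ∨ 4 ≤ m 0 + m 1) := by
  have hdeg := hm.1
  rw [Finsupp.sum_fintype _ _ (fun _ => rfl)] at hdeg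
  have h := mem_of_monomial_mem_smallestStronglyStable
    (M := {m : Fin 4 →₀ ℕ | 4 ≤ m 0 + m 1 + m 2 ∧ (2 ≤ m 0 ∨ 4 ≤ m 0 + m 1)})
    ?_ ?_ ?_ hm.2
  · exact ⟨by simpa [Fin.sum_univ_four] using hdeg, h⟩
  · rintro m (rfl | rfl) <;> simp
  · rintro m ⟨h1, h2⟩ m' hle
    have := hle 0
    have := hle 1
    have := hle 2
    refine ⟨by omega, by omega⟩
  · rintro m ⟨h1, h2⟩ i j hij hi
    fin_cases i <;> fin_cases j <;> simp at hij hi h1 h2 ⊢ <;> omega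

/-- The exponent vector of the image of a variable under the toric map of a pair of ideals. -/
noncomputable def toricWeight {n : ℕ} (G H : Set (Fin n →₀ ℕ)) : ↥G ⊕ ↥H → (Fin n ⊕ Fin 2 →₀ ℕ) :=
  Sum.elim
    (fun u => Finsupp.mapDomain Sum.inl (u : Fin n →₀ ℕ) + Finsupp.single (Sum.inr 0) 1)
    (fun v => Finsupp.mapDomain Sum.inl (v : Fin n →₀ ℕ) + Finsupp.single (Sum.inr 1) 1)

/-- The toric map sends each variable to the monomial with its toric weight as exponent. -/
theorem phi18_eq_aeval_monomial (K : Type) [Field K] (a b : ℕ) :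
    phi18 K a b = MvPolynomial.aeval
      (fun v => MvPolynomial.monomial (toricWeight _ _ v) (1 : K)) := by
  rw [phi18]
  congr 1
  funext v
  cases v <;> rfl

@[simp]
theorem toricWeight_inl_inl {n : ℕ} (G H : Set (Fin n →₀ ℕ)) (u : ↥G) (k : Fin n) :
    toricWeight G H (Sum.inl u) (Sum.inl k) = (u : Fin n →₀ ℕ) k := by
  simp [toricWeight, Finsupp.mapDomain_apply Sum.inl_injective]

@[simp]
theorem toricWeight_inr_inl {n : ℕ} (G H : Set (Fin n →₀ ℕ)) (u : ↥H) (k : Fin n) :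
    toricWeight G H (Sum.inr u) (Sum.inl k) = (u : Fin n →₀ ℕ) k := by
  simp [toricWeight, Finsupp.mapDomain_apply Sum.inl_injective]

@[simp]
theorem toricWeight_inl_inr {n : ℕ} (G H : Set (Fin n →₀ ℕ)) (u : ↥G) (k : Fin 2) :
    toricWeight G H (Sum.inl u) (Sum.inr k) = if k = 0 then 1 else 0 := by
  simp [toricWeight, Finsupp.mapDomain_of_notMem_range, Finsupp.single_apply, eq_comm]

@[simp]
theorem toricWeight_inr_inr {n : ℕ} (G H : Set (Fin n →₀ ℕ)) (u : ↥H) (k : Fin 2) :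
    toricWeight G H (Sum.inr u) (Sum.inr k) = if k = 1 then 1 else 0 := by
  simp [toricWeight, Finsupp.mapDomain_of_notMem_range, Finsupp.single_apply, eq_comm]

theorem exists_eq_single_add_single_add_single {V : Type*} {c : V →₀ ℕ} (hc : c.degree = 3) :
    ∃ x y z, c = Finsupp.single x 1 + Finsupp.single y 1 + Finsupp.single z 1 := by
  classical
  have hcard : c.toMultiset.card = 3 := by
    rw [Finsupp.card_toMultiset]; exact hc
  obtain ⟨x, y, z, h⟩ := Multiset.card_eq_three.1 hcard
  refine ⟨x, y, z, Finsupp.orderIsoMultiset.injective ?_⟩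
  rw [Finsupp.coe_orderIsoMultiset, h]
  simp only [map_add, Finsupp.toMultiset_single, one_smul]
  rfl

/-- A cubic monomial of multidegree `t₁² t₂` has two variables of the first kind and one of
the second. -/
theorem exists_eq_inl_inl_inr {n : ℕ} {G H : Set (Fin n →₀ ℕ)} {c : ↥G ⊕ ↥H →₀ ℕ}
    (hc : c.degree = 3)
    (ht : Finsupp.linearCombination ℕ (toricWeight G H) c (Sum.inr 1) = 1) :
    ∃ p q r, c = Finsupp.single (Sum.inl p) 1 + Finsupp.single (Sum.inl q) 1 +
      Finsupp.single (Sum.inr r) 1 := by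
  obtain ⟨x, y, z, rfl⟩ := exists_eq_single_add_single_add_single hc
  rcases x with x | x <;> rcases y with y | y <;> rcases z with z | z <;>
    simp [Finsupp.linearCombination_single] at ht
  · exact ⟨x, y, z, rfl⟩
  · exact ⟨x, z, y, by abel⟩
  · exact ⟨y, z, x, by abel⟩

/-- The fiber of `F` consists of the two monomials of `F` only. -/
theorem eq_or_eq_of_cubic_relation {a b : ℕ} {p q r : Fin 4 →₀ ℕ} {K : Type} [Field K]
    (hp : p ∈ MinGens (Iex18_1 K a) (a + 4)) (hq : q ∈ MinGens (Iex18_1 K a) (a + 4))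
    (hr : r ∈ MinGens (Iex18_2 K b) (b + 4))
    (h0 : p 0 + q 0 + r 0 = 4) (h1 : p 1 + q 1 + r 1 = 4) (h2 : p 2 + q 2 + r 2 = 4)
    (h3 : p 3 + q 3 + r 3 = 2 * a + b) :
    (p = Finsupp.single 0 2 + Finsupp.single 2 2 + Finsupp.single 3 a ∧ q = p ∧
      r = Finsupp.single 1 4 + Finsupp.single 3 b) ∨
    (p = Finsupp.single 0 1 + Finsupp.single 1 2 + Finsupp.single 2 1 + Finsupp.single 3 a ∧
      q = p ∧ r = Finsupp.single 0 2 + Finsupp.single 2 2 + Finsupp.single 3 b) := by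
  obtain ⟨dp, ep, bp⟩ := bounds_of_mem_minGens_one hp
  obtain ⟨dq, eq, bq⟩ := bounds_of_mem_minGens_one hq
  obtain ⟨dr, er, br⟩ := bounds_of_mem_minGens_two hr
  rcases bp with bp | bp <;> rcases bq with bq | bq <;> rcases br with br | br <;>
    first
    | (exfalso; omega)
    | (left; refine ⟨?_, ?_, ?_⟩ <;> ext k <;> fin_cases k <;> simp <;> omega)
    | (right; refine ⟨?_, ?_, ?_⟩ <;> ext k <;> fin_cases k <;> simp <;> omega)

/-- For `I₁ = B(x₁²x₃²x₄^a, x₁x₂²x₃x₄^a)` and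
`I₂ = B(x₁²x₃²x₄^b, x₂⁴x₄^b)`, the cubic binomial
`F = (T^{(1)}_{x₁²x₃²x₄^a})² T^{(2)}_{x₂⁴x₄^b} − (T^{(1)}_{x₁x₂²x₃x₄^a})²
T^{(2)}_{x₁²x₃²x₄^b}` lies in the toric ideal `T(I₁ ⊕ I₂)` but not in the ideal
generated by its homogeneous elements of degree at most `2`; hence the toric ideal has a
minimal generator of degree `3`. -/
theorem toric_cubic_generator_two_ideals_deg_ge_four (K : Type) [Field K] (a b : ℕ)
    (v1 : ↥(MinGens (Iex18_1 K a) (a + 4)))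
    (hv1 : (v1 : Fin 4 →₀ ℕ) =
      Finsupp.single (0 : Fin 4) 2 + Finsupp.single 2 2 + Finsupp.single 3 a)
    (v2 : ↥(MinGens (Iex18_1 K a) (a + 4)))
    (hv2 : (v2 : Fin 4 →₀ ℕ) =
      Finsupp.single (0 : Fin 4) 1 + Finsupp.single 1 2 + Finsupp.single 2 1 +
        Finsupp.single 3 a)
    (w1 : ↥(MinGens (Iex18_2 K b) (b + 4)))
    (hw1 : (w1 : Fin 4 →₀ ℕ) =
      Finsupp.single (0 : Fin 4) 2 + Finsupp.single 2 2 + Finsupp.single 3 b)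
    (w2 : ↥(MinGens (Iex18_2 K b) (b + 4)))
    (hw2 : (w2 : Fin 4 →₀ ℕ) = Finsupp.single (1 : Fin 4) 4 + Finsupp.single 3 b) :
    (MvPolynomial.X (Sum.inl v1) ^ 2 * MvPolynomial.X (Sum.inr w2) -
        MvPolynomial.X (Sum.inl v2) ^ 2 * MvPolynomial.X (Sum.inr w1)) ∈
        RingHom.ker (phi18 K a b).toRingHom ∧
      (MvPolynomial.X (Sum.inl v1) ^ 2 * MvPolynomial.X (Sum.inr w2) -
        MvPolynomial.X (Sum.inl v2) ^ 2 * MvPolynomial.X (Sum.inr w1)) ∉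
        Ideal.span {f | f ∈ RingHom.ker (phi18 K a b).toRingHom ∧
          ∃ e : ℕ, e ≤ 2 ∧ MvPolynomial.IsHomogeneous f e} := by
  have hF : (MvPolynomial.X (Sum.inl v1) ^ 2 * MvPolynomial.X (Sum.inr w2) -
      MvPolynomial.X (Sum.inl v2) ^ 2 * MvPolynomial.X (Sum.inr w1) :
        MvPolynomial (↥(MinGens (Iex18_1 K a) (a + 4)) ⊕ ↥(MinGens (Iex18_2 K b) (b + 4))) K) =
      MvPolynomial.monomial (Finsupp.single (Sum.inl v1) 2 + Finsupp.single (Sum.inr w2) 1) 1 -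
      MvPolynomial.monomial
        (Finsupp.single (Sum.inl v2) 2 + Finsupp.single (Sum.inr w1) 1) 1 := by
    simp only [MvPolynomial.X, MvPolynomial.monomial_pow, MvPolynomial.monomial_mul,
      Finsupp.smul_single, one_pow, mul_one, smul_eq_mul]
  have hv : v1 ≠ v2 := by
    rintro rfl
    simpa [Finsupp.single_apply] using DFunLike.congr_fun (hv1.symm.trans hv2) 0
  have hw : w1 ≠ w2 := by
    rintro rfl
    simpa [Finsupp.single_apply] using DFunLike.congr_fun (hw1.symm.trans hw2) 0
  rw [hF]
  constructor
  · change phi18 K a b _ = 0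
    rw [phi18_eq_aeval_monomial, map_sub, aeval_monomial_monomial, aeval_monomial_monomial,
      sub_eq_zero]
    refine congrArg (fun d => MvPolynomial.monomial d (1 : K)) (Finsupp.ext fun k => ?_)
    rcases k with k | k
    · simp only [map_add, Finsupp.linearCombination_single, Finsupp.add_apply,
        Finsupp.smul_apply, toricWeight_inl_inl, toricWeight_inr_inl, hv1, hv2, hw1, hw2]
      fin_cases k <;> simp
    · simp [Finsupp.linearCombination_single]
  · intro hmem
    have hcoeff := coeff_eq_zero_of_mem_span_ker (toricWeight _ _) (k := 2)
      (A := Finsupp.single (Sum.inl v1) 2 + Finsupp.single (Sum.inr w2) 1)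
      (B := Finsupp.single (Sum.inl v2) 2 + Finsupp.single (Sum.inr w1) 1) ?_ (by simp) ?_
      (by rw [← phi18_eq_aeval_monomial]; exact hmem)
    · classical
      rw [MvPolynomial.coeff_sub, MvPolynomial.coeff_monomial, MvPolynomial.coeff_monomial,
        if_pos rfl, if_neg] at hcoeff
      · simp at hcoeff
      · intro h
        simpa [Finsupp.single_apply, hv.symm] using DFunLike.congr_fun h (Sum.inl v1)
    · intro c hA hB
      ext x
      have hAx := hA x
      have hBx := hB x
      rcases x with x | x
      · by_cases hx : v1 = x
        · subst hx
          simpa [Finsupp.single_apply, hv.symm] using hBx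
        · simpa [Finsupp.single_apply, hx] using hAx
      · by_cases hx : w2 = x
        · subst hx
          simpa [Finsupp.single_apply, hw] using hBx
        · simpa [Finsupp.single_apply, hx] using hAx
    · intro c hdeg hfib
      have happly := fun k => DFunLike.congr_fun hfib k
      obtain ⟨p, q, r, rfl⟩ := exists_eq_inl_inl_inr (c := c) (by simpa using hdeg)
        (by rw [happly]; simp [Finsupp.linearCombination_single])
      have h := fun k => happly (Sum.inl k)
      simp only [map_add, Finsupp.linearCombination_single, Finsupp.add_apply,
        Finsupp.smul_apply, toricWeight_inl_inl, toricWeight_inr_inl, hv1, hw2] at h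
      have key := eq_or_eq_of_cubic_relation p.2 q.2 r.2
        (by simpa [Finsupp.single_apply] using h 0) (by simpa [Finsupp.single_apply] using h 1)
        (by simpa [Finsupp.single_apply] using h 2) (by simpa [Finsupp.single_apply] using h 3)
      rw [← hv1, ← hv2, ← hw1, ← hw2] at key
      simp only [← Subtype.ext_iff] at key
      rcases key with ⟨rfl, rfl, rfl⟩ | ⟨rfl, rfl, rfl⟩
      · left
        rw [← Finsupp.single_add]
      · right
        rw [← Finsupp.single_add]
end
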